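/- For every q ≥ 1, the infinite-volume FK-percolation measure on the upper half-plane H with Dobrushin boundary conditions at the self-dual point p_c(q) = √q/(1+√q) satisfies φ^{1/0}_{H,p_c(q),q}[0 ↔ ∞] = 0: the origin is almost surely not in an infinite cluster. -/

import Mathlib

open MeasureTheory ProbabilityTheory Filter
open scoped ENNReal

noncomputable section

namespace FK

/-- Ambient vertex set: points of the plane with integer coordinates. -/
abbrev V : Type := ℤ × ℤ

variable (Adj : V → V → Prop)

/-- The edge set of the graph with adjacency relation `Adj`, as unordered pairs. -/
def EdgeSet : Set (Sym2 V) := {e | ∃ u v : V, Adj u v ∧ e = s(u, v)}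

/-- Edges of the graph. -/
abbrev Edge := {e : Sym2 V // e ∈ EdgeSet Adj}

/-- A percolation configuration: each edge is open (`true`) or closed (`false`). -/
abbrev Config := Edge Adj → Bool

/-- A vertex is an endpoint of an edge. -/
def Inc (v : V) (e : Edge Adj) : Prop := v ∈ (e : Sym2 V)

/-- The vertex set of a finite set of edges. -/
def vertexSet (D : Finset (Edge Adj)) : Set V := {v | ∃ e ∈ D, Inc Adj v e}

open Classical in
/-- The degree of a vertex in a finite set of edges. -/
def degree (D : Finset (Edge Adj)) (v : V) : ℕ :=
  (D.filter fun e => Inc Adj v e).card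

/-- Boundary of a finite domain: its vertices of degree less than `maxDeg`
(the degree of the full lattice). -/
def bdry (maxDeg : ℕ) (D : Finset (Edge Adj)) : Set V :=
  {v | v ∈ vertexSet Adj D ∧ degree Adj D v < maxDeg}

/-- `u` and `v` are connected by a path of `ω`-open edges, all belonging to `S`. -/
def ConnectedIn (ω : Config Adj) (S : Set (Edge Adj)) (u v : V) : Prop :=
  Relation.ReflTransGen
    (fun a b => ∃ e : Edge Adj, e ∈ S ∧ ω e = true ∧ Inc Adj a e ∧ Inc Adj b e) u v

/-- `u` lies in an infinite cluster of `ω` restricted to the edges of `S`. -/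
def InfCluster (ω : Config Adj) (S : Set (Edge Adj)) (u : V) : Prop :=
  {v | ConnectedIn Adj ω S u v}.Infinite

/-- The set of edges whose endpoints all belong to the region `S`. -/
def edgesInRegion (S : Set V) : Set (Edge Adj) := {e | ∀ v ∈ (e : Sym2 V), v ∈ S}

/-- The boundary condition induced on `D` by the configuration outside of `D`:
two boundary vertices are wired iff they are connected outside of `D`,
or both belong to infinite clusters of the configuration outside of `D`. -/
def inducedBC (maxDeg : ℕ) (D : Finset (Edge Adj)) (ω : Config Adj) :
    Setoid (bdry Adj maxDeg D) :=
  Relation.EqvGen.setoid fun u v =>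
    ConnectedIn Adj ω {e | e ∉ D} u.1 v.1 ∨
      (InfCluster Adj ω {e | e ∉ D} u.1 ∧ InfCluster Adj ω {e | e ∉ D} v.1)

/-- Extension of a local configuration on `D` by closed edges. -/
def extendBy (D : Finset (Edge Adj)) (η : {e // e ∈ D} → Bool) : Config Adj :=
  fun e => if h : e ∈ D then η ⟨e, h⟩ else false

open Classical in
/-- Number of open edges of a local configuration. -/
def openCount (D : Finset (Edge Adj)) (η : {e // e ∈ D} → Bool) : ℕ :=
  (Finset.univ.filter fun e : {e // e ∈ D} => η e = true).card

/-- The number of clusters of the configuration `ω` in the domain `D`, where boundary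
vertices wired together by `ξ` are identified. -/
def clusterCount (maxDeg : ℕ) (D : Finset (Edge Adj)) (ξ : Setoid (bdry Adj maxDeg D))
    (ω : Config Adj) : ℕ :=
  Nat.card (Quot fun u v : vertexSet Adj D =>
    (∃ e ∈ D, ω e = true ∧ Inc Adj u.1 e ∧ Inc Adj v.1 e) ∨
      ∃ hu : u.1 ∈ bdry Adj maxDeg D, ∃ hv : v.1 ∈ bdry Adj maxDeg D,
        ξ.r ⟨u.1, hu⟩ ⟨v.1, hv⟩)

/-- The FK-percolation weight of a local configuration `η` on the domain `D` with
boundary condition `ξ`. -/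
def fkWeight (p q : ℝ) (maxDeg : ℕ) (D : Finset (Edge Adj)) (ξ : Setoid (bdry Adj maxDeg D))
    (η : {e // e ∈ D} → Bool) : ℝ :=
  (p / (1 - p)) ^ openCount Adj D η * q ^ clusterCount Adj maxDeg D ξ (extendBy Adj D η)

/-- The finite-volume FK-percolation measure on the domain `D` with edge-intensity `p`,
cluster-weight `q` and boundary condition `ξ`. -/
def fkFin (p q : ℝ) (maxDeg : ℕ) (D : Finset (Edge Adj)) (ξ : Setoid (bdry Adj maxDeg D)) :
    Measure ({e // e ∈ D} → Bool) :=
  (∑ η : {e // e ∈ D} → Bool, ENNReal.ofReal (fkWeight Adj p q maxDeg D ξ η))⁻¹ •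
    ∑ η : {e // e ∈ D} → Bool,
      ENNReal.ofReal (fkWeight Adj p q maxDeg D ξ η) • Measure.dirac η

/-- Restriction of a configuration to the edges of `D`. -/
def restrictD (D : Finset (Edge Adj)) (ω : Config Adj) : {e // e ∈ D} → Bool := fun e => ω e.1

/-- The event `B` depends only on the edges outside of `D`. -/
def DependsOutside (D : Finset (Edge Adj)) (B : Set (Config Adj)) : Prop :=
  ∀ ω ω' : Config Adj, (∀ e : Edge Adj, e ∉ D → ω e = ω' e) → (ω ∈ B ↔ ω' ∈ B)

/-- `φ` is a Gibbs measure for FK-percolation with parameters `(p, q)`: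
for every finite domain `D` and boundary condition `ξ`, conditionally on the event that
the configuration outside `D` induces the boundary condition `ξ` and on any event
measurable with respect to the edges outside of `D`, the restriction of `φ` to `D`
is the finite-volume FK-percolation measure with boundary condition `ξ`. -/
def IsGibbs (maxDeg : ℕ) (p q : ℝ) (φ : Measure (Config Adj)) : Prop :=
  IsProbabilityMeasure φ ∧
    ∀ (D : Finset (Edge Adj)) (ξ : Setoid (bdry Adj maxDeg D)) (B : Set (Config Adj)),
      MeasurableSet B → DependsOutside Adj D B →
      φ ({ω | inducedBC Adj maxDeg D ω = ξ} ∩ B) ≠ 0 →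
      (φ[|{ω | inducedBC Adj maxDeg D ω = ξ} ∩ B]).map (restrictD Adj D) =
        fkFin Adj p q maxDeg D ξ

/-- The cylinder event prescribing the configuration on the edges of `D`. -/
def cylinder (D : Finset (Edge Adj)) (η : {e // e ∈ D} → Bool) : Set (Config Adj) :=
  {ω | ∀ e : {e // e ∈ D}, ω e.1 = η e}

/-- Weak convergence of measures on configurations: convergence of the probabilities of
all cylinder events. -/
def WeakLim (μs : ℕ → Measure (Config Adj)) (μ : Measure (Config Adj)) : Prop :=
  ∀ (D : Finset (Edge Adj)) (η : {e // e ∈ D} → Bool),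
    Tendsto (fun k => μs k (cylinder Adj D η)) atTop (nhds (μ (cylinder Adj D η)))

/-- A sequence of finite domains increasing to the full lattice. -/
def IsExhaustion (Dseq : ℕ → Finset (Edge Adj)) : Prop :=
  Monotone Dseq ∧ ∀ e : Edge Adj, ∃ k, e ∈ Dseq k

/-- `φ` is the free infinite-volume FK measure: the weak limit of finite-volume measures
with free boundary conditions along any exhaustion. -/
def IsFreeLimit (maxDeg : ℕ) (p q : ℝ) (φ : Measure (Config Adj)) : Prop :=
  IsProbabilityMeasure φ ∧
    ∀ Dseq : ℕ → Finset (Edge Adj), IsExhaustion Adj Dseq →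
      WeakLim Adj
        (fun k => (fkFin Adj p q maxDeg (Dseq k) ⊥).map (extendBy Adj (Dseq k))) φ

/-- `φ` is the wired infinite-volume FK measure: the weak limit of finite-volume measures
with wired boundary conditions along any exhaustion. -/
def IsWiredLimit (maxDeg : ℕ) (p q : ℝ) (φ : Measure (Config Adj)) : Prop :=
  IsProbabilityMeasure φ ∧
    ∀ Dseq : ℕ → Finset (Edge Adj), IsExhaustion Adj Dseq →
      WeakLim Adj
        (fun k => (fkFin Adj p q maxDeg (Dseq k) ⊤).map (extendBy Adj (Dseq k))) φ

/-- Tail triviality: every event depending on no finite set of edges has probability 0 or 1. -/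
def TailTrivial (φ : Measure (Config Adj)) : Prop :=
  ∀ B : Set (Config Adj), MeasurableSet B →
    (∀ D : Finset (Edge Adj), DependsOutside Adj D B) → φ B = 0 ∨ φ B = 1


open Classical in
/-- The finite set of edges of the graph with both endpoints in the finite vertex set `W`. -/
def finEdgesIn (W : Finset V) : Finset (Edge Adj) :=
  (((W ×ˢ W).filter fun p => Adj p.1 p.2).image fun p => s(p.1, p.2)).subtype
    (· ∈ EdgeSet Adj)

/-- Adjacency of the square lattice `L`: vertices with even coordinate sum at
euclidean distance `√2`. -/
def AdjL (u v : V) : Prop :=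
  Even (u.1 + u.2) ∧ Even (v.1 + v.2) ∧ (u.1 - v.1) ^ 2 = 1 ∧ (u.2 - v.2) ^ 2 = 1

end FK

namespace FK

/-! ### Additional structure on the square lattice: translations, duality, half-planes,
boxes and slit domains. -/

/-- Translation vectors of the square lattice `L`. -/
def IsLatticeVec (t : V) : Prop := Even (t.1 + t.2)

/-- Translation of the plane by `t`. -/
def shiftV (t : V) (v : V) : V := (v.1 + t.1, v.2 + t.2)

lemma adjL_shift {t : V} (ht : IsLatticeVec t) {u v : V} (h : AdjL u v) :
    AdjL (shiftV t u) (shiftV t v) := by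
  obtain ⟨hu, hv, h1, h2⟩ := h
  refine ⟨?_, ?_, ?_, ?_⟩
  · have e : (u.1 + t.1) + (u.2 + t.2) = (u.1 + u.2) + (t.1 + t.2) := by ring
    exact e ▸ hu.add ht
  · have e : (v.1 + t.1) + (v.2 + t.2) = (v.1 + v.2) + (t.1 + t.2) := by ring
    exact e ▸ hv.add ht
  · have e : (u.1 + t.1) - (v.1 + t.1) = u.1 - v.1 := by ring
    exact e ▸ h1
  · have e : (u.2 + t.2) - (v.2 + t.2) = u.2 - v.2 := by ring
    exact e ▸ h2

lemma edgeSet_shift {t : V} (ht : IsLatticeVec t) {e : Sym2 V} (he : e ∈ EdgeSet AdjL) :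
    Sym2.map (shiftV t) e ∈ EdgeSet AdjL := by
  obtain ⟨u, v, huv, rfl⟩ := he
  exact ⟨shiftV t u, shiftV t v, adjL_shift ht huv, by rw [Sym2.map_pair_eq]⟩

/-- Translation of an edge of the square lattice by a lattice vector. -/
def shiftEdge (t : V) (ht : IsLatticeVec t) (e : Edge AdjL) : Edge AdjL :=
  ⟨Sym2.map (shiftV t) e.1, edgeSet_shift ht e.2⟩

/-- The shift of a configuration by a lattice vector. -/
def Shift (t : V) (ht : IsLatticeVec t) (ω : Config AdjL) : Config AdjL :=
  fun e => ω (shiftEdge t ht e)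

/-- Dual vertices: points with odd coordinate sum, i.e. vertices of `L* = L + (1,0)`. -/
def IsDualV (w : V) : Prop := Odd (w.1 + w.2)

/-- The primal edge crossed by the dual edge joining the dual vertices `w` and `w'`. -/
def crossSym (w w' : V) : Sym2 V := s(((w.1, w'.2) : V), ((w'.1, w.2) : V))

/-- One step of a dual-open path: `w` and `w'` are adjacent dual vertices and the primal
edge crossing the dual edge between them belongs to `S` and is closed in `ω`. -/
def DualStep (ω : Config AdjL) (S : Set (Edge AdjL)) (w w' : V) : Prop :=
  IsDualV w ∧ IsDualV w' ∧ (w.1 - w'.1) ^ 2 = 1 ∧ (w.2 - w'.2) ^ 2 = 1 ∧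
    ∃ h : crossSym w w' ∈ EdgeSet AdjL,
      (⟨crossSym w w', h⟩ : Edge AdjL) ∈ S ∧ ω ⟨crossSym w w', h⟩ = false

/-- Connectivity by a dual-open path whose crossed primal edges all lie in `S`. -/
def DualConnectedIn (ω : Config AdjL) (S : Set (Edge AdjL)) (w w' : V) : Prop :=
  Relation.ReflTransGen (DualStep ω S) w w'

/-- The dual vertex `w` lies in an infinite dual cluster. -/
def DualInfCluster (ω : Config AdjL) (S : Set (Edge AdjL)) (w : V) : Prop :=
  {w' | DualConnectedIn ω S w w'}.Infinite

/-- The upper half-plane `H = ℝ × [0, ∞)`. -/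
def HP : Set V := {v | 0 ≤ v.2}

/-- The edges of the square lattice contained in the upper half-plane. -/
def HPedges : Set (Edge AdjL) := edgesInRegion AdjL HP

/-- The vertex set of the rectangle `[x1,x2] × [y1,y2]`. -/
def rectV (x1 x2 y1 y2 : ℤ) : Finset V := Finset.Icc x1 x2 ×ˢ Finset.Icc y1 y2

/-- The edges of the box `Λ_n = [-n,n]²`. -/
def boxE (n : ℤ) : Finset (Edge AdjL) := finEdgesIn AdjL (rectV (-n) n (-n) n)

open Classical in
/-- The configuration in which precisely the edges of the upper half-plane are open. -/
def tau10 : Config AdjL := fun e => if e ∈ HPedges then true else false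

/-- The self-dual (= critical) point `p_c(q) = √q / (1 + √q)`. -/
def pc (q : ℝ) : ℝ := Real.sqrt q / (1 + Real.sqrt q)

/-- The domain `[-N,N] × [0,N]`. -/
def hpDomain (N : ℤ) : Finset (Edge AdjL) := finEdgesIn AdjL (rectV (-N) N 0 N)

/-- `φ` is the infinite-volume FK measure on the upper half-plane with Dobrushin boundary
conditions at parameters `(p,q)`: the weak limit, as `N → ∞`, of the finite-volume FK
measures on `[-N,N] × [0,N]` with the boundary conditions induced by `tau10`. -/
def IsHPDobrushin (p q : ℝ) (φ : Measure (Config AdjL)) : Prop :=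
  IsProbabilityMeasure φ ∧
    WeakLim AdjL (fun N =>
      (fkFin AdjL p q 4 (hpDomain N) (inducedBC AdjL 4 (hpDomain N) tau10)).map
        (extendBy AdjL (hpDomain N))) φ

/-- The free and wired infinite-volume measures (at parameters `(p,q)`) differ. -/
def FreeNeqWired (p q : ℝ) : Prop :=
  ∃ φ0 φ1 : Measure (Config AdjL),
    IsFreeLimit AdjL 4 p q φ0 ∧ IsWiredLimit AdjL 4 p q φ1 ∧ φ0 ≠ φ1

/-! #### The slit domain `Slit(M,N)` -/

/-- Points of the axis that are split in the slit domain `Slit(M,N)`. -/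
def SplitPt (M N : ℤ) (v : V) : Prop := v.2 = 0 ∧ (v.1 < -M ∨ N < v.1)

open Classical in
/-- The copy (upper = `true` / lower = `false`) of the endpoint `u` to which the edge `e`
is attached in the slit domain. -/
def endSide (M N : ℤ) (u : V) (e : Edge AdjL) : Bool :=
  if SplitPt M N u ∧ e ∉ HPedges then false else true

/-- Admissible slit vertices: pairs (vertex, side), the side being `true` except that split
points carry two copies. -/
def SlitVOK (M N : ℤ) (a : V × Bool) : Prop := a.2 = true ∨ SplitPt M N a.1

open Classical in
/-- The degree of a slit vertex in the finite edge set `D`. -/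
def slitDeg (M N : ℤ) (D : Finset (Edge AdjL)) (a : V × Bool) : ℕ :=
  (D.filter fun e => Inc AdjL a.1 e ∧ a.2 = endSide M N a.1 e).card

/-- A slit vertex belongs to the finite slit graph spanned by `D`. -/
def SlitPresent (M N : ℤ) (D : Finset (Edge AdjL)) (a : V × Bool) : Prop :=
  SlitVOK M N a ∧ 0 < slitDeg M N D a

/-- Boundary of the finite slit graph spanned by `D`: its vertices of degree `< 4`. -/
def slitBdry (M N : ℤ) (D : Finset (Edge AdjL)) : Set (V × Bool) :=
  {a | SlitPresent M N D a ∧ slitDeg M N D a < 4}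

/-- Number of clusters of `ω` in the finite slit graph spanned by `D`, with boundary
vertices wired together according to `ξ`. -/
def slitClusterCount (M N : ℤ) (D : Finset (Edge AdjL)) (ξ : Setoid (V × Bool))
    (ω : Config AdjL) : ℕ :=
  Nat.card (Quot fun a b : {a : V × Bool // SlitPresent M N D a} =>
    (∃ e ∈ D, ω e = true ∧ Inc AdjL a.1.1 e ∧ Inc AdjL b.1.1 e ∧
        a.1.2 = endSide M N a.1.1 e ∧ b.1.2 = endSide M N b.1.1 e) ∨
      (a.1 ∈ slitBdry M N D ∧ b.1 ∈ slitBdry M N D ∧ ξ.r a.1 b.1))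

/-- FK weight of a local configuration on the finite slit graph. -/
def slitWeight (p q : ℝ) (M N : ℤ) (D : Finset (Edge AdjL)) (ξ : Setoid (V × Bool))
    (η : {e // e ∈ D} → Bool) : ℝ :=
  (p / (1 - p)) ^ openCount AdjL D η *
    q ^ slitClusterCount M N D ξ (extendBy AdjL D η)

/-- Finite-volume FK measure on the slit graph spanned by `D`, with boundary
condition `ξ`. -/
def slitFin (p q : ℝ) (M N : ℤ) (D : Finset (Edge AdjL)) (ξ : Setoid (V × Bool)) :
    Measure ({e // e ∈ D} → Bool) :=
  (∑ η : {e // e ∈ D} → Bool, ENNReal.ofReal (slitWeight p q M N D ξ η))⁻¹ •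
    ∑ η : {e // e ∈ D} → Bool,
      ENNReal.ofReal (slitWeight p q M N D ξ η) • Measure.dirac η

/-- The boundary condition on the slit graph which is wired on `∂Slit⁺` (the upper copies
of the split points) and free everywhere else. -/
def slitPlusBC (M N : ℤ) : Setoid (V × Bool) :=
  Relation.EqvGen.setoid fun a b =>
    (SplitPt M N a.1 ∧ a.2 = true) ∧ (SplitPt M N b.1 ∧ b.2 = true)

/-- `φ` is the FK measure `φ^{1/0}_{Slit(M,N),p,q}` on `Slit(M,N)`, with wired boundary
conditions on `∂Slit⁺` and free boundary conditions on `∂Slit⁻`: the weak limit of the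
finite-volume slit measures on `Λ_R ∩ Slit` as `R → ∞`. -/
def IsSlitMeasure (p q : ℝ) (M N : ℤ) (φ : Measure (Config AdjL)) : Prop :=
  IsProbabilityMeasure φ ∧
    WeakLim AdjL (fun R =>
      (slitFin p q M N (boxE R) (slitPlusBC M N)).map (extendBy AdjL (boxE R))) φ

/-- The event that `z` is connected to `∂Slit⁺` by an open path contained in the upper
half-plane `H`. -/
def slitPlusConn (M N : ℤ) (z : V) : Set (Config AdjL) :=
  {ω | ∃ a : ℤ, (a < -M ∨ N < a) ∧ ConnectedIn AdjL ω HPedges z (a, 0)}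

open Classical in
/-- The number of `c`-good points `(a, 0)`, `a ∈ [x1, x2]`, for the slit measure `φ`:
points of the primal lattice for which the probability of being connected to `∂Slit⁺`
inside `H` is at least `c`. -/
def goodCount (M N : ℤ) (φ : Measure (Config AdjL)) (c : ℝ) (x1 x2 : ℤ) : ℕ :=
  ((Finset.Icc x1 x2).filter fun a =>
    Even a ∧ ENNReal.ofReal c ≤ φ (slitPlusConn M N (a, 0))).card

end FK

namespace SquareModel

open FK (V)

/-- Unit squares, indexed by their lower left corner; each contains exactly one edge of the
lattice as a diagonal. -/
abbrev Sq : Type := ℤ × ℤ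

/-- The left endpoint of the diagonal of a square. -/
def e0 (s : Sq) : V := if Even (s.1 + s.2) then (s.1, s.2) else (s.1, s.2 + 1)

/-- The right endpoint of the diagonal of a square. -/
def e1 (s : Sq) : V := if Even (s.1 + s.2) then (s.1 + 1, s.2 + 1) else (s.1 + 1, s.2)

/-- The diagonal of `s` joins `u` and `v`. -/
def Joins (s : Sq) (u v : V) : Prop := (u = e0 s ∧ v = e1 s) ∨ (u = e1 s ∧ v = e0 s)

/-- Connection by open diagonals. -/
def Conn (σ : Set Sq) : V → V → Prop := Relation.ReflTransGen fun u v => ∃ s ∈ σ, Joins s u v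

lemma joins_iff {s : Sq} {u v : V} : Joins s u v ↔ (u.1 + u.2) % 2 = 0 ∧
    ((u.1 = s.1 ∧ v.1 = s.1 + 1) ∨ (u.1 = s.1 + 1 ∧ v.1 = s.1)) ∧
    ((u.2 = s.2 ∧ v.2 = s.2 + 1) ∨ (u.2 = s.2 + 1 ∧ v.2 = s.2)) := by
  obtain ⟨a, b⟩ := s
  obtain ⟨x, y⟩ := u
  obtain ⟨x', y'⟩ := v
  simp only [Joins, e0, e1, Int.even_iff]
  split_ifs with h <;> simp only [Prod.mk.injEq] <;> omega

lemma Joins.symm {s : Sq} {u v : V} (h : Joins s u v) : Joins s v u := by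
  rcases h with h | h
  · exact Or.inr ⟨h.2, h.1⟩
  · exact Or.inl ⟨h.2, h.1⟩

lemma joins_ends (s : Sq) : Joins s (e0 s) (e1 s) := Or.inl ⟨rfl, rfl⟩

lemma Conn.refl (σ : Set Sq) (u : V) : Conn σ u u := Relation.ReflTransGen.refl

lemma Conn.trans {σ : Set Sq} {u v w : V} (h : Conn σ u v) (h' : Conn σ v w) : Conn σ u w :=
  Relation.ReflTransGen.trans h h'

lemma Conn.symm {σ : Set Sq} {u v : V} (h : Conn σ u v) : Conn σ v u := by
  induction h with
  | refl => exact Conn.refl _ _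
  | tail _ hbc ih =>
    obtain ⟨s, hs, hj⟩ := hbc
    exact Relation.ReflTransGen.head ⟨s, hs, hj.symm⟩ ih

lemma Conn.mono {σ τ : Set Sq} (h : σ ⊆ τ) {u v : V} (hc : Conn σ u v) : Conn τ u v := by
  exact Relation.ReflTransGen.mono (fun a b ⟨s, hs, hj⟩ => ⟨s, h hs, hj⟩) _ _ hc

lemma Conn.of_joins {σ : Set Sq} {s : Sq} (hs : s ∈ σ) {u v : V} (h : Joins s u v) :
    Conn σ u v := Relation.ReflTransGen.single ⟨s, hs, h⟩

lemma Conn.ends {σ : Set Sq} {s : Sq} (hs : s ∈ σ) : Conn σ (e0 s) (e1 s) :=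
  Conn.of_joins hs (joins_ends s)

lemma conn_insert {σ : Set Sq} {s : Sq} {u v : V} (h : Conn (insert s σ) u v) :
    Conn σ u v ∨ (Conn σ u (e0 s) ∧ Conn σ (e1 s) v) ∨ (Conn σ u (e1 s) ∧ Conn σ (e0 s) v) := by
  induction h with
  | refl => exact Or.inl (Conn.refl _ _)
  | @tail b c _ hbc ih =>
    obtain ⟨t, ht, hj⟩ := hbc
    rcases ht with rfl | ht
    · rcases hj with ⟨rfl, rfl⟩ | ⟨rfl, rfl⟩
      · rcases ih with ih | ih | ih
        · exact Or.inr (Or.inl ⟨ih, Conn.refl _ _⟩)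
        · exact Or.inr (Or.inl ⟨ih.1, Conn.refl _ _⟩)
        · exact Or.inl ih.1
      · rcases ih with ih | ih | ih
        · exact Or.inr (Or.inr ⟨ih, Conn.refl _ _⟩)
        · exact Or.inl ih.1
        · exact Or.inr (Or.inr ⟨ih.1, Conn.refl _ _⟩)
    · have hc := Conn.of_joins ht hj
      rcases ih with ih | ih | ih
      · exact Or.inl (ih.trans hc)
      · exact Or.inr (Or.inl ⟨ih.1, ih.2.trans hc⟩)
      · exact Or.inr (Or.inr ⟨ih.1, ih.2.trans hc⟩)

/-- The cluster of a vertex. -/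
def cluster (σ : Set Sq) (u : V) : Set V := {v | Conn σ u v}

lemma cluster_eq_iff {σ : Set Sq} {u v : V} : cluster σ u = cluster σ v ↔ Conn σ u v := by
  constructor
  · intro h
    have : v ∈ cluster σ v := Conn.refl _ _
    rw [← h] at this
    exact this
  · intro h
    ext w
    exact ⟨fun hw => h.symm.trans hw, fun hw => h.trans hw⟩

/-- The number of clusters meeting `U`. -/
def kk (U : Set V) (σ : Set Sq) : ℕ := (cluster σ '' U).ncard

lemma conn_insert_of_conn {σ : Set Sq} {s : Sq} (hc : Conn σ (e0 s) (e1 s)) {u v : V} :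
    Conn (insert s σ) u v ↔ Conn σ u v := by
  constructor
  · intro h
    rcases conn_insert h with h | h | h
    · exact h
    · exact h.1.trans (hc.trans h.2)
    · exact h.1.trans (hc.symm.trans h.2)
  · exact Conn.mono (Set.subset_insert _ _)

lemma kk_insert_of_conn {U : Set V} {σ : Set Sq} {s : Sq} (hc : Conn σ (e0 s) (e1 s)) :
    kk U (insert s σ) = kk U σ := by
  have : cluster (insert s σ) = cluster σ := by
    ext u v
    exact conn_insert_of_conn hc
  rw [kk, kk, this]

lemma kk_insert_of_not_conn {U : Set V} (hU : U.Finite) {σ : Set Sq} {s : Sq}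
    (h0 : e0 s ∈ U) (h1 : e1 s ∈ U) (hc : ¬ Conn σ (e0 s) (e1 s)) :
    kk U (insert s σ) + 1 = kk U σ := by
  set c0 := cluster σ (e0 s) with hc0
  set c1 := cluster σ (e1 s) with hc1
  have hne : c0 ≠ c1 := fun h => hc (cluster_eq_iff.1 h)
  have hin : Conn (insert s σ) (e0 s) (e1 s) := Conn.ends (Set.mem_insert _ _)
  have hmono : ∀ {u v}, Conn σ u v → Conn (insert s σ) u v := fun h =>
    h.mono (Set.subset_insert _ _)
  have hm0 : cluster (insert s σ) (e0 s) = c0 ∪ c1 := by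
    ext v
    constructor
    · intro h
      rcases conn_insert h with h | h | h
      · exact Or.inl h
      · exact Or.inr h.2
      · exact Or.inl h.2
    · rintro (h | h)
      · exact hmono h
      · exact hin.trans (hmono h)
  have hoff : ∀ u, ¬ Conn σ u (e0 s) → ¬ Conn σ u (e1 s) →
      cluster (insert s σ) u = cluster σ u := by
    intro u hu0 hu1
    ext v
    constructor
    · intro h
      rcases conn_insert h with h | h | h
      · exact h
      · exact absurd h.1 hu0
      · exact absurd h.1 hu1
    · exact fun h => hmono h
  have himg : cluster (insert s σ) '' U = insert (c0 ∪ c1) (cluster σ '' U \ {c0, c1}) := by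
    ext S
    constructor
    · rintro ⟨u, hu, rfl⟩
      by_cases hu0 : Conn σ u (e0 s)
      · left
        rw [← hm0, cluster_eq_iff]
        exact hmono hu0
      by_cases hu1 : Conn σ u (e1 s)
      · left
        rw [← hm0, cluster_eq_iff]
        exact (hmono hu1).trans hin.symm
      · right
        rw [hoff u hu0 hu1]
        refine ⟨⟨u, hu, rfl⟩, ?_⟩
        rintro (h | h)
        · exact hu0 (cluster_eq_iff.1 h)
        · exact hu1 (cluster_eq_iff.1 h)
    · rintro (rfl | ⟨⟨u, hu, rfl⟩, hn⟩)
      · exact ⟨e0 s, h0, hm0⟩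
      · refine ⟨u, hu, hoff u ?_ ?_⟩
        · exact fun h => hn (Or.inl (cluster_eq_iff.2 h))
        · exact fun h => hn (Or.inr (cluster_eq_iff.2 h))
  have hnot : c0 ∪ c1 ∉ cluster σ '' U \ {c0, c1} := by
    rintro ⟨⟨u, hu, hu'⟩, hn⟩
    apply hn
    left
    have : e0 s ∈ cluster σ u := by
      rw [hu']
      exact Or.inl (Conn.refl _ _)
    have h2 : cluster σ u = c0 := cluster_eq_iff.2 this
    exact hu'.symm.trans h2
  have hfin : (cluster σ '' U).Finite := hU.image _
  have hsub : ({c0, c1} : Set (Set V)) ⊆ cluster σ '' U := by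
    rintro S (rfl | rfl)
    · exact ⟨_, h0, rfl⟩
    · exact ⟨_, h1, rfl⟩
  rw [kk, kk, himg, Set.ncard_insert_of_notMem hnot (hfin.subset Set.sdiff_subset)]
  have h2 := Set.ncard_sdiff_add_ncard_of_subset hsub hfin
  rw [Set.ncard_pair hne] at h2
  omega

lemma kk_pos {U : Set V} (hU : U.Finite) (hne : U.Nonempty) (σ : Set Sq) : 1 ≤ kk U σ :=
  (Set.ncard_pos (hU.image _)).2 (hne.image _)

/-- If all vertices of `U` outside `W` are connected, the number of clusters is at most
`1 + #W`. -/
lemma kk_le_of_conn {U W : Set V} (hW : W.Finite) {σ : Set Sq} {r : V}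
    (h : ∀ u ∈ U, u ∉ W → Conn σ u r) : kk U σ ≤ W.ncard + 1 := by
  have hsub : cluster σ '' U ⊆ insert (cluster σ r) (cluster σ '' W) := by
    rintro S ⟨u, hu, rfl⟩
    by_cases hw : u ∈ W
    · exact Or.inr ⟨u, hw, rfl⟩
    · exact Or.inl (cluster_eq_iff.2 (h u hu hw))
  calc kk U σ ≤ (insert (cluster σ r) (cluster σ '' W)).ncard :=
        Set.ncard_le_ncard hsub ((hW.image _).insert _)
    _ ≤ (cluster σ '' W).ncard + 1 := Set.ncard_insert_le _ _
    _ ≤ W.ncard + 1 := by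
        have := Set.ncard_image_le (f := cluster σ) hW
        omega

end SquareModel

section Ratio

variable {α : Type*} [DecidableEq α]

/-- A positive function whose one-point insertion ratios increase is log-supermodular. -/
lemma mul_le_inter_mul_union_of_ratio {S : Finset α} {f : Finset α → ℝ} (hpos : ∀ η, 0 < f η)
    {r : α → Finset α → ℝ}
    (hr : ∀ s ∈ S, ∀ η ⊆ S, s ∉ η → f (insert s η) = f η * r s η)
    (hmono : ∀ s ∈ S, ∀ η η' : Finset α, η ⊆ η' → η' ⊆ S → s ∉ η' → r s η ≤ r s η')
    {a b : Finset α} (ha : a ⊆ S) (hb : b ⊆ S) :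
    f a * f b ≤ f (a ∩ b) * f (a ∪ b) := by
  have key : ∀ c ⊆ b, ∀ d : Finset α, d ⊆ S → Disjoint d b →
      f (d ∪ c) * f b ≤ f c * f (d ∪ b) := by
    intro c hc d
    induction d using Finset.induction_on with
    | empty => intro _ _; simp
    | @insert s d hs ih =>
      intro hd hdis
      have hsS : s ∈ S := hd (Finset.mem_insert_self _ _)
      have hdS : d ⊆ S := (Finset.subset_insert _ _).trans hd
      rw [Finset.disjoint_insert_left] at hdis
      have ih := ih hdS hdis.2
      have h1 : d ∪ b ⊆ S := Finset.union_subset hdS hb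
      have hsub : d ∪ c ⊆ d ∪ b := Finset.union_subset_union_right hc
      have hsn : s ∉ d ∪ b := by
        rw [Finset.mem_union]
        rintro (h | h)
        · exact hs h
        · exact hdis.1 h
      have e1 := hr s hsS (d ∪ c) (hsub.trans h1) (fun h => hsn (hsub h))
      have e2 := hr s hsS (d ∪ b) h1 hsn
      have hm := hmono s hsS _ _ hsub h1 hsn
      have hrpos : 0 < r s (d ∪ c) := by
        have := hpos (insert s (d ∪ c))
        rw [e1] at this
        exact pos_of_mul_pos_right this (hpos _).le
      rw [Finset.insert_union, Finset.insert_union, e1, e2]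
      have h2 : 0 < f c * f (d ∪ b) := mul_pos (hpos _) (hpos _)
      calc f (d ∪ c) * r s (d ∪ c) * f b = f (d ∪ c) * f b * r s (d ∪ c) := by ring
        _ ≤ f c * f (d ∪ b) * r s (d ∪ b) := mul_le_mul ih hm hrpos.le h2.le
        _ = _ := by ring
  have := key (a ∩ b) Finset.inter_subset_right (a \ b) (Finset.sdiff_subset.trans ha)
    Finset.sdiff_disjoint
  rwa [Finset.sdiff_union_inter, Finset.sdiff_union_self_eq_union] at this

/-- Two positive functions with the same one-point insertion ratios are proportional. -/
lemma mul_eq_mul_of_ratio {S : Finset α} {f g : Finset α → ℝ} (hf : f ∅ ≠ 0)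
    (r : α → Finset α → ℝ)
    (hr : ∀ s ∈ S, ∀ η ⊆ S, s ∉ η → f (insert s η) = f η * r s η)
    (hr' : ∀ s ∈ S, ∀ η ⊆ S, s ∉ η → g (insert s η) = g η * r s η) :
    ∃ c, ∀ η ⊆ S, g η = c * f η := by
  refine ⟨g ∅ / f ∅, fun η => ?_⟩
  induction η using Finset.induction_on with
  | empty => intro _; field_simp
  | @insert s d hs ih =>
    intro hd
    have hsS : s ∈ S := hd (Finset.mem_insert_self _ _)
    have hdS : d ⊆ S := (Finset.subset_insert _ _).trans hd
    rw [hr s hsS d hdS hs, hr' s hsS d hdS hs, ih hdS]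
    ring

end Ratio

namespace SquareModel

open FK (V)

/-- The squares of the upper half-plane. -/
def Hs : Set Sq := {s | 0 ≤ s.2}

/-- The squares of the box `[-M, M] × [0, M]`. -/
def B (M : ℕ) : Finset Sq := Finset.Ico (-(M : ℤ)) M ×ˢ Finset.Ico (0 : ℤ) M

lemma mem_B {M : ℕ} {s : Sq} : s ∈ B M ↔ -(M : ℤ) ≤ s.1 ∧ s.1 < M ∧ 0 ≤ s.2 ∧ s.2 < M := by
  simp [B, and_assoc]

/-- The vertices of the box. -/
def U (M : ℕ) : Set V := {v | ∃ s ∈ B M, v = e0 s ∨ v = e1 s}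

lemma U_finite (M : ℕ) : (U M).Finite := by
  have : U M ⊆ e0 '' (B M : Set Sq) ∪ e1 '' (B M : Set Sq) := by
    rintro v ⟨s, hs, rfl | rfl⟩
    · exact Or.inl ⟨s, hs, rfl⟩
    · exact Or.inr ⟨s, hs, rfl⟩
  exact (((B M).finite_toSet.image _).union ((B M).finite_toSet.image _)).subset this

/-- Extension of a configuration in the box by open squares in the rest of the half-plane. -/
def full (M : ℕ) (η : Set Sq) : Set Sq := η ∪ (Hs \ (B M : Set Sq))

lemma full_mono {M : ℕ} {η η' : Set Sq} (h : η ⊆ η') : full M η ⊆ full M η' :=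
  Set.union_subset_union_left _ h

open Classical in
/-- The factor gained by opening a square. -/
def ratio (X : ℝ) (σ : Set Sq) (s : Sq) : ℝ := if Conn σ (e0 s) (e1 s) then X else X⁻¹

lemma ratio_le {X : ℝ} (hX : 1 ≤ X) (σ : Set Sq) (s : Sq) : ratio X σ s ≤ X := by
  unfold ratio
  split_ifs
  · exact le_rfl
  · exact (inv_le_one_of_one_le₀ hX).trans hX

lemma ratio_mono {X : ℝ} (hX : 1 ≤ X) {σ τ : Set Sq} (h : σ ⊆ τ) (s : Sq) :
    ratio X σ s ≤ ratio X τ s := by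
  unfold ratio
  have hle : X⁻¹ ≤ X := (inv_le_one_of_one_le₀ hX).trans hX
  split_ifs with h1 h2
  · exact le_rfl
  · exact absurd (h1.mono h) h2
  · exact hle
  · exact le_rfl

/-- The self-dual FK weight of a configuration in the box. -/
def wt (X : ℝ) (M : ℕ) (η : Finset Sq) : ℝ := X ^ η.card * (X ^ 2) ^ kk (U M) (full M η)

lemma wt_pos {X : ℝ} (hX : 1 ≤ X) (M : ℕ) (η : Finset Sq) : 0 < wt X M η := by
  unfold wt
  positivity

lemma wt_insert {X : ℝ} (hX : 1 ≤ X) {M : ℕ} {s : Sq} (hs : s ∈ B M) {η : Finset Sq}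
    (hη : s ∉ η) : wt X M (insert s η) = wt X M η * ratio X (full M η) s := by
  have hX0 : X ≠ 0 := by positivity
  have hfull : full M (insert s η : Finset Sq) = insert s (full M η) := by
    simp [full, Set.insert_union]
  unfold wt ratio
  rw [hfull, Finset.card_insert_of_notMem hη]
  split_ifs with hc
  · rw [kk_insert_of_conn hc]
    ring
  · rw [← kk_insert_of_not_conn (U_finite M) ⟨s, hs, Or.inl rfl⟩ ⟨s, hs, Or.inr rfl⟩ hc]
    field_simp
    ring

lemma wt_mul_le {X : ℝ} (hX : 1 ≤ X) {M : ℕ} {a b : Finset Sq} (ha : a ⊆ B M) (hb : b ⊆ B M) :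
    wt X M a * wt X M b ≤ wt X M (a ∩ b) * wt X M (a ∪ b) :=
  mul_le_inter_mul_union_of_ratio (S := B M) (wt_pos hX M)
    (r := fun s η => ratio X (full M η) s) (fun _ hs _ _ hη => wt_insert hX hs hη)
    (fun s _ η η' h _ _ => ratio_mono hX (full_mono (by exact_mod_cast h)) s) ha hb

open Classical in
/-- The configurations in the box realizing an event. -/
def ev (M : ℕ) (A : Set (Set Sq)) : Finset (Finset Sq) :=
  (B M).powerset.filter (fun η : Finset Sq => (η : Set Sq) ∈ A)

lemma mem_ev {M : ℕ} {A : Set (Set Sq)} {η : Finset Sq} :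
    η ∈ ev M A ↔ η ⊆ B M ∧ (η : Set Sq) ∈ A := by
  simp [ev]

/-- Total weight of an event. -/
def mass (X : ℝ) (M : ℕ) (A : Set (Set Sq)) : ℝ := ∑ η ∈ ev M A, wt X M η

/-- The FK probability of an event in the box. -/
def pr (X : ℝ) (M : ℕ) (A : Set (Set Sq)) : ℝ := mass X M A / mass X M Set.univ

lemma mass_nonneg {X : ℝ} (hX : 1 ≤ X) (M : ℕ) (A : Set (Set Sq)) : 0 ≤ mass X M A :=
  Finset.sum_nonneg fun η _ => (wt_pos hX M η).le

lemma mass_univ_pos {X : ℝ} (hX : 1 ≤ X) (M : ℕ) : 0 < mass X M Set.univ :=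
  Finset.sum_pos (fun η _ => wt_pos hX M η) ⟨∅, by simp [mem_ev]⟩

lemma mass_mono {X : ℝ} (hX : 1 ≤ X) {M : ℕ} {A A' : Set (Set Sq)}
    (h : ∀ σ ⊆ (B M : Set Sq), σ ∈ A → σ ∈ A') : mass X M A ≤ mass X M A' := by
  classical
  refine Finset.sum_le_sum_of_subset_of_nonneg ?_ fun η _ _ => (wt_pos hX M η).le
  intro η hη
  simp only [mem_ev] at hη ⊢
  exact ⟨hη.1, h _ (by exact_mod_cast hη.1) hη.2⟩

lemma mass_inter_add {X : ℝ} {M : ℕ} (A A' : Set (Set Sq)) :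
    mass X M (A ∩ A') + mass X M (A ∩ A'ᶜ) = mass X M A := by
  classical
  unfold mass
  rw [← Finset.sum_filter_add_sum_filter_not (s := ev M A)
    (p := fun η : Finset Sq => (η : Set Sq) ∈ A')]
  congr 1 <;> exact Finset.sum_congr (by ext; simp [mem_ev, and_assoc]) fun _ _ => rfl

lemma pr_nonneg {X : ℝ} (hX : 1 ≤ X) (M : ℕ) (A : Set (Set Sq)) : 0 ≤ pr X M A :=
  div_nonneg (mass_nonneg hX _ _) (mass_univ_pos hX _).le

lemma pr_univ {X : ℝ} (hX : 1 ≤ X) (M : ℕ) : pr X M Set.univ = 1 :=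
  div_self (mass_univ_pos hX M).ne'

lemma pr_mono_on {X : ℝ} (hX : 1 ≤ X) {M : ℕ} {A A' : Set (Set Sq)}
    (h : ∀ σ ⊆ (B M : Set Sq), σ ∈ A → σ ∈ A') : pr X M A ≤ pr X M A' :=
  div_le_div_of_nonneg_right (mass_mono hX h) (mass_univ_pos hX _).le

lemma pr_inter_add {X : ℝ} {M : ℕ} (A A' : Set (Set Sq)) :
    pr X M (A ∩ A') + pr X M (A ∩ A'ᶜ) = pr X M A := by
  unfold pr
  rw [← add_div, mass_inter_add]

/-- Holley's inequality in four-functions form. -/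
lemma pr_mul_le {X : ℝ} (hX : 1 ≤ X) {M : ℕ} {A A' C D : Set (Set Sq)}
    (h : ∀ a ⊆ (B M : Set Sq), ∀ b ⊆ (B M : Set Sq), a ∈ A → b ∈ A' → a ∩ b ∈ C ∧ a ∪ b ∈ D) :
    pr X M A * pr X M A' ≤ pr X M C * pr X M D := by
  classical
  have key : mass X M A * mass X M A' ≤ mass X M C * mass X M D := by
    have h4 := Finset.four_functions_theorem (B M) (f₁ := wt X M) (f₂ := wt X M)
      (f₃ := wt X M) (f₄ := wt X M) (fun η => (wt_pos hX M η).le) (fun η => (wt_pos hX M η).le)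
      (fun η => (wt_pos hX M η).le) (fun η => (wt_pos hX M η).le)
      (fun a ha b hb => wt_mul_le hX ha hb)
      (𝒜 := ev M A)
      (ℬ := ev M A')
      (fun η hη => Finset.mem_powerset.2 (mem_ev.1 hη).1)
      (fun η hη => Finset.mem_powerset.2 (mem_ev.1 hη).1)
    refine h4.trans (mul_le_mul ?_ ?_ (Finset.sum_nonneg fun η _ => (wt_pos hX M η).le)
      (mass_nonneg hX _ _))
    · refine Finset.sum_le_sum_of_subset_of_nonneg ?_ fun η _ _ => (wt_pos hX M η).le
      intro η hη
      obtain ⟨a, ha, b, hb, rfl⟩ := Finset.mem_infs.1 hη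
      simp only [mem_ev] at ha hb ⊢
      have := h a (by exact_mod_cast ha.1) b (by exact_mod_cast hb.1) ha.2 hb.2
      refine ⟨Finset.inter_subset_left.trans ha.1, ?_⟩
      simpa using this.1
    · refine Finset.sum_le_sum_of_subset_of_nonneg ?_ fun η _ _ => (wt_pos hX M η).le
      intro η hη
      obtain ⟨a, ha, b, hb, rfl⟩ := Finset.mem_sups.1 hη
      simp only [mem_ev] at ha hb ⊢
      have := h a (by exact_mod_cast ha.1) b (by exact_mod_cast hb.1) ha.2 hb.2
      refine ⟨Finset.union_subset ha.1 hb.1, ?_⟩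
      simpa using this.2
  unfold pr
  rw [div_mul_div_comm, div_mul_div_comm]
  exact div_le_div_of_nonneg_right key (mul_pos (mass_univ_pos hX _) (mass_univ_pos hX _)).le

/-- The event `A` depends only on the squares in `F`. -/
def Dep (A : Set (Set Sq)) (F : Set Sq) : Prop :=
  ∀ σ τ : Set Sq, (∀ s ∈ F, s ∈ σ ↔ s ∈ τ) → (σ ∈ A ↔ τ ∈ A)

lemma Dep.mono {A : Set (Set Sq)} {F G : Set Sq} (h : Dep A F) (hFG : F ⊆ G) : Dep A G :=
  fun σ τ hst => h σ τ fun s hs => hst s (hFG hs)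

lemma Dep.inter {A A' : Set (Set Sq)} {F : Set Sq} (h : Dep A F) (h' : Dep A' F) :
    Dep (A ∩ A') F := fun σ τ hst => and_congr (h σ τ hst) (h' σ τ hst)

lemma Dep.compl {A : Set (Set Sq)} {F : Set Sq} (h : Dep A F) : Dep Aᶜ F :=
  fun σ τ hst => not_congr (h σ τ hst)

lemma Dep.union {A A' : Set (Set Sq)} {F : Set Sq} (h : Dep A F) (h' : Dep A' F) :
    Dep (A ∪ A') F := fun σ τ hst => or_congr (h σ τ hst) (h' σ τ hst)

/-- All squares of `F` are closed. -/
def closedOn (F : Set Sq) : Set (Set Sq) := {σ | ∀ s ∈ F, s ∉ σ}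

/-- All squares of `F` are open. -/
def openOn (F : Set Sq) : Set (Set Sq) := {σ | F ⊆ σ}

lemma dep_closedOn (F : Set Sq) : Dep (closedOn F) F := by
  intro σ τ h
  exact forall₂_congr fun s hs => not_congr (h s hs)

lemma dep_openOn (F : Set Sq) : Dep (openOn F) F := by
  intro σ τ h
  exact forall₂_congr fun s hs => h s hs

lemma isLowerSet_closedOn (F : Set Sq) : IsLowerSet (closedOn F) :=
  fun _ _ hst h s hs hs' => h s hs (hst hs')

lemma isUpperSet_openOn (F : Set Sq) : IsUpperSet (openOn F) :=
  fun _ _ hst h => h.trans hst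

lemma closedOn_insert (s : Sq) (F : Set Sq) :
    closedOn (insert s F) = closedOn F ∩ closedOn {s} := by
  ext σ
  simp [closedOn, and_comm]

/-- Cost of closing one square. -/
lemma pr_le_closed_one {X : ℝ} (hX : 1 ≤ X) {M : ℕ} {A : Set (Set Sq)} {s : Sq}
    (hA : Dep A {s}ᶜ) : (1 + X)⁻¹ * pr X M A ≤ pr X M (A ∩ closedOn {s}) := by
  classical
  have key : mass X M (A ∩ (closedOn {s})ᶜ) ≤ X * mass X M (A ∩ closedOn {s}) := by
    unfold mass
    rw [Finset.mul_sum]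
    have hinj : Set.InjOn (fun η : Finset Sq => η.erase s) {η : Finset Sq | s ∈ η} := by
      intro η hη η' hη' h
      have h : η.erase s = η'.erase s := h
      rw [← Finset.insert_erase hη, h, Finset.insert_erase hη']
    have hle : ∀ η ⊆ B M, s ∈ η → wt X M η ≤ X * wt X M (η.erase s) := by
      intro η hη hs
      have := wt_insert hX (hη hs) (Finset.notMem_erase s η)
      rw [Finset.insert_erase hs] at this
      rw [this, mul_comm X]
      exact mul_le_mul_of_nonneg_left (ratio_le hX _ _) (wt_pos hX _ _).le
    have hmem : ∀ η : Finset Sq, (η : Set Sq) ∈ A ∩ (closedOn {s})ᶜ → s ∈ η := by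
      intro η hη
      have := hη.2
      simp only [closedOn, Set.mem_compl_iff, Set.mem_ofPred_eq, Set.mem_singleton_iff,
        forall_eq, not_not, Finset.mem_coe] at this
      exact this
    refine le_trans (Finset.sum_le_sum fun η hη => hle η
      (mem_ev.1 hη).1 (hmem η (mem_ev.1 hη).2)) ?_
    rw [← Finset.sum_image (f := fun η => X * wt X M η) (hinj.mono fun η hη => hmem η
      (mem_ev.1 hη).2)]
    refine Finset.sum_le_sum_of_subset_of_nonneg ?_ fun η _ _ =>
      mul_nonneg (by linarith) (wt_pos hX M η).le
    intro η hη
    obtain ⟨ζ, hζ, rfl⟩ := Finset.mem_image.1 hη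
    simp only [mem_ev] at hζ ⊢
    refine ⟨(Finset.erase_subset _ _).trans hζ.1, ?_, ?_⟩
    · refine (hA _ _ ?_).1 hζ.2.1
      intro t ht
      have : t ≠ s := ht
      simp [this]
    · rintro t rfl
      exact Finset.notMem_erase _ _
  have h1 := mass_inter_add (X := X) (M := M) A (closedOn {s})
  unfold pr
  rw [← mul_div_assoc]
  refine div_le_div_of_nonneg_right ?_ (mass_univ_pos hX _).le
  rw [inv_mul_le_iff₀ (by linarith)]
  linarith

/-- Cost of closing finitely many squares. -/
lemma pr_le_closed {X : ℝ} (hX : 1 ≤ X) {M : ℕ} {A : Set (Set Sq)} (F : Finset Sq)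
    (hA : Dep A (F : Set Sq)ᶜ) :
    ((1 + X)⁻¹) ^ F.card * pr X M A ≤ pr X M (A ∩ closedOn F) := by
  induction F using Finset.induction_on with
  | empty =>
    have : closedOn ((∅ : Finset Sq) : Set Sq) = Set.univ := by
      ext; simp [closedOn]
    rw [this]
    simp
  | @insert s F hs ih =>
    have ih := ih (hA.mono (by simp))
    rw [Finset.card_insert_of_notMem hs, Finset.coe_insert, closedOn_insert, ← Set.inter_assoc]
    have hd : Dep (A ∩ closedOn F) {s}ᶜ := by
      refine (hA.mono (by simp)).inter ((dep_closedOn F).mono ?_)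
      intro t ht h
      rw [Set.mem_singleton_iff] at h
      exact hs (by simpa [h] using ht)
    refine le_trans ?_ (pr_le_closed_one hX hd)
    rw [pow_succ']
    have : 0 ≤ (1 + X)⁻¹ := by positivity
    rw [mul_assoc]
    exact mul_le_mul_of_nonneg_left ih this

end SquareModel

namespace SquareModel

open FK (V)
open scoped Topology

lemma pr_fkg {X : ℝ} (hX : 1 ≤ X) {M : ℕ} {A A' : Set (Set Sq)} (hA : IsUpperSet A)
    (hA' : IsUpperSet A') : pr X M A * pr X M A' ≤ pr X M (A ∩ A') := by
  have := pr_mul_le hX (M := M) (A := A) (A' := A') (C := Set.univ) (D := A ∩ A')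
    fun a _ b _ ha hb => ⟨trivial, hA Set.subset_union_left ha, hA' Set.subset_union_right hb⟩
  rwa [pr_univ hX, one_mul] at this

lemma pr_inter_le_of_lower_upper {X : ℝ} (hX : 1 ≤ X) {M : ℕ} {A D : Set (Set Sq)}
    (hD : IsLowerSet D) (hA : IsUpperSet A) : pr X M (D ∩ A) ≤ pr X M D * pr X M A := by
  have := pr_mul_le hX (M := M) (A := D ∩ A) (A' := Set.univ) (C := D) (D := A)
    fun a _ b _ ha _ => ⟨hD Set.inter_subset_left ha.1, hA Set.subset_union_left ha.2⟩
  rwa [pr_univ hX, mul_one] at this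

/-- Opening everything outside `R` favours an increasing event in `R`. -/
lemma pr_inter_mul_openOn_le {X : ℝ} (hX : 1 ≤ X) {M : ℕ} {A A' : Set (Set Sq)} {R F : Set Sq}
    (hA : IsUpperSet A) (hA' : Dep A' F) (hF : Disjoint F R) :
    pr X M (A ∩ A') * pr X M (openOn ((B M : Set Sq) \ R)) ≤
      pr X M A' * pr X M (A ∩ openOn ((B M : Set Sq) \ R)) := by
  refine pr_mul_le hX ?_
  intro a ha b hb haA hbO
  refine ⟨?_, hA Set.subset_union_left haA.1, Set.Subset.trans hbO Set.subset_union_right⟩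
  refine (hA' a (a ∩ b) ?_).1 haA.2
  intro s hs
  exact ⟨fun h => ⟨h, hbO ⟨ha h, Set.disjoint_left.1 hF hs⟩⟩, fun h => h.1⟩

lemma pr_openOn_pos {X : ℝ} (hX : 1 ≤ X) {M : ℕ} {F : Set Sq} (hF : F ⊆ (B M : Set Sq)) :
    0 < pr X M (openOn F) :=
  div_pos (Finset.sum_pos (fun η _ => wt_pos hX M η) ⟨B M, mem_ev.2 ⟨Finset.Subset.refl _, hF⟩⟩)
    (mass_univ_pos hX M)

/-- Two families of configurations with proportional weights have the same conditional
probabilities. -/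
lemma transfer {X : ℝ} (hX : 1 ≤ X) {M M' : ℕ} {S : Finset Sq} {Φ Ψ : Finset Sq → Finset Sq}
    {G G' A A' : Set (Set Sq)}
    (hΦ : ∀ ζ ⊆ S, Φ ζ ∈ ev M G) (hΦi : ∀ ζ ⊆ S, ∀ ζ' ⊆ S, Φ ζ = Φ ζ' → ζ = ζ')
    (hΦs : ∀ η ∈ ev M G, ∃ ζ ⊆ S, Φ ζ = η)
    (hΨ : ∀ ζ ⊆ S, Ψ ζ ∈ ev M' G') (hΨi : ∀ ζ ⊆ S, ∀ ζ' ⊆ S, Ψ ζ = Ψ ζ' → ζ = ζ')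
    (hΨs : ∀ η ∈ ev M' G', ∃ ζ ⊆ S, Ψ ζ = η)
    (hr : ∀ s ∈ S, ∀ ζ ⊆ S, s ∉ ζ → wt X M (Φ (insert s ζ)) * wt X M' (Ψ ζ) =
      wt X M (Φ ζ) * wt X M' (Ψ (insert s ζ)))
    (hA : ∀ ζ ⊆ S, (Φ ζ : Set Sq) ∈ A ↔ (Ψ ζ : Set Sq) ∈ A') :
    pr X M (A ∩ G) * pr X M' G' = pr X M G * pr X M' (A' ∩ G') := by
  classical
  obtain ⟨c, hc⟩ := mul_eq_mul_of_ratio (S := S) (f := fun ζ => wt X M (Φ ζ))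
    (g := fun ζ => wt X M' (Ψ ζ)) (wt_pos hX M _).ne'
    (fun s ζ => wt X M (Φ (insert s ζ)) / wt X M (Φ ζ))
    (fun s _ ζ _ _ => by
      have := (wt_pos hX M (Φ ζ)).ne'
      field_simp)
    (fun s hs ζ hζ hsζ => by
      have := (wt_pos hX M (Φ ζ)).ne'
      have h := hr s hs ζ hζ hsζ
      field_simp
      linarith)
  have sumΦ : ∀ A : Set (Set Sq), mass X M (A ∩ G) =
      ∑ ζ ∈ S.powerset.filter (fun ζ => (Φ ζ : Set Sq) ∈ A), wt X M (Φ ζ) := by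
    intro A
    symm
    refine Finset.sum_bij (fun ζ _ => Φ ζ) ?_ ?_ ?_ fun _ _ => rfl
    · intro ζ hζ
      rw [Finset.mem_filter, Finset.mem_powerset] at hζ
      have := mem_ev.1 (hΦ ζ hζ.1)
      exact mem_ev.2 ⟨this.1, hζ.2, this.2⟩
    · intro ζ hζ ζ' hζ'
      rw [Finset.mem_filter, Finset.mem_powerset] at hζ hζ'
      exact hΦi ζ hζ.1 ζ' hζ'.1
    · intro η hη
      rw [mem_ev] at hη
      obtain ⟨ζ, hζ, rfl⟩ := hΦs η (mem_ev.2 ⟨hη.1, hη.2.2⟩)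
      exact ⟨ζ, Finset.mem_filter.2 ⟨Finset.mem_powerset.2 hζ, hη.2.1⟩, rfl⟩
  have sumΨ : ∀ A A' : Set (Set Sq), (∀ ζ ⊆ S, (Φ ζ : Set Sq) ∈ A ↔ (Ψ ζ : Set Sq) ∈ A') →
      mass X M' (A' ∩ G') =
      ∑ ζ ∈ S.powerset.filter (fun ζ => (Φ ζ : Set Sq) ∈ A), c * wt X M (Φ ζ) := by
    intro A A' hA
    symm
    refine Finset.sum_bij (fun ζ _ => Ψ ζ) ?_ ?_ ?_ ?_
    · intro ζ hζ
      rw [Finset.mem_filter, Finset.mem_powerset] at hζ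
      have := mem_ev.1 (hΨ ζ hζ.1)
      exact mem_ev.2 ⟨this.1, (hA ζ hζ.1).1 hζ.2, this.2⟩
    · intro ζ hζ ζ' hζ'
      rw [Finset.mem_filter, Finset.mem_powerset] at hζ hζ'
      exact hΨi ζ hζ.1 ζ' hζ'.1
    · intro η hη
      rw [mem_ev] at hη
      obtain ⟨ζ, hζ, rfl⟩ := hΨs η (mem_ev.2 ⟨hη.1, hη.2.2⟩)
      exact ⟨ζ, Finset.mem_filter.2 ⟨Finset.mem_powerset.2 hζ, (hA ζ hζ).2 hη.2.1⟩, rfl⟩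
    · intro ζ hζ
      rw [Finset.mem_filter, Finset.mem_powerset] at hζ
      exact (hc ζ hζ.1).symm
  have h1 : mass X M' (A' ∩ G') = c * mass X M (A ∩ G) := by
    rw [sumΨ A A' hA, sumΦ A, Finset.mul_sum]
  have h2 : mass X M' G' = c * mass X M G := by
    have := sumΨ Set.univ Set.univ (fun _ _ => Iff.rfl)
    have h' := sumΦ Set.univ
    rw [Set.univ_inter] at this h'
    rw [this, h', Finset.mul_sum]
  unfold pr
  rw [h1, h2]
  ring

/-! ### Translations -/

/-- Translation of a configuration by `(t, 0)`. -/
def tr (t : ℤ) (σ : Set Sq) : Set Sq := {s | (s.1 - t, s.2) ∈ σ}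

/-- The event that the translated configuration realizes `A`. -/
def trE (t : ℤ) (A : Set (Set Sq)) : Set (Set Sq) := {σ | tr t σ ∈ A}

/-- The box of size `m` centered at `(t, 0)`. -/
def bx (m : ℕ) (t : ℤ) : Finset Sq := Finset.Ico (t - m) (t + m) ×ˢ Finset.Ico (0 : ℤ) m

lemma mem_bx {m : ℕ} {t : ℤ} {s : Sq} :
    s ∈ bx m t ↔ t - m ≤ s.1 ∧ s.1 < t + m ∧ 0 ≤ s.2 ∧ s.2 < m := by
  simp [bx, and_assoc]

lemma conn_tr {t : ℤ} (ht : Even t) {σ : Set Sq} {u v : V} (h : Conn σ u v) :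
    Conn (tr t σ) (u.1 + t, u.2) (v.1 + t, v.2) := by
  rw [Int.even_iff] at ht
  induction h with
  | refl => exact Conn.refl _ _
  | @tail b c _ hbc ih =>
    obtain ⟨s, hs, hj⟩ := hbc
    refine ih.trans (Conn.of_joins (s := (s.1 + t, s.2)) ?_ ?_)
    · simpa [tr] using hs
    · rw [joins_iff] at hj ⊢
      dsimp only
      omega

lemma tr_tr (t t' : ℤ) (σ : Set Sq) : tr t (tr t' σ) = tr (t + t') σ := by
  ext s
  simp only [tr, Set.mem_ofPred_eq]
  rw [sub_sub]

lemma tr_zero (σ : Set Sq) : tr 0 σ = σ := by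
  ext s
  simp [tr]

lemma conn_tr_iff {t : ℤ} (ht : Even t) {σ : Set Sq} {u v : V} :
    Conn (tr t σ) (u.1 + t, u.2) (v.1 + t, v.2) ↔ Conn σ u v := by
  refine ⟨fun h => ?_, conn_tr ht⟩
  have := conn_tr ht.neg h
  rw [tr_tr, neg_add_cancel, tr_zero] at this
  simpa using this

lemma e0_shift {t : ℤ} (ht : Even t) (s : Sq) : e0 (s.1 + t, s.2) = ((e0 s).1 + t, (e0 s).2) := by
  have : Even (s.1 + t + s.2) ↔ Even (s.1 + s.2) := by
    rw [Int.even_iff] at *; rw [Int.even_iff]; omega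
  unfold e0
  simp only [this]
  split_ifs <;> rfl

lemma e1_shift {t : ℤ} (ht : Even t) (s : Sq) : e1 (s.1 + t, s.2) = ((e1 s).1 + t, (e1 s).2) := by
  have : Even (s.1 + t + s.2) ↔ Even (s.1 + s.2) := by
    rw [Int.even_iff] at *; rw [Int.even_iff]; omega
  unfold e1
  simp only [this]
  split_ifs <;> simp <;> ring

lemma ratio_tr {t : ℤ} (ht : Even t) (X : ℝ) (σ : Set Sq) (s : Sq) :
    ratio X (tr t σ) (s.1 + t, s.2) = ratio X σ s := by
  unfold ratio
  rw [e0_shift ht, e1_shift ht, conn_tr_iff ht]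

/-- With everything open outside a translated box, the law in it is that of the box. -/
lemma pr_inter_openOn_bx {X : ℝ} (hX : 1 ≤ X) {M m : ℕ} {t : ℤ} (ht : Even t)
    (hsub : bx m t ⊆ B M) {A : Set (Set Sq)} (hA : Dep A (bx m t : Set Sq)) :
    pr X M (A ∩ openOn ((B M : Set Sq) \ (bx m t : Set Sq))) =
      pr X M (openOn ((B M : Set Sq) \ (bx m t : Set Sq))) * pr X m (trE t A) := by
  classical
  set sh : Sq → Sq := fun s => (s.1 + t, s.2) with hsh
  have shinj : Function.Injective sh := by
    rintro ⟨a, b⟩ ⟨a', b'⟩ h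
    simp only [hsh, Prod.mk.injEq, add_left_inj] at h
    exact Prod.ext h.1 h.2
  set Φ : Finset Sq → Finset Sq := fun ζ => ζ.image sh ∪ (B M \ bx m t) with hΦ
  have shbx : ∀ s, sh s ∈ bx m t ↔ s ∈ B m := by
    intro s
    rw [mem_bx, mem_B]
    simp only [hsh]
    constructor <;> (intro h; omega)
  have himg : ∀ ζ ⊆ B m, ∀ s, s ∈ Φ ζ ↔
      (s ∈ bx m t ∧ (s.1 - t, s.2) ∈ ζ) ∨ (s ∈ B M ∧ s ∉ bx m t) := by
    intro ζ hζ s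
    simp only [hΦ, Finset.mem_union, Finset.mem_image, Finset.mem_sdiff]
    constructor
    · rintro (⟨r, hr, rfl⟩ | h)
      · refine Or.inl ⟨(shbx r).2 (hζ hr), ?_⟩
        simpa [hsh] using hr
      · exact Or.inr h
    · rintro (⟨_, h⟩ | h)
      · exact Or.inl ⟨_, h, by simp [hsh]⟩
      · exact Or.inr h
  have hfull : ∀ ζ ⊆ B m, full M (Φ ζ : Set Sq) = tr t (full m ζ) := by
    intro ζ hζ
    ext s
    have h1 := himg ζ hζ s
    have h2 : (s.1 - t, s.2) ∈ B m ↔ s ∈ bx m t := by rw [← shbx]; simp [hsh]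
    have h3 := @hsub s
    have h4 : s ∈ B M → 0 ≤ s.2 := fun h => (mem_B.1 h).2.2.1
    have h5 : (s.1 - t, s.2) ∈ ζ → (s.1 - t, s.2) ∈ B m := fun h => hζ h
    simp only [full, tr, Hs, Set.mem_union, Finset.mem_coe, Set.mem_sdiff, Set.mem_ofPred_eq,
      h1, h2]
    grind only
  have key := transfer hX (M := M) (M' := m) (S := B m) (Φ := Φ) (Ψ := id)
    (G := openOn ((B M : Set Sq) \ (bx m t : Set Sq))) (G' := Set.univ) (A := A) (A' := trE t A)
    ?_ ?_ ?_ ?_ ?_ ?_ ?_ ?_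
  · rwa [pr_univ hX, mul_one, Set.inter_univ] at key
  · intro ζ hζ
    refine mem_ev.2 ⟨?_, ?_⟩
    · intro s hs
      rcases (himg ζ hζ s).1 hs with h | h
      · exact hsub h.1
      · exact h.1
    · rintro s ⟨h1, h2⟩
      exact (himg ζ hζ s).2 (Or.inr ⟨h1, h2⟩)
  · intro ζ hζ ζ' hζ' h
    ext s
    have e1 := himg ζ hζ (sh s)
    have e2 := himg ζ' hζ' (sh s)
    rw [h, e2] at e1
    have e3 : ((sh s).1 - t, (sh s).2) = s := by simp [hsh]
    rw [e3, shbx] at e1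
    have := @hζ s
    have := @hζ' s
    grind only
  · intro η hη
    rw [mem_ev] at hη
    refine ⟨(B m).filter fun s => sh s ∈ η, Finset.filter_subset _ _, ?_⟩
    ext s
    rw [himg _ (Finset.filter_subset _ _) s, Finset.mem_filter, ← shbx]
    have e3 : sh (s.1 - t, s.2) = s := by simp [hsh]
    rw [e3]
    have h1 : s ∈ η → s ∈ B M := fun h => hη.1 h
    have h2 : s ∈ B M → s ∉ bx m t → s ∈ η := fun h h' => hη.2 ⟨h, h'⟩
    grind only
  · intro ζ hζ
    exact mem_ev.2 ⟨hζ, trivial⟩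
  · exact fun _ _ _ _ h => h
  · intro η hη
    exact ⟨η, (mem_ev.1 hη).1, rfl⟩
  · intro s hs ζ hζ hsζ
    have e1 : Φ (insert s ζ) = insert (sh s) (Φ ζ) := by
      simp only [hΦ]
      rw [Finset.image_insert, Finset.insert_union]
    have e2 : sh s ∉ Φ ζ := by
      rw [himg ζ hζ]
      have e3 : ((sh s).1 - t, (sh s).2) = s := by simp [hsh]
      have := (shbx s).2 hs
      rw [e3]
      grind only
    rw [e1, wt_insert hX (hsub ((shbx s).2 hs)) e2, id, id, wt_insert hX hs hsζ, hfull ζ hζ,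
      ratio_tr ht]
    ring
  · intro ζ hζ
    refine hA _ _ ?_
    intro s hs
    rw [Finset.mem_coe, himg ζ hζ]
    have : s ∈ bx m t := hs
    simp only [tr, id, Set.mem_ofPred_eq, Finset.mem_coe]
    grind only

/-! ### Infinite-volume limits -/

/-- `P` is the limit of the box measures on local events. -/
structure IsLimit (X : ℝ) (P : Set (Set Sq) → ℝ) : Prop where
  one_le : 1 ≤ X
  tendsto : ∀ (A : Set (Set Sq)) (F : Finset Sq), Dep A (F : Set Sq) →
    Tendsto (fun M => pr X M A) atTop (𝓝 (P A))

/-- Events depending on finitely many squares. -/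
def Loc (A : Set (Set Sq)) : Prop := ∃ F : Finset Sq, Dep A (F : Set Sq)

lemma Loc.inter {A A' : Set (Set Sq)} (h : Loc A) (h' : Loc A') : Loc (A ∩ A') := by
  obtain ⟨F, hF⟩ := h
  obtain ⟨F', hF'⟩ := h'
  exact ⟨F ∪ F', (hF.mono (by simp)).inter (hF'.mono (by simp))⟩

lemma Loc.union {A A' : Set (Set Sq)} (h : Loc A) (h' : Loc A') : Loc (A ∪ A') := by
  obtain ⟨F, hF⟩ := h
  obtain ⟨F', hF'⟩ := h'
  exact ⟨F ∪ F', (hF.mono (by simp)).union (hF'.mono (by simp))⟩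

lemma Loc.compl {A : Set (Set Sq)} (h : Loc A) : Loc Aᶜ := by
  obtain ⟨F, hF⟩ := h
  exact ⟨F, hF.compl⟩

lemma Loc.closedOn (F : Finset Sq) : Loc (closedOn F) := ⟨F, dep_closedOn _⟩

end SquareModel

namespace SquareModel

open FK (V)
open scoped Topology

lemma pr_le_one {X : ℝ} (hX : 1 ≤ X) (M : ℕ) (A : Set (Set Sq)) : pr X M A ≤ 1 := by
  rw [← pr_univ hX M]
  exact pr_mono_on hX fun _ _ _ => trivial

lemma bx_subset_B {n M : ℕ} {t : ℤ} (h : n + t.natAbs ≤ M) : bx n t ⊆ B M := by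
  intro s hs
  rw [mem_bx] at hs
  rw [mem_B]
  omega

lemma exists_subset_bx (F : Finset Sq) (hF : (F : Set Sq) ⊆ Hs) (t : ℤ) :
    ∃ m₀ : ℕ, ∀ m ≥ m₀, F ⊆ bx m t := by
  induction F using Finset.induction_on with
  | empty => exact ⟨0, fun _ _ => Finset.empty_subset _⟩
  | @insert s F hs ih =>
    obtain ⟨m₀, h⟩ := ih (fun x hx => hF (Finset.mem_insert_of_mem hx))
    have hs0 : 0 ≤ s.2 := hF (show s ∈ ((insert s F : Finset Sq) : Set Sq) by simp)
    refine ⟨m₀ + s.1.natAbs + s.2.natAbs + t.natAbs + 1, fun m hm => ?_⟩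
    intro x hx
    rcases Finset.mem_insert.1 hx with rfl | hx
    · rw [mem_bx]
      omega
    · exact h m (by omega) hx

lemma isUpperSet_trE {t : ℤ} {A : Set (Set Sq)} (hA : IsUpperSet A) : IsUpperSet (trE t A) :=
  fun _ _ h hσ => hA (fun _ hs => h hs) hσ

lemma dep_trE {t : ℤ} {A : Set (Set Sq)} {F : Finset Sq} (hA : Dep A (F : Set Sq)) :
    Dep (trE t A) (F.image fun s => (s.1 - t, s.2) : Finset Sq) := by
  intro σ τ h
  refine hA _ _ fun s hs => h _ ?_
  rw [Finset.mem_coe]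
  exact Finset.mem_image_of_mem _ hs

lemma trE_trE (t t' : ℤ) (A : Set (Set Sq)) : trE t (trE t' A) = trE (t' + t) A := by
  ext σ
  simp only [trE, Set.mem_ofPred_eq, tr_tr]

lemma trE_zero (A : Set (Set Sq)) : trE 0 A = A := by
  ext σ
  simp only [trE, Set.mem_ofPred_eq, tr_zero]

namespace IsLimit

variable {X : ℝ} {P : Set (Set Sq) → ℝ} {A A' : Set (Set Sq)}

lemma lim (hP : IsLimit X P) (hA : Loc A) : Tendsto (fun M => pr X M A) atTop (𝓝 (P A)) := by
  obtain ⟨F, hF⟩ := hA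
  exact hP.tendsto A F hF

lemma nonneg (hP : IsLimit X P) (hA : Loc A) : 0 ≤ P A :=
  ge_of_tendsto' (hP.lim hA) fun M => pr_nonneg hP.one_le M A

lemma le_one (hP : IsLimit X P) (hA : Loc A) : P A ≤ 1 :=
  le_of_tendsto' (hP.lim hA) fun M => pr_le_one hP.one_le M A

lemma mono_on (hP : IsLimit X P) (hA : Loc A) (hA' : Loc A')
    (h : ∀ σ ⊆ Hs, σ ∈ A → σ ∈ A') : P A ≤ P A' :=
  le_of_tendsto_of_tendsto' (hP.lim hA) (hP.lim hA') fun _ => pr_mono_on hP.one_le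
    fun σ hσ => h σ fun _ hs => (mem_B.1 (hσ hs)).2.2.1

lemma mono (hP : IsLimit X P) (hA : Loc A) (hA' : Loc A') (h : A ⊆ A') : P A ≤ P A' :=
  hP.mono_on hA hA' fun _ _ hs => h hs

lemma inter_add (hP : IsLimit X P) (hA : Loc A) (hA' : Loc A') :
    P (A ∩ A') + P (A ∩ A'ᶜ) = P A := by
  refine tendsto_nhds_unique ?_ (hP.lim hA)
  refine ((hP.lim (hA.inter hA')).add (hP.lim (hA.inter hA'.compl))).congr fun M => ?_
  exact pr_inter_add A A'

lemma univ (hP : IsLimit X P) : P Set.univ = 1 := by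
  refine tendsto_nhds_unique (hP.lim ⟨∅, fun _ _ _ => Iff.rfl⟩) ?_
  simp only [pr_univ hP.one_le, tendsto_const_nhds]

lemma compl (hP : IsLimit X P) (hA : Loc A) : P Aᶜ = 1 - P A := by
  have := hP.inter_add (A := Set.univ) ⟨∅, fun _ _ _ => Iff.rfl⟩ hA
  rw [Set.univ_inter, Set.univ_inter, hP.univ] at this
  linarith

lemma le_add (hP : IsLimit X P) {A'' : Set (Set Sq)} (hA : Loc A) (hA' : Loc A')
    (hA'' : Loc A'') (h : A ⊆ A' ∪ A'') : P A ≤ P A' + P A'' := by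
  rw [← hP.inter_add hA hA']
  have h1 := hP.mono (hA.inter hA') hA' Set.inter_subset_right
  have h2 : P (A ∩ A'ᶜ) ≤ P A'' := hP.mono (hA.inter hA'.compl) hA''
    fun σ hσ => (h hσ.1).resolve_left hσ.2
  linarith

lemma fkg (hP : IsLimit X P) (hA : Loc A) (hA' : Loc A') (hu : IsUpperSet A)
    (hu' : IsUpperSet A') : P A * P A' ≤ P (A ∩ A') :=
  le_of_tendsto_of_tendsto' ((hP.lim hA).mul (hP.lim hA')) (hP.lim (hA.inter hA'))
    fun _ => pr_fkg hP.one_le hu hu'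

lemma closed (hP : IsLimit X P) (hA : Loc A) (F : Finset Sq) (hF : Dep A (F : Set Sq)ᶜ) :
    ((1 + X)⁻¹) ^ F.card * P A ≤ P (A ∩ closedOn F) :=
  le_of_tendsto_of_tendsto' ((hP.lim hA).const_mul _) (hP.lim (hA.inter (Loc.closedOn F)))
    fun _ => pr_le_closed hP.one_le F hF

/-- Spatial domination: an increasing event in a translated box, together with an event outside
of it. -/
lemma inter_le_mul_pr (hP : IsLimit X P) {m : ℕ} {t : ℤ} (ht : Even t) (hu : IsUpperSet A)
    (hA : Dep A (bx m t : Set Sq)) {F : Finset Sq} (hA' : Dep A' (F : Set Sq))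
    (hF : Disjoint F (bx m t)) : P (A ∩ A') ≤ P A' * pr X m (trE t A) := by
  refine le_of_tendsto_of_tendsto (hP.lim (Loc.inter ⟨_, hA⟩ ⟨_, hA'⟩))
    ((hP.lim ⟨_, hA'⟩).mul_const _) ?_
  filter_upwards [eventually_ge_atTop (m + t.natAbs)] with M hM
  have h1 := pr_inter_mul_openOn_le hP.one_le (M := M) hu hA' (Finset.disjoint_coe.2 hF)
  rw [pr_inter_openOn_bx hP.one_le ht (bx_subset_B hM) hA] at h1
  have h2 : 0 < pr X M (openOn ((B M : Set Sq) \ (bx m t : Set Sq))) :=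
    pr_openOn_pos hP.one_le Set.sdiff_subset
  refine le_of_mul_le_mul_right ?_ h2
  linarith

lemma le_pr (hP : IsLimit X P) {m : ℕ} {t : ℤ} (ht : Even t) (hu : IsUpperSet A)
    (hA : Dep A (bx m t : Set Sq)) : P A ≤ pr X m (trE t A) := by
  have := hP.inter_le_mul_pr ht hu hA (A' := Set.univ) (F := ∅) (fun _ _ _ => Iff.rfl) (by simp)
  rwa [Set.inter_univ, hP.univ, one_mul] at this

lemma le_trE (hP : IsLimit X P) {t : ℤ} (ht : Even t) (hu : IsUpperSet A) {F : Finset Sq}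
    (hA : Dep A (F : Set Sq)) (hF : (F : Set Sq) ⊆ Hs) : P A ≤ P (trE t A) := by
  obtain ⟨m₀, hm⟩ := exists_subset_bx F hF t
  refine ge_of_tendsto (hP.lim ⟨_, dep_trE hA⟩) ?_
  filter_upwards [eventually_ge_atTop m₀] with m h
  exact hP.le_pr ht hu (hA.mono (Finset.coe_subset.2 (hm m h)))

/-- Invariance under horizontal translations. -/
lemma trE_eq (hP : IsLimit X P) {t : ℤ} (ht : Even t) (hu : IsUpperSet A) {F : Finset Sq}
    (hA : Dep A (F : Set Sq)) (hF : (F : Set Sq) ⊆ Hs) : P (trE t A) = P A := by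
  refine le_antisymm ?_ (hP.le_trE ht hu hA hF)
  have := hP.le_trE ht.neg (isUpperSet_trE hu) (dep_trE (t := t) hA) ?_
  · rwa [trE_trE, add_neg_cancel, trE_zero] at this
  · intro s hs
    rw [Finset.mem_coe, Finset.mem_image] at hs
    obtain ⟨r, hr, rfl⟩ := hs
    exact show 0 ≤ r.2 from hF (Finset.mem_coe.2 hr)

end IsLimit

end SquareModel

namespace SquareModel

open FK (V)

/-! ### Planarity through mod 2 flows -/

/-- Indicator of a vertex, modulo two. -/
def vind (u : V) (x y : ℤ) : ZMod 2 := if u.1 = x ∧ u.2 = y then 1 else 0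

/-- The mod 2 chain of diagonals `E` has boundary `u + v`. -/
def IsFlow (E : Sq →₀ ZMod 2) (u v : V) : Prop :=
  ∀ x y : ℤ, (x + y) % 2 = 0 →
    E (x, y) + E (x - 1, y) + E (x, y - 1) + E (x - 1, y - 1) = vind u x y + vind v x y

lemma isFlow_zero (u : V) : IsFlow 0 u u := by
  intro x y _
  simp [CharTwo.add_self_eq_zero]

lemma IsFlow.add {E E' : Sq →₀ ZMod 2} {u v w : V} (h : IsFlow E u v) (h' : IsFlow E' v w) :
    IsFlow (E + E') u w := by
  intro x y hxy
  have h1 := h x y hxy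
  have h2 := h' x y hxy
  have h3 := CharTwo.add_self_eq_zero (vind v x y)
  simp only [Finsupp.add_apply]
  linear_combination h1 + h2 + h3

lemma isFlow_single {s : Sq} {u v : V} (h : Joins s u v) : IsFlow (Finsupp.single s 1) u v := by
  intro x y hxy
  obtain ⟨a, b⟩ := s
  obtain ⟨u1, u2⟩ := u
  obtain ⟨v1, v2⟩ := v
  rw [joins_iff] at h
  dsimp only at h
  simp only [Finsupp.single_apply, Prod.mk.injEq, vind]
  obtain ⟨hp, h1, h2⟩ := h
  split_ifs <;> first
    | (exfalso; omega)
    | decide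

lemma exists_flow {σ : Set Sq} {u v : V} (h : Conn σ u v) :
    ∃ E : Sq →₀ ZMod 2, (∀ s, s ∉ σ → E s = 0) ∧ IsFlow E u v := by
  classical
  induction h with
  | refl => exact ⟨0, fun _ _ => rfl, isFlow_zero u⟩
  | tail _ hbc ih =>
    obtain ⟨s, hs, hj⟩ := hbc
    obtain ⟨E, hE, hf⟩ := ih
    refine ⟨E + Finsupp.single s 1, fun t ht => ?_, hf.add (isFlow_single hj)⟩
    rw [Finsupp.add_apply, hE t ht, Finsupp.single_apply, if_neg, add_zero]
    rintro rfl
    exact ht hs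

/-- Parity of the number of crossings between the chain and the ray going down from the dual
vertex `(a, b)`. -/
def pot (E : Sq →₀ ZMod 2) (a b : ℤ) : ZMod 2 := ∑ y ∈ Finset.Ico 0 b, E (a, y)

lemma pot_of_nonpos (E : Sq →₀ ZMod 2) (a : ℤ) {b : ℤ} (hb : b ≤ 0) : pot E a b = 0 := by
  rw [pot, Finset.Ico_eq_empty (by omega), Finset.sum_empty]

lemma pot_succ (E : Sq →₀ ZMod 2) (a : ℤ) {b : ℤ} (hb : 0 ≤ b) :
    pot E a (b + 1) = pot E a b + E (a, b) := by
  have : Finset.Ico 0 (b + 1) = insert b (Finset.Ico 0 b) := by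
    ext y
    simp only [Finset.mem_Ico, Finset.mem_insert]
    omega
  rw [pot, this, Finset.sum_insert (by simp), add_comm, pot]

/-- Indicator that a vertex lies on the vertical line at `x` strictly below height `b`. -/
def below (u : V) (x b : ℤ) : ZMod 2 := if u.1 = x ∧ u.2 < b then 1 else 0

lemma pot_add_pot {E : Sq →₀ ZMod 2} {u v : V} (hf : IsFlow E u v)
    (hE : ∀ s : Sq, s.2 < 0 → E s = 0) (hu : (u.1 + u.2) % 2 = 0 ∧ 0 ≤ u.2)
    (hv : (v.1 + v.2) % 2 = 0 ∧ 0 ≤ v.2) {x b : ℤ} (hxb : (x + b) % 2 = 1) :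
    pot E (x - 1) b + pot E x b = below u x b + below v x b := by
  have base : ∀ b ≤ 0, pot E (x - 1) b + pot E x b = below u x b + below v x b := by
    intro b hb
    have h1 : ¬ (u.1 = x ∧ u.2 < b) := by omega
    have h2 : ¬ (v.1 = x ∧ v.2 < b) := by omega
    simp [pot_of_nonpos E _ hb, below, h1, h2]
  have key : ∀ k : ℕ, ∀ b : ℤ, b ≤ k → (x + b) % 2 = 1 →
      pot E (x - 1) b + pot E x b = below u x b + below v x b := by
    intro k
    induction k using Nat.strong_induction_on with
    | _ k ih =>
      intro b hbk hxb
      rcases le_or_gt b 0 with hb | hb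
      · exact base b hb
      have hst : ∀ w : V, (w.1 + w.2) % 2 = 0 →
          below w x b = below w x (b - 2) + vind w x (b - 1) := by
        intro w hw
        unfold below vind
        by_cases c1 : w.1 = x
        · by_cases c2 : w.2 = b - 1
          · have : ¬ w.2 < b - 2 := by omega
            have : w.2 < b := by omega
            simp [*]
          · have : w.2 < b ↔ w.2 < b - 2 := by omega
            simp [c1, c2, this]
        · simp [c1]
      have hflow := hf x (b - 1) (by omega)
      have hprev : pot E (x - 1) (b - 2) + pot E x (b - 2) =
          below u x (b - 2) + below v x (b - 2) := by
        rcases le_or_gt (b - 2) 0 with hb2 | hb2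
        · exact base _ hb2
        · exact ih (b - 2).toNat (by omega) _ (by omega) (by omega)
      have hpot : ∀ a, pot E a b = pot E a (b - 2) + E (a, b - 2) + E (a, b - 1) := by
        intro a
        have e1 := pot_succ E a (b := b - 1) (by omega)
        rw [sub_add_cancel] at e1
        rw [e1]
        congr 1
        rcases eq_or_lt_of_le (show 1 ≤ b by omega) with h1 | h1
        · rw [← h1, pot_of_nonpos _ _ (by norm_num), pot_of_nonpos _ _ (by norm_num),
            hE _ (by norm_num), add_zero]
        · have e2 := pot_succ E a (b := b - 2) (by omega)
          rw [show b - 2 + 1 = b - 1 by ring] at e2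
          exact e2
      rw [hpot, hpot, hst u hu.1, hst v hv.1]
      rw [show b - 1 - 1 = b - 2 by ring] at hflow
      linear_combination hprev + hflow
  exact key b.toNat b (by omega) hxb

/-- The potential jumps across the dual edge of a square according to the chain. -/
lemma pot_step {E : Sq →₀ ZMod 2} {u v : V} (hf : IsFlow E u v)
    (hE : ∀ s : Sq, s.2 < 0 → E s = 0) (hu : (u.1 + u.2) % 2 = 0 ∧ 0 ≤ u.2)
    (hv : (v.1 + v.2) % 2 = 0 ∧ 0 ≤ v.2) {N : ℤ} (hN : N % 2 = 1) {t : Sq}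
    (huv : u = v ∨ (N - 1 - t.2 < u.2 ∧ N - 1 - t.2 < v.2)) {c d : V} (hj : Joins t c d) :
    pot E c.1 (N - c.2) + pot E d.1 (N - d.2) = E (t.1, N - 1 - t.2) := by
  have hcol : ∀ x b, (x + b) % 2 = 1 → b ≤ N - t.2 → pot E (x - 1) b = pot E x b := by
    intro x b hxb hb
    have h := pot_add_pot hf hE hu hv hxb
    rw [← CharTwo.add_eq_zero, h]
    rcases huv with rfl | huv
    · exact CharTwo.add_self_eq_zero _
    · have h1 : ¬ u.2 < b := by omega
      have h2 : ¬ v.2 < b := by omega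
      simp [below, h1, h2]
  have hsucc : ∀ a b, pot E a (b + 1) = pot E a b + E (a, b) := by
    intro a b
    rcases le_or_gt 0 b with hb | hb
    · exact pot_succ E a hb
    · rw [pot_of_nonpos _ _ (by omega), pot_of_nonpos _ _ (by omega), hE _ hb, add_zero]
  obtain ⟨a, b⟩ := t
  obtain ⟨c1, c2⟩ := c
  obtain ⟨d1, d2⟩ := d
  rw [joins_iff] at hj
  dsimp only at hj hcol ⊢
  have h2 : ∀ z : ZMod 2, z + z = 0 := CharTwo.add_self_eq_zero
  obtain ⟨hp, h1, h1'⟩ := hj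
  have hs := hsucc a (N - 1 - b)
  rw [show N - 1 - b + 1 = N - b by ring] at hs
  -- The dual ends sit at heights `N - b` and `N - 1 - b`.
  have key : (pot E a (N - b) + pot E (a + 1) (N - 1 - b) = E (a, N - 1 - b) ∨ (a + b) % 2 ≠ 0) ∧
      (pot E a (N - 1 - b) + pot E (a + 1) (N - b) = E (a, N - 1 - b) ∨ (a + b) % 2 ≠ 1) := by
    constructor
    · by_cases h : (a + b) % 2 = 0
      · left
        have := hcol (a + 1) (N - 1 - b) (by omega) (by omega)
        rw [add_sub_cancel_right] at this
        rw [← this, hs]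
        linear_combination h2 (pot E a (N - 1 - b))
      · exact Or.inr h
    · by_cases h : (a + b) % 2 = 1
      · left
        have := hcol (a + 1) (N - b) (by omega) (by omega)
        rw [add_sub_cancel_right] at this
        rw [← this, hs]
        linear_combination h2 (pot E a (N - 1 - b))
      · exact Or.inr h
  rcases h1 with ⟨rfl, rfl⟩ | ⟨rfl, rfl⟩ <;> rcases h1' with ⟨rfl, rfl⟩ | ⟨rfl, rfl⟩
  · rw [show N - (c2 + 1) = N - 1 - c2 by ring]
    exact key.1.resolve_right (by omega)
  · rw [show N - (d2 + 1) = N - 1 - d2 by ring]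
    exact key.2.resolve_right (by omega)
  · rw [show N - (c2 + 1) = N - 1 - c2 by ring, add_comm]
    exact key.2.resolve_right (by omega)
  · rw [show N - (d2 + 1) = N - 1 - d2 by ring, add_comm]
    exact key.1.resolve_right (by omega)

/-- Reflection of squares in the strip of height `N`. -/
def rf (N : ℤ) (s : Sq) : Sq := (s.1, N - 1 - s.2)

/-- The potential is constant along dual paths avoiding the chain. -/
lemma pot_eq_of_conn {E : Sq →₀ ZMod 2} {u v : V} (hf : IsFlow E u v)
    (hE : ∀ s : Sq, s.2 < 0 → E s = 0) (hu : (u.1 + u.2) % 2 = 0 ∧ 0 ≤ u.2)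
    (hv : (v.1 + v.2) % 2 = 0 ∧ 0 ≤ v.2) {N : ℤ} (hN : N % 2 = 1) {τ : Set Sq}
    (huv : u = v ∨ ∀ t ∈ τ, N - 1 - t.2 < u.2 ∧ N - 1 - t.2 < v.2)
    (hτ : ∀ t ∈ τ, E (rf N t) = 0) {c d : V} (h : Conn τ c d) :
    pot E c.1 (N - c.2) = pot E d.1 (N - d.2) := by
  induction h with
  | refl => rfl
  | tail _ hbc ih =>
    obtain ⟨t, ht, hj⟩ := hbc
    have := pot_step hf hE hu hv hN (t := t) (huv.imp_right fun h => h t ht) hj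
    rw [show ((t.1, N - 1 - t.2) : Sq) = rf N t from rfl, hτ t ht, CharTwo.add_eq_zero] at this
    rw [ih, this]

lemma ends_parity (s : Sq) : ((e0 s).1 + (e0 s).2) % 2 = 0 ∧ ((e1 s).1 + (e1 s).2) % 2 = 0 := by
  have h1 := joins_iff.1 (joins_ends s)
  have h2 := joins_iff.1 (joins_ends s).symm
  exact ⟨h1.1, h2.1⟩

lemma ends_height (s : Sq) : s.2 ≤ (e0 s).2 ∧ s.2 ≤ (e1 s).2 := by
  have h1 := joins_iff.1 (joins_ends s)
  omega

/-- A primal path joining the ends of an edge separates the ends of the dual edge. -/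
lemma not_both {σ τ : Set Sq} (hσ : σ ⊆ Hs) {N : ℤ} (hN : N % 2 = 1) {s : Sq} (hs0 : 0 ≤ s.2)
    (hs : s ∉ σ) (hτ : ∀ t ∈ τ, rf N t ∉ σ ∧ rf N t ≠ s) (h : Conn σ (e0 s) (e1 s)) :
    ¬ Conn τ (e0 (rf N s)) (e1 (rf N s)) := by
  classical
  intro h'
  obtain ⟨E, hE, hf⟩ := exists_flow h
  have hf' := hf.add (isFlow_single (joins_ends s).symm)
  have hp : ((e0 s).1 + (e0 s).2) % 2 = 0 ∧ 0 ≤ (e0 s).2 :=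
    ⟨(ends_parity s).1, hs0.trans (ends_height s).1⟩
  have hneg : ∀ r : Sq, r.2 < 0 → (E + Finsupp.single s 1 : Sq →₀ ZMod 2) r = 0 := by
    intro r hr
    rw [Finsupp.add_apply, hE r (fun h => absurd (show 0 ≤ r.2 from hσ h) (by omega)),
      Finsupp.single_apply, if_neg, add_zero]
    rintro rfl
    omega
  have h1 := pot_eq_of_conn hf' hneg hp hp hN (Or.inl rfl) (fun t ht => by
    rw [Finsupp.add_apply, hE _ (hτ t ht).1, Finsupp.single_apply, if_neg (hτ t ht).2.symm,
      add_zero]) h'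
  have h2 := pot_step hf' hneg hp hp hN (t := rf N s) (Or.inl rfl) (joins_ends (rf N s))
  have h3 : (((rf N s).1, N - 1 - (rf N s).2) : Sq) = s := by simp [rf]
  rw [h1, CharTwo.add_self_eq_zero, h3, Finsupp.add_apply, hE s hs, Finsupp.single_eq_same] at h2
  exact absurd h2 (by decide)

/-- A crossing at height `N` over a point of the strip blocks dual descents from this point. -/
lemma strip_crossing {σ τ : Set Sq} {N : ℤ} (hN : N % 2 = 1) (hN0 : 0 ≤ N)
    (hσ : ∀ s ∈ σ, 0 ≤ s.2 ∧ s.2 < N) (hτ : ∀ t ∈ τ, 0 ≤ t.2 ∧ rf N t ∉ σ) {l r : ℤ}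
    (hl : (l + N) % 2 = 0) (hr : (r + N) % 2 = 0) (h : Conn σ (l, N) (r, N)) {a : ℤ}
    (hla : l ≤ a) (har : a < r) {w : V} (hw : N ≤ w.2) : ¬ Conn τ (a, 0) w := by
  intro h'
  obtain ⟨E, hE, hf⟩ := exists_flow h
  have hneg : ∀ s : Sq, s.2 < 0 → E s = 0 := fun s hs => hE s fun hs' => by
    have := hσ s hs'
    omega
  have h1 := pot_eq_of_conn hf hneg ⟨hl, hN0⟩ ⟨hr, hN0⟩ hN (Or.inr fun t ht => by
    have := hτ t ht
    dsimp only
    omega) (fun t ht => hE _ (hτ t ht).2) h'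
  rw [pot_of_nonpos E w.1 (by omega)] at h1
  dsimp only at h1
  rw [sub_zero] at h1
  have hrec : ∀ x, pot E (x - 1) N + pot E x N =
      below (l, N) x (N + 1) + below (r, N) x (N + 1) := by
    intro x
    have hsucc : ∀ x, pot E x (N + 1) = pot E x N := fun x => by
      rw [pot_succ E x hN0, hE (x, N) (fun h => by have := (hσ _ h).2; simp at this), add_zero]
    by_cases hx : (x + N) % 2 = 0
    · have := pot_add_pot hf hneg ⟨hl, hN0⟩ ⟨hr, hN0⟩ (x := x) (b := N + 1) (by omega)
      rwa [hsucc, hsucc] at this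
    · rw [pot_add_pot hf hneg ⟨hl, hN0⟩ ⟨hr, hN0⟩ (x := x) (b := N) (by omega)]
      have c1 : l ≠ x := by rintro rfl; exact hx hl
      have c2 : r ≠ x := by rintro rfl; exact hx hr
      simp [below, c1, c2]
  obtain ⟨m, hm⟩ : ∃ m : ℤ, m < l ∧ ∀ x ≤ m, pot E x N = 0 := by
    obtain ⟨m, hm⟩ : ∃ m : ℤ, ∀ s ∈ E.support, m < s.1 := by
      obtain ⟨m, hm⟩ := (E.support.image Prod.fst).bddBelow
      exact ⟨m - 1, fun s hs => by
        have := hm (Finset.mem_coe.2 (Finset.mem_image_of_mem Prod.fst hs))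
        omega⟩
    refine ⟨min m (l - 1), by omega, fun x hx => Finset.sum_eq_zero fun y _ => ?_⟩
    by_contra hne
    have : m < x := hm (x, y) (Finsupp.mem_support_iff.2 hne)
    omega
  have hval : ∀ x, m ≤ x → pot E x N = (if l ≤ x then 1 else 0) + (if r ≤ x then 1 else 0) := by
    intro x hx
    induction x, hx using Int.leInduction with
    | base =>
      rw [hm.2 m le_rfl, if_neg (by omega), if_neg (by omega), add_zero]
    | succ x hx ih =>
      have := hrec (x + 1)
      rw [add_sub_cancel_right, ih] at this
      have e := CharTwo.add_self_eq_zero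
        ((if l ≤ x then 1 else 0 : ZMod 2) + (if r ≤ x then 1 else 0))
      have st : ∀ k : ℤ, (if k ≤ x + 1 then 1 else 0 : ZMod 2) =
          (if k ≤ x then 1 else 0) + below (k, N) (x + 1) (N + 1) := by
        intro k
        unfold below
        by_cases c : k = x + 1
        · simp [c]
        · have : k ≤ x + 1 ↔ k ≤ x := by omega
          simp [c, this]
      rw [st l, st r]
      linear_combination this - e
  rw [hval a (by omega), if_pos hla, if_neg (by omega)] at h1
  exact absurd h1 (by decide)

end SquareModel

namespace SquareModel

open FK (V)

/-! ### Connectivity of complements of boxes -/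

lemma conn_right (x y : ℤ) (hxy : (x + y) % 2 = 0) (k : ℕ) :
    Conn {s : Sq | x ≤ s.1 ∧ y ≤ s.2} (x, y) (x + k, y + k) := by
  induction k with
  | zero => simpa using Conn.refl _ _
  | succ k ih =>
    refine ih.trans (Conn.of_joins (s := (x + k, y + k)) ?_ ?_)
    · constructor <;> dsimp only <;> omega
    · rw [joins_iff]
      dsimp only
      push_cast
      omega

lemma conn_left (x y : ℤ) (hxy : (x + y) % 2 = 0) (k : ℕ) :
    Conn {s : Sq | s.1 < x ∧ y ≤ s.2} (x, y) (x - k, y + k) := by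
  induction k with
  | zero => simpa using Conn.refl _ _
  | succ k ih =>
    refine ih.trans (Conn.of_joins (s := (x - k - 1, y + k)) ?_ ?_)
    · constructor <;> dsimp only <;> omega
    · rw [joins_iff]
      dsimp only
      push_cast
      omega

/-- The squares above height `N`. -/
def upper (N : ℤ) : Set Sq := {s | N ≤ s.2}

lemma conn_upper {N : ℤ} {u v : V} (hu : (u.1 + u.2) % 2 = 0 ∧ N ≤ u.2)
    (hv : (v.1 + v.2) % 2 = 0 ∧ N ≤ v.2) : Conn (upper N) u v := by
  have cone : ∀ u : V, (u.1 + u.2) % 2 = 0 → N ≤ u.2 → ∀ k l : ℕ,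
      Conn (upper N) u (u.1 + k - l, u.2 + k + l) := by
    intro u hu hN k l
    have h1 := (conn_right u.1 u.2 hu k).mono (τ := upper N) fun s hs => hN.trans hs.2
    have h2 := (conn_left (u.1 + k) (u.2 + k) (by omega) l).mono (τ := upper N) fun s hs => by
      have := hs.2
      show N ≤ s.2
      omega
    exact h1.trans h2
  have hK := cone u hu.1 hu.2 ((v.1 - u.1).natAbs + (v.2 - u.2).natAbs)
    ((v.1 - u.1).natAbs + (v.2 - u.2).natAbs)
  obtain ⟨a, ha⟩ : ∃ a : ℕ, (a : ℤ) = (2 * ((v.1 - u.1).natAbs + (v.2 - u.2).natAbs : ℕ) +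
    (u.2 - v.2) + (u.1 - v.1)) / 2 := ⟨_, Int.toNat_of_nonneg (by omega)⟩
  obtain ⟨b, hb⟩ : ∃ b : ℕ, (b : ℤ) = (2 * ((v.1 - u.1).natAbs + (v.2 - u.2).natAbs : ℕ) +
    (u.2 - v.2) - (u.1 - v.1)) / 2 := ⟨_, Int.toNat_of_nonneg (by omega)⟩
  have hL := cone v hv.1 hv.2 a b
  have : ((v.1 + a - b, v.2 + a + b) : V) = (u.1 + ((v.1 - u.1).natAbs + (v.2 - u.2).natAbs : ℕ) -
      ((v.1 - u.1).natAbs + (v.2 - u.2).natAbs : ℕ),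
      u.2 + ((v.1 - u.1).natAbs + (v.2 - u.2).natAbs : ℕ) +
      ((v.1 - u.1).natAbs + (v.2 - u.2).natAbs : ℕ)) := by
    refine Prod.ext ?_ ?_ <;> dsimp only <;> omega
  rw [this] at hL
  exact hK.trans hL.symm

/-- Vertices outside of a box are connected by squares outside of it. -/
lemma conn_outside {l r N : ℤ} {u v : V}
    (hu : (u.1 + u.2) % 2 = 0 ∧ 0 ≤ u.2 ∧ (N ≤ u.2 ∨ u.1 ≤ l ∨ r ≤ u.1))
    (hv : (v.1 + v.2) % 2 = 0 ∧ 0 ≤ v.2 ∧ (N ≤ v.2 ∨ v.1 ≤ l ∨ r ≤ v.1)) :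
    Conn {s : Sq | 0 ≤ s.2 ∧ (N ≤ s.2 ∨ s.1 < l ∨ r ≤ s.1)} u v := by
  set σ : Set Sq := {s : Sq | 0 ≤ s.2 ∧ (N ≤ s.2 ∨ s.1 < l ∨ r ≤ s.1)} with hσ
  have up : ∀ u : V, (u.1 + u.2) % 2 = 0 → 0 ≤ u.2 → (N ≤ u.2 ∨ u.1 ≤ l ∨ r ≤ u.1) →
      ∃ w : V, (w.1 + w.2) % 2 = 0 ∧ max N 0 ≤ w.2 ∧ Conn σ u w := by
    intro u hp h0 h
    rcases h with h | h | h
    · exact ⟨u, hp, max_le h h0, Conn.refl _ _⟩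
    · refine ⟨_, ?_, ?_, (conn_left u.1 u.2 hp N.natAbs).mono ?_⟩
      · dsimp only; omega
      · dsimp only; omega
      · rintro s ⟨h1, h2⟩
        exact ⟨h0.trans h2, Or.inr (Or.inl (h1.trans_le h))⟩
    · refine ⟨_, ?_, ?_, (conn_right u.1 u.2 hp N.natAbs).mono ?_⟩
      · dsimp only; omega
      · dsimp only; omega
      · rintro s ⟨h1, h2⟩
        exact ⟨h0.trans h2, Or.inr (Or.inr (h.trans h1))⟩
  obtain ⟨w, hw1, hw2, hw3⟩ := up u hu.1 hu.2.1 hu.2.2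
  obtain ⟨z, hz1, hz2, hz3⟩ := up v hv.1 hv.2.1 hv.2.2
  refine hw3.trans (((conn_upper (N := max N 0) ⟨hw1, hw2⟩ ⟨hz1, hz2⟩).mono ?_).trans hz3.symm)
  intro s hs
  have : max N 0 ≤ s.2 := hs
  exact ⟨by omega, Or.inl (by omega)⟩

/-! ### Duality in a rectangle -/

/-- The rectangle `[-n, n] × [0, N]`. -/
def Rc (n N : ℕ) : Finset Sq := Finset.Ico (-(n : ℤ)) n ×ˢ Finset.Ico (0 : ℤ) N

/-- The two columns of squares next to the rectangle. -/
def Fc (n N : ℕ) : Finset Sq := {-(n : ℤ) - 1, (n : ℤ)} ×ˢ Finset.Ico (0 : ℤ) N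

lemma mem_Rc {n N : ℕ} {s : Sq} : s ∈ Rc n N ↔ -(n : ℤ) ≤ s.1 ∧ s.1 < n ∧ 0 ≤ s.2 ∧ s.2 < N := by
  simp [Rc, and_assoc]

lemma mem_Fc {n N : ℕ} {s : Sq} :
    s ∈ Fc n N ↔ (s.1 = -(n : ℤ) - 1 ∨ s.1 = n) ∧ 0 ≤ s.2 ∧ s.2 < N := by
  simp [Fc]

lemma card_Fc_le (n N : ℕ) : (Fc n N).card ≤ 2 * N := by
  rw [Fc, Finset.card_product]
  have h1 : (Finset.Ico (0 : ℤ) N).card = N := by simp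
  rw [h1]
  exact Nat.mul_le_mul_right _ Finset.card_le_two

lemma rf_rf (N : ℤ) (s : Sq) : rf N (rf N s) = s := by
  simp [rf]

lemma rf_mem_Rc {n N : ℕ} {s : Sq} : rf N s ∈ Rc n N ↔ s ∈ Rc n N := by
  simp only [mem_Rc, rf]
  omega

/-- The vertices of the rectangle. -/
def VR (n N : ℕ) : Set V :=
  {v | (v.1 + v.2) % 2 = 0 ∧ -(n : ℤ) ≤ v.1 ∧ v.1 ≤ n ∧ 0 ≤ v.2 ∧ v.2 ≤ N}

lemma VR_finite (n N : ℕ) : (VR n N).Finite := by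
  refine ((Finset.Icc (-(n : ℤ)) n ×ˢ Finset.Icc (0 : ℤ) N).finite_toSet).subset ?_
  rintro v ⟨-, h1, h2, h3, h4⟩
  rw [Finset.mem_coe, Finset.mem_product, Finset.mem_Icc, Finset.mem_Icc]
  exact ⟨⟨h1, h2⟩, h3, h4⟩

lemma ends_mem_VR {n N : ℕ} {s : Sq} (hs : s ∈ Rc n N) : e0 s ∈ VR n N ∧ e1 s ∈ VR n N := by
  rw [mem_Rc] at hs
  have h1 := joins_iff.1 (joins_ends s)
  have h2 := ends_parity s
  constructor
  · exact ⟨h2.1, by omega, by omega, by omega, by omega⟩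
  · exact ⟨h2.2, by omega, by omega, by omega, by omega⟩

/-- The dual of a configuration in the rectangle, with everything open outside. -/
def dOut (n N : ℕ) (ζ : Set Sq) : Set Sq :=
  {s | s ∈ Rc n N ∧ rf N s ∉ ζ} ∪ (Hs \ (Rc n N : Set Sq))

lemma not_both_rect {n N : ℕ} (hN : N % 2 = 1) {ζ : Set Sq} (hζ : ζ ⊆ Rc n N) {s : Sq}
    (hs : s ∈ Rc n N) (hsζ : s ∉ ζ) (h : Conn (ζ ∪ upper N) (e0 s) (e1 s)) :
    ¬ Conn (dOut n N (insert s ζ)) (e0 (rf N s)) (e1 (rf N s)) := by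
  have hs' := mem_Rc.1 hs
  refine not_both ?_ (by omega) hs'.2.2.1 ?_ ?_ h
  · rintro r (hr | hr)
    · exact (mem_Rc.1 (hζ hr)).2.2.1
    · have : (N : ℤ) ≤ r.2 := hr
      show 0 ≤ r.2
      omega
  · rintro (h | h)
    · exact hsζ h
    · have : (N : ℤ) ≤ s.2 := h
      omega
  · rintro t (⟨ht, htζ⟩ | ⟨ht0, ht⟩)
    · have := mem_Rc.1 ht
      rw [Set.mem_insert_iff, not_or] at htζ
      refine ⟨?_, htζ.1⟩
      rintro (h | h)
      · exact htζ.2 h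
      · have h : (N : ℤ) ≤ N - 1 - t.2 := h
        omega
    · have ht0 : 0 ≤ t.2 := ht0
      have hnot : rf N t ∉ Rc n N := fun h => ht (rf_mem_Rc.1 h)
      refine ⟨?_, fun h => hnot (h ▸ hs)⟩
      rintro (h | h)
      · exact hnot (hζ h)
      · have h : (N : ℤ) ≤ N - 1 - t.2 := h
        omega

/-- Euler characteristic deficit. -/
def deficit (n N : ℕ) (ζ : Finset Sq) : ℤ :=
  kk (VR n N) ((ζ : Set Sq) ∪ upper N) + ζ.card - kk (VR n N) (dOut n N ζ)

lemma dOut_insert {n N : ℕ} {ζ : Set Sq} {s : Sq} (hs : s ∈ Rc n N) (hsζ : s ∉ ζ) :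
    dOut n N ζ = insert (rf N s) (dOut n N (insert s ζ)) := by
  ext t
  simp only [dOut, Set.mem_union, Set.mem_ofPred_eq, Set.mem_insert_iff, not_or]
  by_cases ht : t = rf N s
  · subst ht
    simp [rf_mem_Rc, hs, rf_rf, hsζ]
  · have : rf N t ≠ s := by
      rintro rfl
      exact ht (rf_rf _ _).symm
    simp [ht, this]

open Classical in
lemma deficit_insert {n N : ℕ} {ζ : Finset Sq} {s : Sq} (hs : s ∈ Rc n N) (hsζ : s ∉ ζ) :
    deficit n N (insert s ζ) = deficit n N ζ - 1 +
      (if Conn ((ζ : Set Sq) ∪ upper N) (e0 s) (e1 s) then 1 else 0) +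
      (if Conn (dOut n N (insert s (ζ : Set Sq))) (e0 (rf N s)) (e1 (rf N s)) then 1 else 0) := by
  have hV := VR_finite n N
  have hm := ends_mem_VR hs
  have hm' := ends_mem_VR (rf_mem_Rc.2 hs)
  unfold deficit
  rw [Finset.card_insert_of_notMem hsζ, dOut_insert hs (by exact_mod_cast hsζ : s ∉ (ζ : Set Sq)),
    Finset.coe_insert, Set.insert_union]
  have key : ∀ (σ : Set Sq) (r : Sq), e0 r ∈ VR n N → e1 r ∈ VR n N →
      (kk (VR n N) (insert r σ) : ℤ) = kk (VR n N) σ - 1 +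
        (if Conn σ (e0 r) (e1 r) then 1 else 0) := by
    intro σ r h0 h1
    split_ifs with h
    · rw [kk_insert_of_conn h]; ring
    · rw [← kk_insert_of_not_conn hV h0 h1 h]; push_cast; ring
  rw [key _ s hm.1 hm.2, key _ (rf N s) hm'.1 hm'.2]
  push_cast
  ring

lemma deficit_insert_le {n N : ℕ} (hN : N % 2 = 1) {ζ : Finset Sq} (hζ : ζ ⊆ Rc n N) {s : Sq}
    (hs : s ∈ Rc n N) (hsζ : s ∉ ζ) : deficit n N (insert s ζ) ≤ deficit n N ζ := by
  rw [deficit_insert hs hsζ]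
  have := not_both_rect hN (Finset.coe_subset.2 hζ) hs hsζ
  split_ifs with h1 h2
  · exact absurd h2 (this h1)
  all_goals omega

lemma deficit_anti {n N : ℕ} (hN : N % 2 = 1) {ζ ξ : Finset Sq} (h : ζ ⊆ ξ) (hξ : ξ ⊆ Rc n N) :
    deficit n N ξ ≤ deficit n N ζ := by
  have key : ∀ δ : Finset Sq, Disjoint δ ζ → δ ⊆ Rc n N → deficit n N (δ ∪ ζ) ≤ deficit n N ζ := by
    intro δ
    induction δ using Finset.induction_on with
    | empty => intro _ _; simp
    | @insert s δ hs ih =>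
      intro hd hR
      rw [Finset.disjoint_insert_left] at hd
      rw [Finset.insert_union]
      have hδ : δ ⊆ Rc n N := (Finset.subset_insert _ _).trans hR
      refine (deficit_insert_le hN (Finset.union_subset hδ (h.trans hξ))
        (hR (Finset.mem_insert_self _ _)) ?_).trans (ih hd.2 hδ)
      rw [Finset.mem_union]
      rintro (h | h)
      · exact hs h
      · exact hd.1 h
  have := key (ξ \ ζ) Finset.sdiff_disjoint (Finset.sdiff_subset.trans hξ)
  rwa [Finset.sdiff_union_of_subset h] at this

lemma card_rect_vertices {n N : ℕ} (hn : 1 ≤ n) :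
    {v : V | (v.1 + v.2) % 2 = 0 ∧ -(n : ℤ) ≤ v.1 ∧ v.1 ≤ n ∧ 0 ≤ v.2 ∧ v.2 < N}.ncard +
      {v : V | (v.1 + v.2) % 2 = 0 ∧ -(n : ℤ) < v.1 ∧ v.1 < n ∧ 0 ≤ v.2 ∧ v.2 < N}.ncard ≤
      (Rc n N).card := by
  set W1 := {v : V | (v.1 + v.2) % 2 = 0 ∧ -(n : ℤ) ≤ v.1 ∧ v.1 ≤ n ∧ 0 ≤ v.2 ∧ v.2 < N}
  set W2 := {v : V | (v.1 + v.2) % 2 = 0 ∧ -(n : ℤ) < v.1 ∧ v.1 < n ∧ 0 ≤ v.2 ∧ v.2 < N}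
  set f : V → Sq := fun v => if v.1 < n then v else (v.1 - 1, v.2) with hf
  set g : V → Sq := fun v => (v.1 - 1, v.2) with hg
  have fR : f '' W1 ⊆ Rc n N := by
    rintro _ ⟨v, ⟨h1, h2, h3, h4, h5⟩, rfl⟩
    rw [Finset.mem_coe, mem_Rc]
    simp only [hf]
    split_ifs <;> omega
  have gR : g '' W2 ⊆ Rc n N := by
    rintro _ ⟨v, ⟨h1, h2, h3, h4, h5⟩, rfl⟩
    rw [Finset.mem_coe, mem_Rc]
    simp only [hg]
    omega
  have fi : Set.InjOn f W1 := by
    rintro ⟨a, b⟩ ⟨h1, h2, h3, h4, h5⟩ ⟨a', b'⟩ ⟨h1', h2', h3', h4', h5'⟩ h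
    simp only [hf] at h
    dsimp only at *
    rw [Prod.mk.injEq]
    split_ifs at h <;> rw [Prod.mk.injEq] at h <;> omega
  have gi : Set.InjOn g W2 := by
    rintro ⟨a, b⟩ _ ⟨a', b'⟩ _ h
    simp only [hg, Prod.mk.injEq] at h
    rw [Prod.mk.injEq]
    omega
  have hd : Disjoint (f '' W1) (g '' W2) := by
    rw [Set.disjoint_left]
    rintro _ ⟨v, ⟨h1, h2, h3, h4, h5⟩, rfl⟩ ⟨w, ⟨h1', h2', h3', h4', h5'⟩, h⟩
    have e1 := congrArg Prod.fst h
    have e2 := congrArg Prod.snd h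
    simp only [hf, hg] at e1 e2
    split_ifs at e1 e2 <;> omega
  rw [← fi.ncard_image, ← gi.ncard_image,
    ← Set.ncard_union_eq hd ((Rc n N).finite_toSet.subset fR) ((Rc n N).finite_toSet.subset gR),
    ← Set.ncard_coe_finset]
  exact Set.ncard_le_ncard (Set.union_subset fR gR) (Rc n N).finite_toSet

lemma deficit_empty_le {n N : ℕ} (hn : 1 ≤ n) : deficit n N ∅ ≤ deficit n N (Rc n N) := by
  have hne : (VR n N).Nonempty := ⟨(0, 0), by simp [VR]⟩
  have h1 := kk_pos (VR_finite n N) hne (((Rc n N : Finset Sq) : Set Sq) ∪ upper N)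
  have h2 := kk_pos (VR_finite n N) hne (dOut n N ((∅ : Finset Sq) : Set Sq))
  have hfin : ∀ W : Set V, W ⊆ VR n N → W.Finite := fun W hW => (VR_finite n N).subset hW
  obtain ⟨r, hr⟩ : ∃ r : V, (r.1 + r.2) % 2 = 0 ∧ (N : ℤ) ≤ r.2 :=
    ⟨(N, N), by dsimp only; omega, le_rfl⟩
  have h3 := kk_le_of_conn (U := VR n N)
    (W := {v : V | (v.1 + v.2) % 2 = 0 ∧ -(n : ℤ) ≤ v.1 ∧ v.1 ≤ n ∧ 0 ≤ v.2 ∧ v.2 < N})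
    (hfin _ fun v ⟨h1, h2, h3, h4, h5⟩ => ⟨h1, h2, h3, h4, h5.le⟩)
    (σ := ((∅ : Finset Sq) : Set Sq) ∪ upper N) (r := r) (by
      rintro u ⟨hp, h1, h2, h3, h4⟩ hW
      have hN : (N : ℤ) ≤ u.2 := by
        by_contra hlt
        exact hW ⟨hp, h1, h2, h3, not_le.1 hlt⟩
      exact (conn_upper ⟨hp, hN⟩ hr).mono Set.subset_union_right)
  have h4 := kk_le_of_conn (U := VR n N)
    (W := {v : V | (v.1 + v.2) % 2 = 0 ∧ -(n : ℤ) < v.1 ∧ v.1 < n ∧ 0 ≤ v.2 ∧ v.2 < N})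
    (hfin _ fun v ⟨h1, h2, h3, h4, h5⟩ => ⟨h1, h2.le, h3.le, h4, h5.le⟩)
    (σ := dOut n N ((Rc n N : Finset Sq) : Set Sq)) (r := r) (by
      rintro u ⟨hp, h1, h2, h3, h4⟩ hW
      have hN : (N : ℤ) ≤ u.2 ∨ u.1 ≤ -(n : ℤ) ∨ (n : ℤ) ≤ u.1 := by
        by_contra! hlt
        exact hW ⟨hp, hlt.2.1, hlt.2.2, h3, hlt.1⟩
      refine (conn_outside (l := -(n : ℤ)) (r := n) (N := N) ⟨hp, h3, hN⟩
        ⟨hr.1, (Nat.cast_nonneg N).trans hr.2, Or.inl hr.2⟩).mono ?_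
      rintro s ⟨hs0, hs⟩
      refine Or.inr ⟨hs0, fun h => ?_⟩
      have := mem_Rc.1 (Finset.mem_coe.1 h)
      omega)
  have h5 := card_rect_vertices (n := n) (N := N) hn
  unfold deficit
  rw [Finset.card_empty, Nat.cast_zero]
  omega

/-- Exactly one of an edge and its dual has its ends already connected. -/
lemma exactly_one {n N : ℕ} (hN : N % 2 = 1) (hn : 1 ≤ n) {ζ : Finset Sq} (hζ : ζ ⊆ Rc n N)
    {s : Sq} (hs : s ∈ Rc n N) (hsζ : s ∉ ζ) :
    Conn (dOut n N (insert s (ζ : Set Sq))) (e0 (rf N s)) (e1 (rf N s)) ↔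
      ¬ Conn ((ζ : Set Sq) ∪ upper N) (e0 s) (e1 s) := by
  have h1 := deficit_anti hN (Finset.empty_subset ζ) hζ
  have h2 := deficit_anti hN (ζ := insert s ζ) (Finset.insert_subset hs hζ) (Finset.Subset.refl _)
  have h3 := deficit_empty_le (N := N) hn
  have h4 := deficit_insert hs hsζ
  have := not_both_rect hN (Finset.coe_subset.2 hζ) hs hsζ
  refine ⟨fun h h' => this h' h, fun h => ?_⟩
  by_contra h'
  rw [if_neg h, if_neg h'] at h4
  omega

/-- Open squares beyond closed columns do not affect connections in the rectangle. -/
lemma conn_columns {n N : ℕ} {ζ : Set Sq} (hζ : ζ ⊆ Rc n N) {u v : V} (hu : u ∈ VR n N)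
    (hv : v ∈ VR n N) :
    Conn (ζ ∪ (Hs \ ((Rc n N : Set Sq) ∪ Fc n N))) u v ↔ Conn (ζ ∪ upper N) u v := by
  obtain ⟨r, hr⟩ : ∃ r : V, (r.1 + r.2) % 2 = 0 ∧ (N : ℤ) ≤ r.2 :=
    ⟨(N, N), by dsimp only; omega, le_rfl⟩
  constructor
  · intro h
    have key : ∀ w, Conn (ζ ∪ (Hs \ ((Rc n N : Set Sq) ∪ Fc n N))) u w →
        ((-(n : ℤ) ≤ w.1 ∧ w.1 ≤ n ∨ (N : ℤ) ≤ w.2) → Conn (ζ ∪ upper N) u w) ∧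
        (¬ (-(n : ℤ) ≤ w.1 ∧ w.1 ≤ n ∨ (N : ℤ) ≤ w.2) → Conn (ζ ∪ upper N) u r) := by
      intro w hw
      induction hw with
      | refl =>
        refine ⟨fun _ => Conn.refl _ _, fun h => absurd (Or.inl ⟨hu.2.1, hu.2.2.1⟩) h⟩
      | @tail b c _ hbc ih =>
        obtain ⟨s, hs, hj⟩ := hbc
        have hji := joins_iff.1 hj
        have hji' := joins_iff.1 hj.symm
        rcases hs with hs | ⟨hs0, hs⟩
        · have h1 := mem_Rc.1 (hζ hs)
          have hc : Conn (ζ ∪ upper N) b c := Conn.of_joins (Or.inl hs) hj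
          refine ⟨fun _ => (ih.1 (by omega)).trans hc, fun h => absurd ?_ h⟩
          omega
        · rw [Set.mem_union, not_or, Finset.mem_coe, Finset.mem_coe, mem_Rc, mem_Fc] at hs
          have hs0 : 0 ≤ s.2 := hs0
          by_cases hsN : (N : ℤ) ≤ s.2
          · have hc : Conn (ζ ∪ upper N) b c := Conn.of_joins (Or.inr hsN) hj
            refine ⟨fun _ => (ih.1 (by omega)).trans hc, fun h => absurd ?_ h⟩
            omega
          · have hout : s.1 < -(n : ℤ) - 1 ∨ (n : ℤ) < s.1 := by omega
            have hbr : Conn (ζ ∪ upper N) u r := by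
              by_cases hb : (N : ℤ) ≤ b.2
              · exact (ih.1 (Or.inr hb)).trans
                  ((conn_upper ⟨hji.1, hb⟩ hr).mono Set.subset_union_right)
              · exact ih.2 (by omega)
            refine ⟨fun h => ?_, fun _ => hbr⟩
            have hc : (N : ℤ) ≤ c.2 := by omega
            exact hbr.trans ((conn_upper hr ⟨hji'.1, hc⟩).mono Set.subset_union_right)
    exact (key v h).1 (Or.inl ⟨hv.2.1, hv.2.2.1⟩)
  · refine Conn.mono (Set.union_subset_union_right _ ?_)
    intro s hs
    have hs : (N : ℤ) ≤ s.2 := hs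
    refine ⟨show 0 ≤ s.2 by omega, ?_⟩
    rw [Set.mem_union, not_or, Finset.mem_coe, Finset.mem_coe, mem_Rc, mem_Fc]
    omega

/-- The dual configuration in the strip of height `N`. -/
def dl (N : ℕ) (σ : Set Sq) : Set Sq := {s | rf N s ∉ σ}

/-- The event that the dual configuration realizes `E`. -/
def dlE (N : ℕ) (E : Set (Set Sq)) : Set (Set Sq) := {σ | dl N σ ∈ E}

/-- The configuration in `B M` which is `ζ` in the rectangle, closed in the two columns next to it
and open elsewhere. -/
def extP (n N M : ℕ) (ζ : Finset Sq) : Finset Sq := by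
  classical exact ζ ∪ (B M \ (Rc n N ∪ Fc n N))

/-- The configuration in `B M` which is dual to `ζ` in the rectangle and open elsewhere. -/
def extD (n N M : ℕ) (ζ : Finset Sq) : Finset Sq := by
  classical exact (Rc n N).filter (fun s => rf N s ∉ ζ) ∪ (B M \ Rc n N)

lemma mem_extP {n N M : ℕ} {ζ : Finset Sq} {s : Sq} :
    s ∈ extP n N M ζ ↔ s ∈ ζ ∨ (s ∈ B M ∧ s ∉ Rc n N ∧ s ∉ Fc n N) := by
  simp [extP]

lemma mem_extD {n N M : ℕ} {ζ : Finset Sq} {s : Sq} :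
    s ∈ extD n N M ζ ↔ (s ∈ Rc n N ∧ rf N s ∉ ζ) ∨ (s ∈ B M ∧ s ∉ Rc n N) := by
  simp [extD]

lemma Rc_subset_B {n N M : ℕ} (hnM : n < M) (hNM : N ≤ M) {s : Sq} (hs : s ∈ Rc n N) :
    s ∈ B M := by
  rw [mem_Rc] at hs
  rw [mem_B]
  omega

lemma Fc_subset_B {n N M : ℕ} (hnM : n < M) (hNM : N ≤ M) {s : Sq} (hs : s ∈ Fc n N) :
    s ∈ B M := by
  rw [mem_Fc] at hs
  rw [mem_B]
  omega

lemma notMem_Rc_of_mem_Fc {n N : ℕ} {s : Sq} (hs : s ∈ Fc n N) : s ∉ Rc n N := by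
  intro h
  rw [mem_Fc] at hs
  rw [mem_Rc] at h
  omega

lemma full_extP {n N M : ℕ} (hnM : n < M) (hNM : N ≤ M) (ζ : Finset Sq) :
    full M (extP n N M ζ : Set Sq) = (ζ : Set Sq) ∪ (Hs \ ((Rc n N : Set Sq) ∪ Fc n N)) := by
  ext s
  have h1 := Rc_subset_B (s := s) hnM hNM
  have h2 := Fc_subset_B (s := s) hnM hNM
  have h3 : s ∈ B M → 0 ≤ s.2 := fun hs => (mem_B.1 hs).2.2.1
  simp only [full, Hs, Set.mem_union, Set.mem_sdiff, Finset.mem_coe, Set.mem_ofPred_eq, mem_extP]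
  generalize (s ∈ B M) = b at *
  generalize (s ∈ Rc n N) = c at *
  generalize (s ∈ Fc n N) = d at *
  generalize (s ∈ ζ) = e at *
  generalize (0 ≤ s.2) = f at *
  tauto

lemma full_extD {n N M : ℕ} (hnM : n < M) (hNM : N ≤ M) (ζ : Finset Sq) :
    full M (extD n N M ζ : Set Sq) = dOut n N ζ := by
  ext s
  have h1 := Rc_subset_B (s := s) hnM hNM
  have h3 : s ∈ B M → 0 ≤ s.2 := fun hs => (mem_B.1 hs).2.2.1
  simp only [full, dOut, Hs, Set.mem_union, Set.mem_sdiff, Finset.mem_coe, Set.mem_ofPred_eq,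
    mem_extD]
  generalize (s ∈ B M) = b at *
  generalize (s ∈ Rc n N) = c at *
  generalize (rf N s ∈ ζ) = e at *
  generalize (0 ≤ s.2) = f at *
  tauto

/-- The configurations with closed columns next to the rectangle and everything else open. -/
def evP (n N M : ℕ) : Set (Set Sq) :=
  closedOn (Fc n N) ∩ openOn ((B M : Set Sq) \ ((Rc n N : Set Sq) ∪ Fc n N))

/-- The configurations with everything open outside of the rectangle. -/
def evD (n N M : ℕ) : Set (Set Sq) := openOn ((B M : Set Sq) \ (Rc n N : Set Sq))

lemma extP_mem {n N M : ℕ} (hnM : n < M) (hNM : N ≤ M) {ζ : Finset Sq} (hζ : ζ ⊆ Rc n N) :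
    extP n N M ζ ∈ ev M (evP n N M) := by
  refine mem_ev.2 ⟨fun s hs => ?_, fun s hs hs' => ?_, ?_⟩
  · rcases mem_extP.1 hs with h | h
    · exact Rc_subset_B hnM hNM (hζ h)
    · exact h.1
  · rcases mem_extP.1 hs' with h | h
    · exact notMem_Rc_of_mem_Fc hs (hζ h)
    · exact h.2.2 hs
  · rintro s ⟨h1, h2⟩
    rw [Set.mem_union, not_or] at h2
    exact mem_extP.2 (Or.inr ⟨h1, h2.1, h2.2⟩)

lemma extP_inj {n N M : ℕ} {ζ ζ' : Finset Sq} (hζ : ζ ⊆ Rc n N) (hζ' : ζ' ⊆ Rc n N)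
    (h : extP n N M ζ = extP n N M ζ') : ζ = ζ' := by
  ext s
  have h1 := mem_extP (M := M) (ζ := ζ) (s := s) (n := n) (N := N)
  have h2 := mem_extP (M := M) (ζ := ζ') (s := s) (n := n) (N := N)
  have h3 := @hζ s
  have h4 := @hζ' s
  rw [h] at h1
  clear h hζ hζ'
  generalize (s ∈ extP n N M ζ') = a at *
  generalize (s ∈ B M) = b at *
  generalize (s ∈ Rc n N) = c at *
  generalize (s ∈ Fc n N) = d at *
  generalize (s ∈ ζ) = e at *
  generalize (s ∈ ζ') = f at *
  tauto

lemma exists_extP {n N M : ℕ} {η : Finset Sq} (hη : η ∈ ev M (evP n N M)) :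
    ∃ ζ ⊆ Rc n N, extP n N M ζ = η := by
  classical
  obtain ⟨h1, h2, h3⟩ := mem_ev.1 hη
  refine ⟨η ∩ Rc n N, Finset.inter_subset_right, ?_⟩
  ext s
  have e1 := @h1 s
  have e2 : s ∈ Fc n N → s ∉ η := fun h => h2 s h
  have e3 : s ∈ B M → s ∉ Rc n N → s ∉ Fc n N → s ∈ η := fun h h' h'' =>
    h3 ⟨h, fun h => h.elim h' h''⟩
  have e4 := notMem_Rc_of_mem_Fc (n := n) (N := N) (s := s)
  rw [mem_extP, Finset.mem_inter]
  clear hη h1 h2 h3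
  generalize (s ∈ B M) = b at *
  generalize (s ∈ Rc n N) = c at *
  generalize (s ∈ Fc n N) = d at *
  generalize (s ∈ η) = e at *
  tauto

lemma extD_mem {n N M : ℕ} (hnM : n < M) (hNM : N ≤ M) (ζ : Finset Sq) :
    extD n N M ζ ∈ ev M (evD n N M) := by
  refine mem_ev.2 ⟨fun s hs => ?_, ?_⟩
  · rcases mem_extD.1 hs with h | h
    · exact Rc_subset_B hnM hNM h.1
    · exact h.1
  · rintro s ⟨h1, h2⟩
    exact mem_extD.2 (Or.inr ⟨h1, h2⟩)

lemma extD_inj {n N M : ℕ} {ζ ζ' : Finset Sq} (hζ : ζ ⊆ Rc n N) (hζ' : ζ' ⊆ Rc n N)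
    (h : extD n N M ζ = extD n N M ζ') : ζ = ζ' := by
  ext s
  have h1 := mem_extD (M := M) (ζ := ζ) (s := rf N s) (n := n) (N := N)
  have h2 := mem_extD (M := M) (ζ := ζ') (s := rf N s) (n := n) (N := N)
  rw [rf_rf, rf_mem_Rc] at h1 h2
  have h3 := @hζ s
  have h4 := @hζ' s
  rw [h] at h1
  clear h hζ hζ'
  generalize (rf N s ∈ extD n N M ζ') = a at *
  generalize (rf N s ∈ B M) = b at *
  generalize (s ∈ Rc n N) = c at *
  generalize (s ∈ ζ) = e at *
  generalize (s ∈ ζ') = f at *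
  tauto

lemma exists_extD {n N M : ℕ} {η : Finset Sq} (hη : η ∈ ev M (evD n N M)) :
    ∃ ζ ⊆ Rc n N, extD n N M ζ = η := by
  classical
  obtain ⟨h1, h2⟩ := mem_ev.1 hη
  refine ⟨(Rc n N).filter (fun s => rf N s ∉ η), Finset.filter_subset _ _, ?_⟩
  ext s
  have e1 := @h1 s
  have e3 : s ∈ B M → s ∉ Rc n N → s ∈ η := fun h h' => h2 ⟨h, h'⟩
  rw [mem_extD, Finset.mem_filter, rf_rf, rf_mem_Rc]
  clear hη h1 h2
  generalize (s ∈ B M) = b at *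
  generalize (s ∈ Rc n N) = c at *
  generalize (s ∈ η) = e at *
  tauto

lemma wt_ext_mul {X : ℝ} (hX : 1 ≤ X) {n N M : ℕ} (hN : N % 2 = 1) (hn : 1 ≤ n) (hnM : n < M)
    (hNM : N ≤ M) {ζ : Finset Sq} (hζ : ζ ⊆ Rc n N) {s : Sq} (hs : s ∈ Rc n N) (hsζ : s ∉ ζ) :
    wt X M (extP n N M (insert s ζ)) * wt X M (extD n N M ζ) =
      wt X M (extP n N M ζ) * wt X M (extD n N M (insert s ζ)) := by
  have e1 : extP n N M (insert s ζ) = insert s (extP n N M ζ) := by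
    ext t
    rw [mem_extP, Finset.mem_insert, Finset.mem_insert, mem_extP, or_assoc]
  have e2 : s ∉ extP n N M ζ := by
    rw [mem_extP]
    rintro (h | h)
    · exact hsζ h
    · exact h.2.1 hs
  have e3 : extD n N M ζ = insert (rf N s) (extD n N M (insert s ζ)) := by
    ext t
    rw [Finset.mem_insert, mem_extD, mem_extD, Finset.mem_insert, not_or]
    by_cases ht : t = rf N s
    · subst ht
      simp [rf_mem_Rc, hs, rf_rf, hsζ]
    · have : rf N t ≠ s := by
        rintro rfl
        exact ht (rf_rf _ _).symm
      simp [ht, this]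
  have e4 : rf N s ∉ extD n N M (insert s ζ) := by
    rw [mem_extD, rf_rf, rf_mem_Rc]
    simp [hs]
  have hm := ends_mem_VR hs
  have hone := exactly_one hN hn hζ hs hsζ
  rw [e1, e3, wt_insert hX (Rc_subset_B hnM hNM hs) e2,
    wt_insert hX (Rc_subset_B hnM hNM (rf_mem_Rc.2 hs)) e4, full_extP hnM hNM, full_extD hnM hNM]
  have hr : ratio X ((ζ : Set Sq) ∪ (Hs \ ((Rc n N : Set Sq) ∪ Fc n N))) s *
      ratio X (dOut n N ((insert s ζ : Finset Sq) : Set Sq)) (rf N s) = 1 := by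
    have hX0 : X ≠ 0 := by positivity
    unfold ratio
    rw [conn_columns (Finset.coe_subset.2 hζ) hm.1 hm.2, Finset.coe_insert, hone]
    split_ifs <;> field_simp
  linear_combination (wt X M (extP n N M ζ) * wt X M (extD n N M (insert s ζ))) * hr

lemma pr_duality {X : ℝ} (hX : 1 ≤ X) {n N M : ℕ} (hN : N % 2 = 1) (hn : 1 ≤ n) (hnM : n < M)
    (hNM : N ≤ M) {E : Set (Set Sq)} (hE : Dep E (Rc n N : Set Sq)) :
    pr X M (E ∩ evP n N M) * pr X M (evD n N M) =
      pr X M (evP n N M) * pr X M (dlE N E ∩ evD n N M) := by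
  refine transfer hX (S := Rc n N) (fun ζ => extP_mem hnM hNM)
    (fun ζ hζ ζ' hζ' => extP_inj hζ hζ') (fun η => exists_extP)
    (fun ζ _ => extD_mem hnM hNM ζ) (fun ζ hζ ζ' hζ' => extD_inj hζ hζ') (fun η => exists_extD)
    (fun s hs ζ hζ hsζ => wt_ext_mul hX hN hn hnM hNM hζ hs hsζ) ?_
  intro ζ hζ
  refine hE _ _ fun s hs => ?_
  rw [Finset.mem_coe] at hs
  change s ∈ (extP n N M ζ : Set Sq) ↔ rf N s ∉ (extD n N M ζ : Set Sq)
  rw [Finset.mem_coe, Finset.mem_coe, mem_extP, mem_extD, rf_rf, rf_mem_Rc]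
  generalize (s ∈ ζ) = e at *
  tauto

end SquareModel

namespace SquareModel

open FK (V)
open scoped Topology

lemma isLowerSet_dlE {N : ℕ} {E : Set (Set Sq)} (hE : IsUpperSet E) : IsLowerSet (dlE N E) :=
  fun σ τ h hσ => hE (show dl N σ ⊆ dl N τ from fun _ hs hs' => hs (h hs')) hσ

lemma dep_dlE {n N : ℕ} {E : Set (Set Sq)} (hE : Dep E (Rc n N : Set Sq)) :
    Dep (dlE N E) (Rc n N : Set Sq) := by
  intro σ τ h
  refine hE _ _ fun s hs => not_congr (h _ ?_)
  rw [Finset.mem_coe] at hs ⊢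
  exact rf_mem_Rc.2 hs

lemma pr_inter_closed_le {X : ℝ} (hX : 1 ≤ X) {n N M : ℕ} (hN : N % 2 = 1) (hn : 1 ≤ n)
    (hnM : n < M) (hNM : N ≤ M) {E : Set (Set Sq)} (hu : IsUpperSet E)
    (hE : Dep E (Rc n N : Set Sq)) :
    pr X M (E ∩ closedOn (Fc n N)) ≤ pr X M (closedOn (Fc n N)) * pr X M (dlE N E) := by
  have hD : 0 < pr X M (evD n N M) := pr_openOn_pos hX Set.sdiff_subset
  have hO : 0 < pr X M (openOn ((B M : Set Sq) \ ((Rc n N : Set Sq) ∪ Fc n N))) :=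
    pr_openOn_pos hX Set.sdiff_subset
  have hP : 0 < pr X M (evP n N M) := by
    have h := pr_le_closed hX (M := M) (Fc n N)
      (A := openOn ((B M : Set Sq) \ ((Rc n N : Set Sq) ∪ Fc n N)))
      ((dep_openOn _).mono fun s hs => fun h => hs.2 (Or.inr h))
    rw [Set.inter_comm] at h
    refine lt_of_lt_of_le ?_ h
    positivity
  have h1 := pr_mul_le hX (M := M) (A := E ∩ closedOn (Fc n N)) (A' := evP n N M)
    (C := closedOn (Fc n N)) (D := E ∩ evP n N M) fun a _ b _ ha hb =>
      ⟨isLowerSet_closedOn _ Set.inter_subset_left ha.2,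
        hu Set.subset_union_left ha.1,
        fun s hs hs' => hs'.elim (ha.2 s hs) (hb.1 s hs),
        isUpperSet_openOn _ Set.subset_union_right hb.2⟩
  have h2 := pr_duality hX hN hn hnM hNM hE
  have h3 := pr_inter_le_of_lower_upper hX (M := M) (isLowerSet_dlE (N := N) hu)
    (isUpperSet_openOn ((B M : Set Sq) \ (Rc n N : Set Sq)))
  have h4 : pr X M (E ∩ evP n N M) ≤ pr X M (evP n N M) * pr X M (dlE N E) := by
    refine le_of_mul_le_mul_right ?_ hD
    rw [h2, mul_assoc]
    exact mul_le_mul_of_nonneg_left h3 hP.le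
  refine le_of_mul_le_mul_right (h1.trans ?_) hP
  have := mul_le_mul_of_nonneg_left h4 (pr_nonneg hX M (closedOn (Fc n N : Set Sq)))
  linarith

lemma Rc_mono {n m N : ℕ} (h : n ≤ m) : Rc n N ⊆ Rc m N := by
  intro s hs
  rw [mem_Rc] at *
  omega

lemma Rc_subset_bx {n N : ℕ} (h : N ≤ n) : Rc n N ⊆ bx n 0 := by
  intro s hs
  rw [mem_Rc] at hs
  rw [mem_bx]
  omega

lemma disjoint_Fc_bx (n N : ℕ) : Disjoint (Fc n N) (bx n 0) := by
  rw [Finset.disjoint_left]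
  intro s hs hs'
  rw [mem_Fc] at hs
  rw [mem_bx] at hs'
  omega

namespace IsLimit

variable {X : ℝ} {P : Set (Set Sq) → ℝ} {E : Set (Set Sq)}

lemma inter_closed_le (hP : IsLimit X P) {n N : ℕ} (hN : N % 2 = 1) (hn : 1 ≤ n)
    (hu : IsUpperSet E) (hE : Dep E (Rc n N : Set Sq)) :
    P (E ∩ closedOn (Fc n N)) ≤ P (closedOn (Fc n N)) * P (dlE N E) := by
  refine le_of_tendsto_of_tendsto (hP.lim (Loc.inter ⟨_, hE⟩ (Loc.closedOn _)))
    ((hP.lim (Loc.closedOn _)).mul (hP.lim ⟨_, dep_dlE hE⟩)) ?_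
  filter_upwards [eventually_ge_atTop (n + N + 1)] with M hM
  exact pr_inter_closed_le hP.one_le hN hn (by omega) (by omega) hu hE

lemma pow_le_closed (hP : IsLimit X P) (n N : ℕ) :
    ((1 + X)⁻¹) ^ (2 * N) ≤ P (closedOn (Fc n N)) := by
  have h := hP.closed (A := Set.univ) ⟨∅, fun _ _ _ => Iff.rfl⟩ (Fc n N) (fun _ _ _ => Iff.rfl)
  rw [Set.univ_inter, hP.univ, mul_one] at h
  refine le_trans ?_ h
  have := hP.one_le
  exact pow_le_pow_of_le_one (by positivity) (inv_le_one_of_one_le₀ (by linarith))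
    (card_Fc_le n N)

/-- The dual configuration in a strip of odd height dominates the primal one. -/
lemma le_dlE (hP : IsLimit X P) {n N : ℕ} (hN : N % 2 = 1) (hu : IsUpperSet E)
    (hE : Dep E (Rc n N : Set Sq)) : P E ≤ P (dlE N E) := by
  have hX := hP.one_le
  set δ : ℝ := ((1 + X)⁻¹) ^ (2 * N) with hδ
  have hδ0 : 0 < δ := by positivity
  have hLE : Loc E := ⟨_, hE⟩
  have key : ∀ᶠ m : ℕ in atTop, δ * (P E - P (dlE N E)) ≤ pr X m E - P E := by
    filter_upwards [eventually_ge_atTop (n + N + 1)] with m hm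
    have hEm : Dep E (Rc m N : Set Sq) := hE.mono (Finset.coe_subset.2 (Rc_mono (by omega)))
    have hEb : Dep E (bx m 0 : Set Sq) :=
      hEm.mono (Finset.coe_subset.2 (Rc_subset_bx (by omega)))
    have h1 := hP.inter_closed_le hN (by omega : 1 ≤ m) hu hEm
    have h2 := hP.inter_le_mul_pr (m := m) (t := 0) Even.zero hu hEb
      (dep_closedOn (Fc m N : Set Sq)).compl (disjoint_Fc_bx m N)
    rw [trE_zero, hP.compl (Loc.closedOn _)] at h2
    have h3 := hP.inter_add hLE (Loc.closedOn (Fc m N))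
    have h4 := hP.pow_le_closed m N
    have h5 := hP.le_pr (m := m) (t := 0) Even.zero hu hEb
    rw [trE_zero] at h5
    have h6 := hP.nonneg (Loc.closedOn (Fc m N))
    by_cases hle : P E ≤ P (dlE N E)
    · have : δ * (P E - P (dlE N E)) ≤ 0 := mul_nonpos_of_nonneg_of_nonpos hδ0.le (by linarith)
      linarith
    · push Not at hle
      have h7 := mul_le_mul_of_nonneg_right h4 (sub_nonneg.2 hle.le)
      have h8 := mul_nonneg h6 (sub_nonneg.2 h5)
      nlinarith
  have h := ge_of_tendsto ((hP.lim hLE).sub_const (P E)) key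
  rw [sub_self] at h
  by_contra! hlt
  have := mul_pos hδ0 (sub_pos.2 hlt)
  linarith

end IsLimit

end SquareModel

namespace SquareModel

open FK (V)
open scoped Topology

/-! ### Second moment bound -/

lemma pr_forall_notMem_le {X : ℝ} (hX : 1 ≤ X) {M : ℕ} (K : Finset ℕ) (A : ℕ → Set (Set Sq))
    (l : ℝ) : pr X M {σ | ∀ i ∈ K, σ ∉ A i} ≤
      1 - 2 * l * ∑ i ∈ K, pr X M (A i) + l ^ 2 * ∑ i ∈ K, ∑ j ∈ K, pr X M (A i ∩ A j) := by
  classical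
  set Z := mass X M Set.univ with hZ
  have hZ0 : 0 < Z := mass_univ_pos hX M
  set f : Set (Set Sq) → Finset Sq → ℝ := fun D η => if (η : Set Sq) ∈ D then 1 else 0 with hf
  have hpr : ∀ D : Set (Set Sq),
      pr X M D = ∑ η ∈ (B M).powerset, wt X M η / Z * f D η := by
    intro D
    unfold pr
    rw [← hZ, mass, ev, Finset.sum_filter, Finset.sum_div]
    refine Finset.sum_congr (by congr) fun η _ => ?_
    simp only [hf]
    split_ifs <;> simp
  have h1 : (1 : ℝ) = ∑ η ∈ (B M).powerset, wt X M η / Z := by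
    rw [← pr_univ hX M, hpr]
    simp [hf]
  have hpt : ∀ η ∈ (B M).powerset, wt X M η / Z * f {σ | ∀ i ∈ K, σ ∉ A i} η ≤
      wt X M η / Z * (1 - 2 * l * ∑ i ∈ K, f (A i) η +
        l ^ 2 * ∑ i ∈ K, ∑ j ∈ K, f (A i ∩ A j) η) := by
    intro η _
    refine mul_le_mul_of_nonneg_left ?_ (div_nonneg (wt_pos hX M η).le hZ0.le)
    have hsq : ∑ i ∈ K, ∑ j ∈ K, f (A i ∩ A j) η = (∑ i ∈ K, f (A i) η) ^ 2 := by
      rw [sq, Finset.sum_mul_sum]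
      refine Finset.sum_congr rfl fun i _ => Finset.sum_congr rfl fun j _ => ?_
      simp only [hf, Set.mem_inter_iff]
      by_cases hi : (η : Set Sq) ∈ A i <;> by_cases hj : (η : Set Sq) ∈ A j <;> simp [hi, hj]
    rw [hsq]
    by_cases h : ∀ i ∈ K, (η : Set Sq) ∉ A i
    · have h0 : ∑ i ∈ K, f (A i) η = 0 := Finset.sum_eq_zero fun i hi => if_neg (h i hi)
      rw [h0]
      have : f {σ | ∀ i ∈ K, σ ∉ A i} η = 1 := if_pos h
      rw [this]
      simp
    · have : f {σ | ∀ i ∈ K, σ ∉ A i} η = 0 := if_neg h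
      rw [this]
      nlinarith [sq_nonneg (1 - l * ∑ i ∈ K, f (A i) η)]
  rw [hpr]
  refine (Finset.sum_le_sum hpt).trans (le_of_eq ?_)
  simp only [hpr]
  conv_rhs => rw [h1]
  simp only [mul_add, mul_sub, mul_one, Finset.sum_add_distrib, Finset.sum_sub_distrib]
  congr 1
  · congr 1
    rw [Finset.sum_comm, Finset.mul_sum]
    refine Finset.sum_congr rfl fun η _ => ?_
    rw [← Finset.mul_sum]
    ring
  · rw [Finset.mul_sum]
    have h2 : ∀ i ∈ K, l ^ 2 * ∑ j ∈ K, ∑ η ∈ (B M).powerset, wt X M η / Z * f (A i ∩ A j) η =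
        ∑ η ∈ (B M).powerset, l ^ 2 * (wt X M η / Z * ∑ j ∈ K, f (A i ∩ A j) η) := by
      intro i _
      rw [Finset.sum_comm, Finset.mul_sum]
      refine Finset.sum_congr rfl fun η _ => ?_
      rw [← Finset.mul_sum]
    rw [Finset.sum_congr rfl h2, Finset.sum_comm]
    refine Finset.sum_congr rfl fun η _ => ?_
    rw [Finset.mul_sum, Finset.mul_sum]
    refine Finset.sum_congr rfl fun i _ => ?_
    ring

lemma Loc.forall_notMem {K : Finset ℕ} {A : ℕ → Set (Set Sq)} (hA : ∀ i, Loc (A i)) :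
    Loc {σ | ∀ i ∈ K, σ ∉ A i} := by
  classical
  induction K using Finset.induction_on with
  | empty => exact ⟨∅, fun _ _ _ => by simp⟩
  | insert i K hi ih =>
    convert (hA i).compl.inter ih using 1
    ext σ
    simp

lemma IsLimit.forall_notMem_le {X : ℝ} {P : Set (Set Sq) → ℝ} (hP : IsLimit X P) (K : Finset ℕ)
    {A : ℕ → Set (Set Sq)} (hA : ∀ i, Loc (A i)) (l : ℝ) : P {σ | ∀ i ∈ K, σ ∉ A i} ≤
      1 - 2 * l * ∑ i ∈ K, P (A i) + l ^ 2 * ∑ i ∈ K, ∑ j ∈ K, P (A i ∩ A j) := by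
  refine le_of_tendsto_of_tendsto' (hP.lim (Loc.forall_notMem hA)) ?_
    fun M => pr_forall_notMem_le hP.one_le K A l
  refine (tendsto_const_nhds.sub ((tendsto_finsetSum _ fun i _ => hP.lim (hA i)).const_mul _)).add
    ((tendsto_finsetSum _ fun i _ => tendsto_finsetSum _ fun j _ =>
      hP.lim ((hA i).inter (hA j))).const_mul _)

/-! ### Connection events -/

/-- The event that `u` is connected to `T` by open squares of `F`. -/
def reach (F : Finset Sq) (u : V) (T : Set V) : Set (Set Sq) :=
  {σ | ∃ w ∈ T, Conn (σ ∩ F) u w}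

lemma isUpperSet_reach (F : Finset Sq) (u : V) (T : Set V) : IsUpperSet (reach F u T) := by
  rintro σ τ h ⟨w, hw, hc⟩
  exact ⟨w, hw, hc.mono (Set.inter_subset_inter_left _ h)⟩

lemma dep_reach (F : Finset Sq) (u : V) (T : Set V) : Dep (reach F u T) (F : Set Sq) := by
  intro σ τ h
  have : σ ∩ F = τ ∩ (F : Set Sq) := by
    ext s
    exact and_congr_left fun hs => h s hs
  simp only [reach, Set.mem_ofPred_eq, this]

lemma loc_reach (F : Finset Sq) (u : V) (T : Set V) : Loc (reach F u T) := ⟨F, dep_reach F u T⟩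

/-- A path either stays in `F` or reaches the boundary of `F` inside `F`. -/
lemma conn_exit {σ : Set Sq} {F : Finset Sq} {T : Set V} {u w : V} (h : Conn σ u w)
    (hT : ∀ s ∈ σ, s ∉ F → ∀ a b, Joins s a b → Conn (σ ∩ F) u a → a ∈ T) :
    Conn (σ ∩ F) u w ∨ σ ∈ reach F u T := by
  induction h with
  | refl => exact Or.inl (Conn.refl _ _)
  | @tail a b _ hab ih =>
    obtain ⟨s, hs, hj⟩ := hab
    rcases ih with ih | ih
    · by_cases hF : s ∈ F
      · exact Or.inl (ih.trans (Conn.of_joins (σ := σ ∩ (F : Set Sq)) (s := s) ⟨hs, hF⟩ hj))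
      · exact Or.inr ⟨a, hT s hs hF a b hj ih, ih⟩
    · exact Or.inr ih

lemma conn_end {σ : Set Sq} {u w : V} (h : Conn σ u w) :
    w = u ∨ ∃ s ∈ σ, ∃ a, Joins s a w := by
  rcases Relation.ReflTransGen.cases_tail h with rfl | ⟨a, -, s, hs, hj⟩
  · exact Or.inl rfl
  · exact Or.inr ⟨s, hs, a, hj⟩

/-- The vertices at distance at least `n` from `(t, 0)`. -/
def far (n : ℕ) (t : ℤ) : Set V := {w | (n : ℤ) ≤ |w.1 - t| ∨ (n : ℤ) ≤ w.2}

/-- The event that `(t, 0)` is connected to distance `n`. -/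
def arm (n : ℕ) (t : ℤ) : Set (Set Sq) := reach (bx n t) (t, 0) (far n t)

lemma mem_far_of_joins {n : ℕ} {t : ℤ} {s : Sq} (hs0 : 0 ≤ s.2) (hs : s ∉ bx n t) {a b : V}
    (hj : Joins s a b) : a ∈ far n t := by
  rw [mem_bx] at hs
  have := joins_iff.1 hj
  show (n : ℤ) ≤ |a.1 - t| ∨ (n : ℤ) ≤ a.2
  rw [le_abs']
  omega

lemma arm_of_conn {n : ℕ} {t : ℤ} {σ : Set Sq} (hσ : σ ⊆ Hs) {w : V} (hw : w ∈ far n t)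
    (h : Conn σ (t, 0) w) : σ ∈ arm n t := by
  rcases conn_exit (F := bx n t) (T := far n t) h
    fun s hs hF a b hj _ => mem_far_of_joins (hσ hs) hF hj with h | h
  · exact ⟨w, hw, h⟩
  · exact h

lemma arm_anti {n m : ℕ} (h : n ≤ m) (t : ℤ) : arm m t ⊆ arm n t := by
  rintro σ ⟨w, hw, hc⟩
  have hsub : σ ∩ bx m t ⊆ Hs := fun s hs => (mem_bx.1 hs.2).2.2.1
  have hw' : w ∈ far n t := by
    rcases hw with hw | hw
    · exact Or.inl (le_trans (by exact_mod_cast h) hw)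
    · exact Or.inr (le_trans (by exact_mod_cast h) hw)
  exact isUpperSet_reach _ _ _ Set.inter_subset_left (arm_of_conn hsub hw' hc)

lemma trE_arm {t : ℤ} (ht : Even t) (n : ℕ) : trE t (arm n t) = arm n 0 := by
  ext σ
  have hF : tr t σ ∩ bx n t = tr t (σ ∩ bx n 0) := by
    ext s
    simp only [tr, Set.mem_inter_iff, Set.mem_ofPred_eq, Finset.mem_coe, mem_bx]
    refine and_congr_right fun _ => ?_
    omega
  constructor
  · rintro ⟨w, hw, hc⟩
    rw [hF] at hc
    have : w = ((w.1 - t) + t, w.2) := by ext <;> simp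
    rw [this] at hc
    refine ⟨(w.1 - t, w.2), by simpa [far] using hw, ?_⟩
    rw [← conn_tr_iff ht]
    simpa using hc
  · rintro ⟨w, hw, hc⟩
    refine ⟨(w.1 + t, w.2), by simpa [far] using hw, ?_⟩
    rw [hF]
    simpa using conn_tr ht hc

namespace IsLimit

variable {X : ℝ} {P : Set (Set Sq) → ℝ}

lemma arm_eq (hP : IsLimit X P) {t : ℤ} (ht : Even t) (n : ℕ) : P (arm n t) = P (arm n 0) := by
  rw [← trE_arm ht n]
  exact (hP.trE_eq ht (isUpperSet_reach _ _ _) (dep_reach _ _ _)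
    fun s hs => (mem_bx.1 (Finset.mem_coe.1 hs)).2.2.1).symm

lemma arm_anti (hP : IsLimit X P) {n m : ℕ} (h : n ≤ m) (t : ℤ) : P (arm m t) ≤ P (arm n t) :=
  hP.mono (loc_reach _ _ _) (loc_reach _ _ _) (SquareModel.arm_anti h t)

/-- Far away arms are almost independent. -/
lemma arm_inter_le (hP : IsLimit X P) {n m : ℕ} (hnm : n ≤ m) {t t' : ℤ} (ht : Even t)
    (ht' : Even t') (hd : (2 * m : ℤ) ≤ |t - t'|) :
    P (arm n t ∩ arm n t') ≤ P (arm n 0) * pr X m (arm n 0) := by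
  have hsub : ∀ t : ℤ, (bx n t : Set Sq) ⊆ (bx m t : Set Sq) := fun t s hs => by
    rw [Finset.mem_coe, mem_bx] at *
    omega
  have := hP.inter_le_mul_pr (m := m) ht (isUpperSet_reach _ _ _)
    ((dep_reach (bx n t) (t, 0) (far n t)).mono (hsub t)) (A' := arm n t') (F := bx m t')
    ((dep_reach (bx n t') (t', 0) (far n t')).mono (hsub t')) (by
      rw [Finset.disjoint_left]
      intro s h h'
      rw [mem_bx] at h h'
      rw [le_abs'] at hd
      omega)
  have hE : trE t (reach (bx n t) (t, 0) (far n t)) = arm n 0 := trE_arm ht n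
  rw [hE, hP.arm_eq ht'] at this
  exact this

/-- If the origin percolates with positive probability, then some point of a large finite set does
with probability close to one. -/
lemma exists_arm (hP : IsLimit X P) {θ : ℝ} (hθ : 0 < θ) (h : ∀ n, θ ≤ P (arm n 0)) {ε : ℝ}
    (hε : 0 < ε) : ∃ (L : ℤ) (K : ℕ), 0 ≤ L ∧ Even L ∧
      ∃ n₀, ∀ n ≥ n₀, P {σ | ∀ i ∈ Finset.range K, σ ∉ arm n (L * (i : ℤ))} ≤ ε := by
  have hX := hP.one_le
  obtain ⟨θ', hθ', hlim⟩ : ∃ θ', θ ≤ θ' ∧ Tendsto (fun n => P (arm n 0)) atTop (𝓝 θ') := by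
    have := tendsto_atTop_ciInf (f := fun n => P (arm n 0))
      (fun n m hnm => hP.arm_anti hnm 0) ⟨θ, by rintro _ ⟨n, rfl⟩; exact h n⟩
    exact ⟨_, le_ciInf h, this⟩
  have hθ0 : 0 < θ' := hθ.trans_le hθ'
  have hle : ∀ n, θ' ≤ P (arm n 0) := fun n =>
    Antitone.le_of_tendsto (fun n m hnm => hP.arm_anti hnm 0) hlim n
  obtain ⟨δ, hδ0, hδ⟩ : ∃ δ > 0, 2 * δ / θ' + δ ^ 2 / θ' ^ 2 ≤ ε / 2 := by
    have hc : Tendsto (fun δ : ℝ => 2 * δ / θ' + δ ^ 2 / θ' ^ 2) (𝓝[>] 0) (𝓝 0) := by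
      have : Continuous fun δ : ℝ => 2 * δ / θ' + δ ^ 2 / θ' ^ 2 := by fun_prop
      have h := this.tendsto 0
      simp only [mul_zero, zero_div, ne_eq, OfNat.ofNat_ne_zero, not_false_eq_true, zero_pow,
        add_zero] at h
      exact h.mono_left nhdsWithin_le_nhds
    have h1 := hc.eventually_le_const (half_pos hε)
    obtain ⟨δ, h2, h3⟩ := (h1.and self_mem_nhdsWithin).exists
    exact ⟨δ, h3, h2⟩
  obtain ⟨n, hn⟩ := (hlim.eventually_lt_const (by linarith : θ' < θ' + δ)).exists
  obtain ⟨m, hm, hmn⟩ := (((hP.lim (loc_reach (bx n 0) (0, 0) (far n 0))).eventually_lt_const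
    (show P (arm n 0) < θ' + δ from hn)).and (eventually_ge_atTop n)).exists
  obtain ⟨K, hK⟩ := exists_nat_gt (1 / (θ' ^ 2 * (ε / 2)))
  have hK0 : (0 : ℝ) < K := lt_of_le_of_lt (by positivity) hK
  refine ⟨2 * m, K, by positivity, even_two_mul _, n, fun k hk => ?_⟩
  have hev : ∀ i : ℕ, Even (2 * (m : ℤ) * i) := fun i => (even_two_mul _).mul_right _
  have key := hP.forall_notMem_le (Finset.range K) (A := fun i => arm k (2 * (m : ℤ) * i))
    (fun i => loc_reach _ _ _) (1 / (K * θ'))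
  have e1 : ∑ i ∈ Finset.range K, P (arm k (2 * (m : ℤ) * i)) = K * P (arm k 0) := by
    rw [Finset.sum_congr rfl fun i _ => hP.arm_eq (hev i) k]
    simp
  have e2 : ∑ i ∈ Finset.range K, ∑ j ∈ Finset.range K,
      P (arm k (2 * (m : ℤ) * i) ∩ arm k (2 * (m : ℤ) * j)) ≤ K + K ^ 2 * (θ' + δ) ^ 2 := by
    have hb : ∀ i ∈ Finset.range K, ∀ j ∈ Finset.range K,
        P (arm k (2 * (m : ℤ) * i) ∩ arm k (2 * (m : ℤ) * j)) ≤
          (if i = j then 1 else 0) + (θ' + δ) ^ 2 := by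
      intro i _ j _
      have hloc := (loc_reach (bx k (2 * (m : ℤ) * i)) (2 * (m : ℤ) * i, 0)
        (far k (2 * (m : ℤ) * i))).inter (loc_reach (bx k (2 * (m : ℤ) * j))
          (2 * (m : ℤ) * j, 0) (far k (2 * (m : ℤ) * j)))
      split_ifs with hij
      · have := hP.le_one hloc
        have h2 := sq_nonneg (θ' + δ)
        exact this.trans (by linarith)
      · have hd : (2 * m : ℤ) ≤ |2 * (m : ℤ) * i - 2 * (m : ℤ) * j| := by
          rw [← mul_sub, abs_mul, abs_of_nonneg (by positivity : (0 : ℤ) ≤ 2 * m)]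
          have : (1 : ℤ) ≤ |(i : ℤ) - j| := Int.one_le_abs (by omega)
          nlinarith
        have h1 := hP.mono hloc ((loc_reach _ _ _).inter (loc_reach _ _ _))
          (Set.inter_subset_inter (SquareModel.arm_anti hk (2 * (m : ℤ) * i))
            (SquareModel.arm_anti hk (2 * (m : ℤ) * j)))
        have h2 := hP.arm_inter_le hmn (hev i) (hev j) hd
        have h3 : P (arm n 0) * pr X m (arm n 0) ≤ (θ' + δ) * (θ' + δ) :=
          mul_le_mul hn.le hm.le (pr_nonneg hX _ _) (by positivity)
        refine h1.trans (h2.trans ?_)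
        linarith
    refine (Finset.sum_le_sum fun i hi => Finset.sum_le_sum (hb i hi)).trans (le_of_eq ?_)
    simp only [Finset.sum_add_distrib, Finset.sum_ite_eq, Finset.sum_const, Finset.card_range,
      nsmul_eq_mul]
    rw [Finset.sum_congr rfl fun i hi => if_pos hi]
    simp
    ring
  refine key.trans ?_
  rw [e1]
  have h1 : 2 * (1 / (K * θ')) * (K * P (arm k 0)) ≥ 2 := by
    have : 2 * (1 / (K * θ')) * (K * P (arm k 0)) = 2 * (P (arm k 0) / θ') := by
      field_simp
    rw [this]
    have := (one_le_div hθ0).2 (hle k)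
    linarith
  have h2 : (1 / (K * θ')) ^ 2 * (K + K ^ 2 * (θ' + δ) ^ 2) ≤ ε / 2 + (1 + ε / 2) := by
    have e : (1 / (K * θ')) ^ 2 * (K + K ^ 2 * (θ' + δ) ^ 2) =
        1 / (K * θ' ^ 2) + (1 + (2 * δ / θ' + δ ^ 2 / θ' ^ 2)) := by
      field_simp
      ring
    have h3 : 1 / (K * θ' ^ 2) ≤ ε / 2 := by
      rw [div_lt_iff₀ (by positivity)] at hK
      rw [div_le_iff₀ (by positivity)]
      nlinarith
    rw [e]
    linarith
  have h3 := mul_le_mul_of_nonneg_left e2 (sq_nonneg (1 / (K * θ')))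
  linarith

end IsLimit

end SquareModel

namespace SquareModel

open FK (V)
open scoped Topology

/-! ### Crossings of rectangles -/

/-- The vertices at height at least `N`. -/
def top (N : ℕ) : Set V := {w | (N : ℤ) ≤ w.2}

/-- The vertices at horizontal distance at least `n`. -/
def side (n : ℕ) : Set V := {w | (n : ℤ) ≤ |w.1|}

/-- The event that `(t, 0)` is connected to the top of the rectangle. -/
def up (n N : ℕ) (t : ℤ) : Set (Set Sq) := reach (Rc n N) (t, 0) (top N)

/-- The event that `(t, 0)` is connected to the sides of the rectangle. -/
def sd (n N : ℕ) (t : ℤ) : Set (Set Sq) := reach (Rc n N) (t, 0) (side n)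

lemma conn_Rc_end {n N : ℕ} {σ : Set Sq} {u w : V} (h : Conn (σ ∩ Rc n N) u w) :
    w = u ∨ ((w.1 + w.2) % 2 = 0 ∧ -(n : ℤ) ≤ w.1 ∧ w.1 ≤ n ∧ 0 ≤ w.2 ∧ w.2 ≤ N) := by
  rcases conn_end h with h | ⟨s, hs, a, hj⟩
  · exact Or.inl h
  · have h1 := mem_Rc.1 (Finset.mem_coe.1 hs.2)
    have h2 := joins_iff.1 hj.symm
    refine Or.inr ?_
    omega

lemma sd_succ_subset {n N : ℕ} {t : ℤ} (ht : |t| ≤ n) :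
    sd (n + 1) N t ⊆ sd n N t ∩ (closedOn (Fc n N))ᶜ := by
  rintro σ ⟨w, hw, hc⟩
  have hw : ((n + 1 : ℕ) : ℤ) ≤ |w.1| := hw
  have hsub : ∀ {u v : V}, Conn (σ ∩ Rc (n + 1) N ∩ Rc n N) u v → Conn (σ ∩ Rc n N) u v :=
    fun h => h.mono (Set.inter_subset_inter_left _ Set.inter_subset_left)
  have hFc : ∀ s ∈ σ ∩ Rc (n + 1) N, s ∉ Rc n N → s ∈ Fc n N := by
    rintro s ⟨-, hs⟩ hs'
    rw [Finset.mem_coe, mem_Rc] at hs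
    rw [mem_Rc] at hs'
    rw [mem_Fc]
    omega
  constructor
  · refine (conn_exit (F := Rc n N) (T := side n) hc fun s hs hs' a b hj _ => ?_).elim
      (fun h => ?_) fun h => ?_
    · have h1 := mem_Fc.1 (hFc s hs hs')
      have h2 := joins_iff.1 hj
      show (n : ℤ) ≤ |a.1|
      rw [le_abs']
      omega
    · refine ⟨w, ?_, hsub h⟩
      show (n : ℤ) ≤ |w.1|
      omega
    · exact isUpperSet_reach _ _ _ Set.inter_subset_left h
  · intro hcl
    refine (conn_exit (F := Rc n N) (T := ∅) hc fun s hs hs' a b hj _ => ?_).elim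
      (fun h => ?_) fun h => ?_
    · exact (hcl s (hFc s hs hs') hs.1).elim
    · rcases conn_Rc_end (hsub h) with rfl | h
      · have hw : ((n + 1 : ℕ) : ℤ) ≤ |t| := hw
        omega
      · rw [le_abs'] at hw
        omega
    · obtain ⟨w, hw, -⟩ := h
      exact hw

lemma arm_subset {n N m : ℕ} {t : ℤ} (hm : N + n + t.natAbs ≤ m) :
    arm m t ⊆ up n N t ∪ sd n N t := by
  rintro σ ⟨w, hw, hc⟩
  have hw : (m : ℤ) ≤ |w.1 - t| ∨ (m : ℤ) ≤ w.2 := hw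
  have hreach : ∀ σ ∈ reach (Rc n N) (t, 0) (top N ∪ side n), σ ∈ up n N t ∪ sd n N t := by
    rintro σ ⟨w, hw | hw, hc⟩
    · exact Or.inl ⟨w, hw, hc⟩
    · exact Or.inr ⟨w, hw, hc⟩
  apply hreach
  refine (conn_exit (F := Rc n N) (T := top N ∪ side n) hc fun s hs hs' a b hj _ => ?_).elim
    (fun h => ?_) fun h => ?_
  · have h1 := mem_bx.1 (Finset.mem_coe.1 hs.2)
    rw [mem_Rc] at hs'
    have h2 := joins_iff.1 hj
    show (N : ℤ) ≤ a.2 ∨ (n : ℤ) ≤ |a.1|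
    rw [le_abs']
    omega
  · refine ⟨w, ?_, h.mono (Set.inter_subset_inter_left _ Set.inter_subset_left)⟩
    show (N : ℤ) ≤ w.2 ∨ (n : ℤ) ≤ |w.1|
    rw [le_abs'] at *
    omega
  · exact isUpperSet_reach _ _ _ Set.inter_subset_left h

lemma up_succ_subset {n N : ℕ} : up n (N + 1) 0 ⊆ up n N 0 := by
  rintro σ ⟨w, hw, hc⟩
  have hw : ((N + 1 : ℕ) : ℤ) ≤ w.2 := hw
  refine (conn_exit (F := Rc n N) (T := top N) hc fun s hs hs' a b hj _ => ?_).elim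
    (fun h => ?_) fun h => ?_
  · have h1 := mem_Rc.1 (Finset.mem_coe.1 hs.2)
    rw [mem_Rc] at hs'
    have h2 := joins_iff.1 hj
    show (N : ℤ) ≤ a.2
    omega
  · refine ⟨w, ?_, h.mono (Set.inter_subset_inter_left _ Set.inter_subset_left)⟩
    show (N : ℤ) ≤ w.2
    omega
  · exact isUpperSet_reach _ _ _ Set.inter_subset_left h

/-- The event that one of the points `(L * i, 0)`, `i < K`, is connected to the top of the
rectangle. -/
def multi (n N : ℕ) (L : ℤ) (K : ℕ) : Set (Set Sq) :=
  {σ | ∃ i ∈ Finset.range K, σ ∈ up n N (L * (i : ℤ))}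

lemma isUpperSet_multi (n N : ℕ) (L : ℤ) (K : ℕ) : IsUpperSet (multi n N L K) := by
  rintro σ τ h ⟨i, hi, hσ⟩
  exact ⟨i, hi, isUpperSet_reach _ _ _ h hσ⟩

lemma dep_multi (n N : ℕ) (L : ℤ) (K : ℕ) : Dep (multi n N L K) (Rc n N : Set Sq) :=
  fun σ τ h => exists_congr fun _ => and_congr_right fun _ => dep_reach _ _ _ σ τ h

/-- The event that the origin is connected to the top of the rectangle weakly left of `h`. -/
def upL (n N : ℕ) (h : ℤ) : Set (Set Sq) := reach (Rc n N) (0, 0) {w | w.1 ≤ h ∧ (N : ℤ) ≤ w.2}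

/-- The event that the origin is connected to the top of the rectangle weakly right of `h`. -/
def upR (n N : ℕ) (h : ℤ) : Set (Set Sq) := reach (Rc n N) (0, 0) {w | h ≤ w.1 ∧ (N : ℤ) ≤ w.2}

lemma conn_Rc_top {n N : ℕ} (hN : 1 ≤ N) {σ : Set Sq} {w : V} (h : Conn (σ ∩ Rc n N) (0, 0) w)
    (hw : (N : ℤ) ≤ w.2) : w.2 = N ∧ (w.1 + w.2) % 2 = 0 ∧ -(n : ℤ) ≤ w.1 ∧ w.1 ≤ n := by
  rcases conn_Rc_end h with rfl | h
  · have hw : (N : ℤ) ≤ 0 := hw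
    omega
  · omega

/-- A primal path separates the dual from the top. -/
lemma notMem_trE_dlE {n N K : ℕ} (hN : N % 2 = 1) {L h a : ℤ} (hL : 0 ≤ L)
    (ha : L * K ≤ a) (hh : Even h) {σ : Set Sq} (h1 : σ ∈ upL n N h)
    (h2 : σ ∈ upR n N (h + a + 1)) :
    σ ∉ trE (-h) (dlE N (multi n N L K)) := by
  rintro ⟨i, hi, w, hw, hc⟩
  have hw : (N : ℤ) ≤ w.2 := hw
  obtain ⟨x, ⟨hx1, hx2⟩, hxc⟩ := h1
  obtain ⟨y, ⟨hy1, hy2⟩, hyc⟩ := h2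
  obtain ⟨ex, px, -, -⟩ := conn_Rc_top (by omega) hxc hx2
  obtain ⟨ey, py, -, -⟩ := conn_Rc_top (by omega) hyc hy2
  have hxy : Conn (σ ∩ Rc n N) (x.1, (N : ℤ)) (y.1, (N : ℤ)) := by
    rw [← ex]
    nth_rw 2 [ex]
    rw [← ey]
    exact hxc.symm.trans hyc
  have hi' : (i : ℤ) ≤ K := by
    have := Finset.mem_range.1 hi
    omega
  have hLi : 0 ≤ L * (i : ℤ) := by positivity
  have hLi' : L * (i : ℤ) ≤ a := (mul_le_mul_of_nonneg_left hi' hL).trans ha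
  have hd := conn_tr hh hc
  refine strip_crossing (N := N) (w := (w.1 + h, w.2)) (by omega) (by omega)
    (fun s hs => ?_) (fun s hs => ?_) (by omega) (by omega)
    hxy (a := L * (i : ℤ) + h) (by omega) (by omega) hw hd
  · have := mem_Rc.1 (Finset.mem_coe.1 hs.2)
    omega
  · obtain ⟨hs1, hs2⟩ := hs
    have h3 := mem_Rc.1 (Finset.mem_coe.1 hs2)
    refine ⟨h3.2.2.1, fun h4 => hs1 ?_⟩
    have h5 : rf N s ∈ σ := h4.1
    show (s.1 - h - -h, (N : ℤ) - 1 - s.2) ∈ σ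
    rw [sub_neg_eq_add, sub_add_cancel]
    exact h5

namespace IsLimit

variable {X : ℝ} {P : Set (Set Sq) → ℝ}

lemma sd_succ_le (hP : IsLimit X P) {n N : ℕ} {t : ℤ} (ht : |t| ≤ n) :
    P (sd (n + 1) N t) ≤ (1 - ((1 + X)⁻¹) ^ (2 * N)) * P (sd n N t) := by
  have hX := hP.one_le
  have hloc : Loc (sd n N t) := loc_reach _ _ _
  have h1 := hP.mono (loc_reach _ _ _) (hloc.inter (Loc.closedOn (Fc n N)).compl)
    (sd_succ_subset (N := N) ht)
  have h2 := hP.inter_add hloc (Loc.closedOn (Fc n N))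
  have h3 := hP.closed hloc (Fc n N) ((dep_reach (Rc n N) (t, 0) (side n)).mono
    fun s hs hs' => notMem_Rc_of_mem_Fc (Finset.mem_coe.1 hs') (Finset.mem_coe.1 hs))
  have h4 : ((1 + X)⁻¹) ^ (2 * N) ≤ ((1 + X)⁻¹) ^ (Fc n N).card :=
    pow_le_pow_of_le_one (by positivity) (inv_le_one_of_one_le₀ (by linarith)) (card_Fc_le n N)
  have h5 := mul_le_mul_of_nonneg_right h4 (hP.nonneg hloc)
  have h6 : P (sd (n + 1) N t) ≤ P (sd n N t ∩ (closedOn (Fc n N))ᶜ) := h1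
  linarith

lemma tendsto_sd (hP : IsLimit X P) (N : ℕ) (t : ℤ) :
    Tendsto (fun n => P (sd n N t)) atTop (𝓝 0) := by
  have hX := hP.one_le
  set δ : ℝ := ((1 + X)⁻¹) ^ (2 * N) with hδ
  have hδ0 : 0 < δ := by positivity
  have hδ1 : δ ≤ 1 := pow_le_one₀ (by positivity) (inv_le_one_of_one_le₀ (by linarith))
  rw [← tendsto_add_atTop_iff_nat t.natAbs]
  have hb : ∀ k, P (sd (k + t.natAbs) N t) ≤ (1 - δ) ^ k := by
    intro k
    induction k with
    | zero =>
      rw [pow_zero]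
      exact hP.le_one (loc_reach _ _ _)
    | succ k ih =>
      have h := hP.sd_succ_le (n := k + t.natAbs) (N := N) (t := t) (by
        rw [Int.abs_eq_natAbs]
        omega)
      have : k + 1 + t.natAbs = k + t.natAbs + 1 := by omega
      rw [this, pow_succ']
      exact h.trans (mul_le_mul_of_nonneg_left ih (by linarith))
  exact squeeze_zero (fun k => hP.nonneg (loc_reach _ _ _)) hb
    (tendsto_pow_atTop_nhds_zero_of_lt_one (by linarith) (by linarith))

lemma le_inter_add_sum (hP : IsLimit X P) {A : Set (Set Sq)} (hA : Loc A)
    {C : ℕ → Set (Set Sq)} (hC : ∀ i, Loc (C i)) (K : Finset ℕ) :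
    P A ≤ P (A ∩ {σ | ∀ i ∈ K, σ ∉ C i}) + ∑ i ∈ K, P (C i) := by
  classical
  induction K using Finset.induction_on with
  | empty => simp
  | insert i K hi ih =>
    have := hP.le_add (hA.inter (Loc.forall_notMem (K := K) hC))
      (hA.inter (Loc.forall_notMem (K := insert i K) hC)) (hC i) (by
        rintro σ ⟨h1, h2⟩
        by_cases h : σ ∈ C i
        · exact Or.inr h
        · refine Or.inl ⟨h1, fun j hj => ?_⟩
          rcases Finset.mem_insert.1 hj with rfl | hj
          · exact h
          · exact h2 j hj)
    rw [Finset.sum_insert hi]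
    linarith

lemma exists_multi (hP : IsLimit X P) {θ : ℝ} (hθ : 0 < θ) (h : ∀ n, θ ≤ P (arm n 0)) {ε : ℝ}
    (hε : 0 < ε) : ∃ (L : ℤ) (K : ℕ), 0 ≤ L ∧ Even L ∧
      ∀ N, ∀ᶠ n in atTop, 1 - ε ≤ P (multi n N L K) := by
  obtain ⟨L, K, hL, hLe, n₀, hn⟩ := hP.exists_arm hθ h (half_pos hε)
  refine ⟨L, K, hL, hLe, fun N => ?_⟩
  have hlim : Tendsto (fun n => ∑ i ∈ Finset.range K, P (sd n N (L * (i : ℤ)))) atTop (𝓝 0) := by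
    have := tendsto_finsetSum (Finset.range K) fun i _ => hP.tendsto_sd N (L * (i : ℤ))
    simpa using this
  filter_upwards [hlim.eventually_le_const (half_pos hε)] with n hs
  have hloc : Loc (multi n N L K) := ⟨_, dep_multi n N L K⟩
  obtain ⟨m, hm0, hm⟩ : ∃ m ≥ n₀, ∀ i ∈ Finset.range K, N + n + (L * (i : ℤ)).natAbs ≤ m := by
    refine ⟨n₀ + N + n + (L * (K : ℤ)).natAbs, by omega, fun i hi => ?_⟩
    have h1 : (L * (i : ℤ)).natAbs ≤ (L * (K : ℤ)).natAbs := by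
      rw [Int.natAbs_mul, Int.natAbs_mul]
      have := Finset.mem_range.1 hi
      exact Nat.mul_le_mul_left _ (by omega)
    omega
  have h1 := hP.le_inter_add_sum hloc.compl (C := fun i => sd n N (L * (i : ℤ)))
    (fun i => loc_reach _ _ _) (Finset.range K)
  have hlocS : Loc {σ | ∀ i ∈ Finset.range K, σ ∉ sd n N (L * (i : ℤ))} :=
    Loc.forall_notMem (A := fun i : ℕ => sd n N (L * (i : ℤ))) fun i => loc_reach _ _ _
  have hlocA : Loc {σ | ∀ i ∈ Finset.range K, σ ∉ arm m (L * (i : ℤ))} :=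
    Loc.forall_notMem (A := fun i : ℕ => arm m (L * (i : ℤ))) fun i => loc_reach _ _ _
  have h2 := hP.mono (hloc.compl.inter hlocS) hlocA (by
      rintro σ ⟨h1, h2⟩ i hi h3
      rcases arm_subset (hm i hi) h3 with h4 | h4
      · exact h1 ⟨i, hi, h4⟩
      · exact h2 i hi h4)
  have h3 := hn m hm0
  have h4 := hP.compl hloc
  linarith

/-- If the connections to the top of a rectangle are localized, they can be blocked. -/
lemma up_succ_le (hP : IsLimit X P) {θ : ℝ} (hθ : 0 < θ) {n N : ℕ} (hN : 1 ≤ N) (a : ℕ)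
    (hup : θ / 2 ≤ P (up n N 0))
    (hno : ∀ h : ℤ, Even h → θ / 8 ≤ P (upL n N h) → P (upR n N (h + a + 1)) < θ / 8) :
    P (up n (N + 1) 0) ≤ P (up n N 0) - ((1 + X)⁻¹) ^ (a + 5) * (θ / 4) := by
  have hX := hP.one_le
  obtain ⟨k, hk, hmin⟩ := Int.exists_least_of_bdd (P := fun k : ℤ => θ / 8 ≤ P (upL n N (2 * k)))
    ⟨-(n : ℤ), fun k hk => by
      by_contra! hlt
      have hE : upL n N (2 * k) = ∅ := by
        refine Set.eq_empty_of_forall_notMem ?_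
        rintro σ ⟨w, ⟨h1, h2⟩, hc⟩
        have := conn_Rc_top hN hc h2
        omega
      have h0 := hP.compl (A := Set.univ) ⟨∅, fun _ _ _ => Iff.rfl⟩
      rw [Set.compl_univ, hP.univ] at h0
      rw [hE, h0] at hk
      linarith⟩
    ⟨n, by
      have hle : P (up n N 0) ≤ P (upL n N (2 * (n : ℤ))) := by
        refine hP.mono (loc_reach _ _ _) (loc_reach _ _ _) ?_
        rintro σ ⟨w, hw, hc⟩
        have := conn_Rc_top hN hc hw
        exact ⟨w, ⟨by omega, hw⟩, hc⟩
      linarith⟩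
  have hL : P (upL n N (2 * (k - 1))) < θ / 8 := by
    by_contra! h
    have := hmin _ h
    omega
  have hR := hno (2 * k) (even_two_mul k) hk
  have lU : Loc (up n N 0) := loc_reach _ _ _
  have lL : Loc (upL n N (2 * (k - 1))) := loc_reach _ _ _
  have lR : Loc (upR n N (2 * k + a + 1)) := loc_reach _ _ _
  set G := up n N 0 ∩ ((upL n N (2 * (k - 1)))ᶜ ∩ (upR n N (2 * k + a + 1))ᶜ) with hG
  have lG : Loc G := lU.inter (lL.compl.inter lR.compl)
  have hGP : θ / 4 ≤ P G := by
    have h1 := hP.le_add lU (lG.union lL) lR (by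
      intro σ hσ
      by_cases h1 : σ ∈ upL n N (2 * (k - 1))
      · exact Or.inl (Or.inr h1)
      · by_cases h2 : σ ∈ upR n N (2 * k + a + 1)
        · exact Or.inr h2
        · exact Or.inl (Or.inl ⟨hσ, h1, h2⟩))
    have h2 := hP.le_add (lG.union lL) lG lL subset_rfl
    linarith
  set F : Finset Sq := Finset.Ico (2 * k - 3) (2 * k + a + 2) ×ˢ {(N : ℤ)} with hF
  have mF : ∀ s : Sq, s ∈ F ↔ (2 * k - 3 ≤ s.1 ∧ s.1 < 2 * k + a + 2) ∧ s.2 = N := by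
    intro s
    rw [hF, Finset.mem_product, Finset.mem_Ico, Finset.mem_singleton]
  have cF : F.card = a + 5 := by
    rw [hF, Finset.card_product, Int.card_Ico, Finset.card_singleton]
    omega
  have dG : Dep G (F : Set Sq)ᶜ := by
    have : ∀ T : Set V, Dep (reach (Rc n N) (0, 0) T) (F : Set Sq)ᶜ := fun T =>
      (dep_reach _ _ _).mono fun s hs hs' => by
        rw [Finset.mem_coe, mem_Rc] at hs
        rw [Finset.mem_coe, mF] at hs'
        omega
    exact (this _).inter ((this _).compl.inter (this _).compl)
  have hcl := hP.closed lG F dG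
  rw [cF] at hcl
  have hsub : up n (N + 1) 0 ⊆ up n N 0 ∩ (G ∩ closedOn F)ᶜ := by
    intro σ hσ
    refine ⟨up_succ_subset hσ, ?_⟩
    rintro ⟨⟨-, hnL, hnR⟩, hclosed⟩
    obtain ⟨w, hw, hc⟩ := hσ
    have hw : ((N + 1 : ℕ) : ℤ) ≤ w.2 := hw
    have hsub : ∀ {u v : V}, Conn (σ ∩ Rc n (N + 1) ∩ Rc n N) u v → Conn (σ ∩ Rc n N) u v :=
      fun h => h.mono (Set.inter_subset_inter_left _ Set.inter_subset_left)
    refine (conn_exit (F := Rc n N) (T := ∅) hc fun s hs hs' b c hj hb => ?_).elim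
      (fun h => ?_) fun h => ?_
    · exfalso
      have h1 := mem_Rc.1 (Finset.mem_coe.1 hs.2)
      rw [mem_Rc] at hs'
      have h2 := joins_iff.1 hj
      have hb2 : (N : ℤ) ≤ b.2 := by omega
      have h3 : ¬ b.1 ≤ 2 * (k - 1) := fun h => hnL ⟨b, ⟨h, hb2⟩, hsub hb⟩
      have h4 : ¬ 2 * k + a + 1 ≤ b.1 := fun h => hnR ⟨b, ⟨h, hb2⟩, hsub hb⟩
      refine hclosed s (Finset.mem_coe.2 ((mF s).2 ?_)) hs.1
      omega
    · have := conn_Rc_top hN (hsub h) (by omega)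
      omega
    · obtain ⟨w, hw, -⟩ := h
      exact hw
  have lF := Loc.closedOn F
  have h1 := hP.mono (loc_reach _ _ _) (lU.inter (lG.inter lF).compl) hsub
  have h2 := hP.inter_add lU (lG.inter lF)
  have h3 : up n N 0 ∩ (G ∩ closedOn F) = G ∩ closedOn F :=
    Set.inter_eq_right.2 fun σ hσ => hσ.1.1
  rw [h3] at h2
  have h4 := mul_le_mul_of_nonneg_left hGP (by positivity : 0 ≤ ((1 + X)⁻¹) ^ (a + 5))
  have h5 : P (up n (N + 1) 0) ≤ P (up n N 0 ∩ (G ∩ closedOn F)ᶜ) := h1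
  linarith

/-- The origin does not percolate. -/
theorem not_forall_le_arm (hP : IsLimit X P) {θ : ℝ} (hθ : 0 < θ) : ¬ ∀ n, θ ≤ P (arm n 0) := by
  intro h
  have hX := hP.one_le
  obtain ⟨L, K, hL, hLe, hmulti⟩ := hP.exists_multi hθ h
    (by positivity : 0 < (θ / 8) ^ 2 / 2)
  obtain ⟨a, ha⟩ : ∃ a : ℕ, (a : ℤ) = L * K := ⟨_, Int.toNat_of_nonneg (by positivity)⟩
  set κ : ℝ := ((1 + X)⁻¹) ^ (a + 5) * (θ / 4) with hκ
  have hκ0 : 0 < κ := by positivity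
  obtain ⟨R, hR⟩ := exists_nat_gt (1 / κ)
  obtain ⟨n, hn1, hn2⟩ : ∃ n, (∀ N ∈ Finset.range (2 * R + 2), 1 - (θ / 8) ^ 2 / 2 ≤
      P (multi n N L K)) ∧ ∀ N ∈ Finset.range (2 * R + 2), P (sd n N 0) ≤ θ / 2 :=
    (((Finset.eventually_all _).2 fun N _ => hmulti N).and ((Finset.eventually_all _).2 fun N _ =>
      (hP.tendsto_sd N 0).eventually_le_const (half_pos hθ))).exists
  have hup : ∀ N ∈ Finset.range (2 * R + 2), θ / 2 ≤ P (up n N 0) := by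
    intro N hN
    have h1 := hP.le_add (loc_reach _ _ _) (loc_reach _ _ _) (loc_reach _ _ _)
      (arm_subset (n := n) (N := N) (m := N + n) (t := 0) (by simp))
    have h2 : P (arm (N + n) 0) ≤ P (up n N 0) + P (sd n N 0) := h1
    have h3 := h (N + n)
    have h4 := hn2 N hN
    linarith
  have hstep : ∀ N ∈ Finset.range (2 * R + 2), N % 2 = 1 →
      P (up n (N + 1) 0) ≤ P (up n N 0) - κ := by
    intro N hN hodd
    refine hP.up_succ_le hθ (by omega) a (hup N hN) fun g hg hgL => ?_
    by_contra! hgR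
    have lD : Loc (dlE N (multi n N L K)) := ⟨_, dep_dlE (dep_multi n N L K)⟩
    have h1 := hP.le_dlE hodd (isUpperSet_multi n N L K) (dep_multi n N L K)
    have h2 := hn1 N hN
    have h3 : P (trE (-g) (dlE N (multi n N L K))) = P (dlE N (multi n N L K)) := by
      have hc := hP.trE_eq hg.neg (isLowerSet_dlE (N := N) (isUpperSet_multi n N L K)).compl
        (dep_dlE (dep_multi n N L K)).compl
        fun s hs => (mem_Rc.1 (Finset.mem_coe.1 hs)).2.2.1
      have hc' : trE (-g) (dlE N (multi n N L K))ᶜ = (trE (-g) (dlE N (multi n N L K)))ᶜ := rfl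
      have lT : Loc (trE (-g) (dlE N (multi n N L K))) :=
        ⟨_, dep_trE (dep_dlE (dep_multi n N L K))⟩
      rw [hc', hP.compl lT, hP.compl lD] at hc
      linarith
    have lT : Loc (trE (-g) (dlE N (multi n N L K))) :=
      ⟨_, dep_trE (dep_dlE (dep_multi n N L K))⟩
    have lL : Loc (upL n N g) := loc_reach _ _ _
    have lR : Loc (upR n N (g + a + 1)) := loc_reach _ _ _
    have h4 := hP.fkg lL lR (isUpperSet_reach _ _ _) (isUpperSet_reach _ _ _)
    have h5 := hP.mono (lL.inter lR) lT.compl fun σ hσ =>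
      notMem_trE_dlE hodd hL ha.ge hg hσ.1 hσ.2
    rw [hP.compl lT, h3] at h5
    have h6 : θ / 8 * (θ / 8) ≤ P (upL n N g) * P (upR n N (g + a + 1)) :=
      mul_le_mul hgL hgR (by positivity) (hP.nonneg lL)
    nlinarith
  have hdec : ∀ r ≤ R, P (up n (2 * r + 1) 0) ≤ 1 - r * κ := by
    intro r
    induction r with
    | zero =>
      intro _
      rw [Nat.cast_zero, zero_mul, sub_zero]
      exact hP.le_one (loc_reach _ _ _)
    | succ r ih =>
      intro hr
      have h1 := ih (by omega)
      have h2 := hstep (2 * r + 1) (Finset.mem_range.2 (by omega)) (by omega)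
      have h3 : P (up n (2 * r + 1 + 1 + 1) 0) ≤ P (up n (2 * r + 1 + 1) 0) :=
        hP.mono (loc_reach _ _ _) (loc_reach _ _ _) up_succ_subset
      have e : 2 * (r + 1) + 1 = 2 * r + 1 + 1 + 1 := by ring
      rw [e]
      push_cast
      linarith
  have h1 := hdec R le_rfl
  have h2 := hup (2 * R + 1) (Finset.mem_range.2 (by omega))
  rw [div_lt_iff₀ hκ0] at hR
  linarith

end IsLimit

end SquareModel

namespace SquareModel

open FK
open scoped Topology

/-! ### Edges of the lattice as diagonals of squares -/

lemma adjL_of_joins {s : Sq} {u v : V} (h : Joins s u v) : AdjL u v := by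
  obtain ⟨h0, h1, h2⟩ := joins_iff.1 h
  refine ⟨Int.even_iff.2 h0, Int.even_iff.2 (by omega), ?_, ?_⟩
  · rcases h1 with ⟨a, b⟩ | ⟨a, b⟩ <;> rw [a, b] <;> ring
  · rcases h2 with ⟨a, b⟩ | ⟨a, b⟩ <;> rw [a, b] <;> ring

/-- The diagonal of a square. -/
def diag (s : Sq) : Edge AdjL := ⟨s(e0 s, e1 s), e0 s, e1 s, adjL_of_joins (joins_ends s), rfl⟩

lemma joins_of_adjL {u v : V} (h : AdjL u v) : ∃ s, Joins s u v := by
  obtain ⟨h0, -, h1, h2⟩ := h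
  rw [Int.even_iff] at h0
  rw [sq_eq_one_iff] at h1 h2
  refine ⟨(min u.1 v.1, min u.2 v.2), joins_iff.2 ⟨h0, ?_, ?_⟩⟩ <;> dsimp only <;> omega

lemma diag_surjective : Function.Surjective diag := by
  rintro ⟨_, u, v, huv, rfl⟩
  obtain ⟨s, hs⟩ := joins_of_adjL huv
  refine ⟨s, Subtype.ext ?_⟩
  rcases hs with ⟨rfl, rfl⟩ | ⟨rfl, rfl⟩
  · rfl
  · exact Sym2.eq_swap

lemma inc_diag {a : V} {s : Sq} : Inc AdjL a (diag s) ↔ a = e0 s ∨ a = e1 s := Sym2.mem_iff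

lemma diag_injective : Function.Injective diag := by
  intro s t h
  have h0 := joins_iff.1 (joins_ends s)
  have h1 : Joins t (e0 s) (e1 s) := by
    have := congrArg Subtype.val h
    rcases Sym2.eq_iff.1 this with h | h
    · exact Or.inl h
    · exact Or.inr h
  have h1 := joins_iff.1 h1
  exact Prod.ext (by omega) (by omega)

lemma coords_of_inc {a : V} {s : Sq} (h : a = e0 s ∨ a = e1 s) :
    (a.1 + a.2) % 2 = 0 ∧ (a.1 = s.1 ∨ a.1 = s.1 + 1) ∧ (a.2 = s.2 ∨ a.2 = s.2 + 1) := by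
  have h1 := joins_iff.1 (joins_ends s)
  rcases h with rfl | rfl <;> omega

lemma forall_mem_diag {s : Sq} {p : V → Prop} :
    (∀ v ∈ (diag s : Sym2 V), p v) ↔ p (e0 s) ∧ p (e1 s) := by
  constructor
  · exact fun h => ⟨h _ (Sym2.mem_mk_left _ _), h _ (Sym2.mem_mk_right _ _)⟩
  · rintro ⟨h0, h1⟩ v hv
    rcases inc_diag.1 hv with rfl | rfl
    · exact h0
    · exact h1

lemma diag_mem_HPedges {s : Sq} : diag s ∈ HPedges ↔ s ∈ Hs := by
  refine (forall_mem_diag (p := fun v => v ∈ HP)).trans ?_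
  have h := joins_iff.1 (joins_ends s)
  show 0 ≤ (e0 s).2 ∧ 0 ≤ (e1 s).2 ↔ 0 ≤ s.2
  omega

lemma mem_rectV {x1 x2 y1 y2 : ℤ} {v : V} :
    v ∈ rectV x1 x2 y1 y2 ↔ (x1 ≤ v.1 ∧ v.1 ≤ x2) ∧ y1 ≤ v.2 ∧ v.2 ≤ y2 := by
  rw [rectV, Finset.mem_product, Finset.mem_Icc, Finset.mem_Icc]

lemma diag_mem_hpDomain {N : ℕ} {s : Sq} : diag s ∈ hpDomain N ↔ s ∈ B N := by
  classical
  have h := joins_iff.1 (joins_ends s)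
  rw [hpDomain, finEdgesIn, Finset.mem_subtype, Finset.mem_image, mem_B]
  constructor
  · rintro ⟨⟨u, v⟩, huv, he⟩
    rw [Finset.mem_filter, Finset.mem_product, mem_rectV, mem_rectV] at huv
    obtain ⟨⟨hu, hv⟩, -⟩ := huv
    rcases Sym2.eq_iff.1 he with ⟨rfl, rfl⟩ | ⟨rfl, rfl⟩ <;> dsimp only at * <;> omega
  · intro hs
    refine ⟨(e0 s, e1 s), ?_, rfl⟩
    rw [Finset.mem_filter, Finset.mem_product, mem_rectV, mem_rectV]
    refine ⟨?_, adjL_of_joins (joins_ends s)⟩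
    dsimp only
    omega

lemma connectedIn_iff {ω : Config AdjL} {S : Set (Edge AdjL)} {u v : V} :
    ConnectedIn AdjL ω S u v ↔ Conn {s | diag s ∈ S ∧ ω (diag s) = true} u v := by
  constructor
  · intro h
    induction h with
    | refl => exact Conn.refl _ _
    | @tail a b _ hab ih =>
      obtain ⟨e, he, hω, ha, hb⟩ := hab
      obtain ⟨s, rfl⟩ := diag_surjective e
      have hs : s ∈ {s | diag s ∈ S ∧ ω (diag s) = true} := ⟨he, hω⟩
      refine ih.trans ?_
      rcases inc_diag.1 ha with rfl | rfl <;> rcases inc_diag.1 hb with rfl | rfl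
      · exact Conn.refl _ _
      · exact Conn.ends hs
      · exact (Conn.ends hs).symm
      · exact Conn.refl _ _
  · intro h
    induction h with
    | refl => exact Relation.ReflTransGen.refl
    | @tail a b _ hab ih =>
      obtain ⟨s, ⟨hs, hω⟩, hj⟩ := hab
      refine ih.tail ⟨diag s, hs, hω, ?_, ?_⟩
      · exact inc_diag.2 (hj.imp And.left And.left)
      · exact inc_diag.2 (hj.symm.imp And.left And.left)

lemma mem_vertexSet {N : ℕ} {v : V} : v ∈ vertexSet AdjL (hpDomain N) ↔ v ∈ U N := by
  constructor
  · rintro ⟨e, he, hv⟩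
    obtain ⟨s, rfl⟩ := diag_surjective e
    exact ⟨s, diag_mem_hpDomain.1 he, inc_diag.1 hv⟩
  · rintro ⟨s, hs, hv⟩
    exact ⟨diag s, diag_mem_hpDomain.2 hs, inc_diag.2 hv⟩

/-- A vertex of the domain with an incident edge outside of the domain is on the boundary. -/
lemma mem_bdry {N : ℕ} {v : V} (hv : v ∈ U N) {s : Sq} (hs : s ∉ B N)
    (hvs : v = e0 s ∨ v = e1 s) : v ∈ bdry AdjL 4 (hpDomain N) := by
  classical
  refine ⟨mem_vertexSet.2 hv, ?_⟩
  set Q : Finset Sq := {(v.1, v.2), (v.1 - 1, v.2), (v.1, v.2 - 1), (v.1 - 1, v.2 - 1)} with hQ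
  have hmem : ∀ {t : Sq}, (v = e0 t ∨ v = e1 t) → t ∈ Q := by
    intro t ht
    have := coords_of_inc ht
    simp only [hQ, Finset.mem_insert, Finset.mem_singleton, Prod.ext_iff]
    omega
  have hsub : ((hpDomain N).filter fun e => Inc AdjL v e) ⊆ (Q.erase s).image diag := by
    intro e he
    obtain ⟨t, rfl⟩ := diag_surjective e
    obtain ⟨h1, h2⟩ := Finset.mem_filter.1 he
    refine Finset.mem_image_of_mem _ (Finset.mem_erase.2 ⟨?_, hmem (inc_diag.1 h2)⟩)
    rintro rfl
    exact hs (diag_mem_hpDomain.1 h1)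
  have h1 := (Finset.card_le_card hsub).trans Finset.card_image_le
  have h2 := Finset.card_erase_lt_of_mem (hmem hvs)
  have h3 : Q.card ≤ 4 := Finset.card_le_four
  have h4 : degree AdjL (hpDomain N) v = ((hpDomain N).filter fun e => Inc AdjL v e).card := by
    unfold degree
    congr
  omega

/-! ### Clusters -/

/-- The squares of the half-plane outside of the box. -/
def outer (N : ℕ) : Set Sq := Hs \ (B N : Set Sq)

lemma connectedIn_tau10 {N : ℕ} {u v : V} :
    ConnectedIn AdjL tau10 {e | e ∉ hpDomain N} u v ↔ Conn (outer N) u v := by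
  classical
  have : {s : Sq | diag s ∈ {e | e ∉ hpDomain (N : ℤ)} ∧ tau10 (diag s) = true} = outer N := by
    ext s
    rw [Set.mem_ofPred_eq, Set.mem_ofPred_eq, diag_mem_hpDomain, tau10, ite_eq_left_iff,
      diag_mem_HPedges, outer, Set.mem_sdiff, Finset.mem_coe, and_comm]
    simp
  rw [connectedIn_iff, this]

lemma eq_or_inc_of_conn {σ : Set Sq} {u v : V} (h : Conn σ u v) :
    u = v ∨ (∃ s ∈ σ, u = e0 s ∨ u = e1 s) ∧ ∃ s ∈ σ, v = e0 s ∨ v = e1 s := by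
  have key : ∀ {u v : V}, Conn σ u v → v = u ∨ ∃ s ∈ σ, v = e0 s ∨ v = e1 s := by
    intro u v h
    rcases conn_end h with h | ⟨s, hs, a, hj⟩
    · exact Or.inl h
    · exact Or.inr ⟨s, hs, hj.symm.imp And.left And.left⟩
  rcases key h with h1 | h1
  · exact Or.inl h1.symm
  rcases key h.symm with h2 | h2
  · exact Or.inl h2
  · exact Or.inr ⟨h2, h1⟩

lemma inc_outer_of_infinite {N : ℕ} {u : V}
    (h : InfCluster AdjL tau10 {e | e ∉ hpDomain N} u) : ∃ s ∈ outer N, u = e0 s ∨ u = e1 s := by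
  by_contra hn
  refine h ((Set.finite_singleton u).subset fun v hv => ?_)
  rcases eq_or_inc_of_conn (connectedIn_tau10.1 hv) with h | h
  · exact h.symm
  · exact (hn h.1).elim

lemma conn_outer {N : ℕ} {u v : V} (hu : ∃ s ∈ outer N, u = e0 s ∨ u = e1 s)
    (hv : ∃ s ∈ outer N, v = e0 s ∨ v = e1 s) : Conn (outer N) u v := by
  have key : ∀ {u : V}, (∃ s ∈ outer N, u = e0 s ∨ u = e1 s) →
      (u.1 + u.2) % 2 = 0 ∧ 0 ≤ u.2 ∧ ((N : ℤ) ≤ u.2 ∨ u.1 ≤ -N ∨ N ≤ u.1) := by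
    rintro u ⟨s, ⟨h1, h2⟩, h3⟩
    have h1 : 0 ≤ s.2 := h1
    rw [Finset.mem_coe, mem_B] at h2
    have := coords_of_inc h3
    omega
  refine (conn_outside (key hu) (key hv)).mono ?_
  rintro s ⟨h1, h2⟩
  refine ⟨h1, ?_⟩
  rw [Finset.mem_coe, mem_B]
  omega

lemma inducedBC_conn {N : ℕ} {u v : bdry AdjL 4 (hpDomain N)}
    (h : (inducedBC AdjL 4 (hpDomain N) tau10).r u v) : Conn (outer N) u.1 v.1 := by
  induction h with
  | rel u v h =>
    rcases h with h | ⟨h1, h2⟩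
    · exact connectedIn_tau10.1 h
    · exact conn_outer (inc_outer_of_infinite h1) (inc_outer_of_infinite h2)
  | refl => exact Conn.refl _ _
  | symm _ _ _ ih => exact ih.symm
  | trans _ _ _ _ _ ih ih' => exact ih.trans ih'

/-- The open squares of a configuration. -/
def opens (ω : Config AdjL) : Set Sq := {s | ω (diag s) = true}

open Classical in
/-- The open squares of a configuration in the box. -/
def toF (N : ℕ) (η : {e // e ∈ hpDomain N} → Bool) : Finset Sq :=
  (B N).filter fun s => extendBy AdjL (hpDomain N) η (diag s) = true

lemma coe_toF {N : ℕ} (η : {e // e ∈ hpDomain N} → Bool) :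
    (toF N η : Set Sq) = opens (extendBy AdjL (hpDomain N) η) := by
  ext s
  rw [Finset.mem_coe, toF, Finset.mem_filter, opens, Set.mem_ofPred_eq, and_iff_right_iff_imp]
  intro h
  by_contra hs
  rw [extendBy, dif_neg (mt diag_mem_hpDomain.1 hs)] at h
  exact Bool.false_ne_true h

lemma mem_toF {N : ℕ} {η : {e // e ∈ hpDomain N} → Bool} {s : Sq} :
    s ∈ toF N η ↔ extendBy AdjL (hpDomain N) η (diag s) = true := by
  rw [← Finset.mem_coe, coe_toF]
  rfl

lemma toF_subset {N : ℕ} (η : {e // e ∈ hpDomain N} → Bool) : toF N η ⊆ B N :=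
  Finset.filter_subset _ _

lemma clusterCount_eq {N : ℕ} (η : {e // e ∈ hpDomain N} → Bool) :
    clusterCount AdjL 4 (hpDomain N) (inducedBC AdjL 4 (hpDomain N) tau10)
      (extendBy AdjL (hpDomain N) η) = kk (U N) (full N (toF N η)) := by
  set σ : Set Sq := full N (toF N η) with hσ
  have hout : outer N ⊆ σ := Set.subset_union_right
  have hin : ∀ s ∈ toF N η, s ∈ σ := fun s hs => Or.inl hs
  unfold clusterCount kk
  set r : vertexSet AdjL (hpDomain N) → vertexSet AdjL (hpDomain N) → Prop :=
    fun u v => (∃ e ∈ hpDomain (N : ℤ), extendBy AdjL (hpDomain N) η e = true ∧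
      Inc AdjL u.1 e ∧ Inc AdjL v.1 e) ∨
      ∃ hu : u.1 ∈ bdry AdjL 4 (hpDomain N), ∃ hv : v.1 ∈ bdry AdjL 4 (hpDomain N),
        (inducedBC AdjL 4 (hpDomain N) tau10).r ⟨u.1, hu⟩ ⟨v.1, hv⟩ with hr
  have hconn : ∀ u v, r u v → Conn σ u.1 v.1 := by
    rintro ⟨u, hu⟩ ⟨v, hv⟩ (⟨e, -, h1, h2, h3⟩ | ⟨h1, h2, h3⟩)
    · obtain ⟨s, rfl⟩ := diag_surjective e
      have hs := hin s (mem_toF.2 h1)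
      dsimp only at h2 h3 ⊢
      rcases inc_diag.1 h2 with rfl | rfl <;> rcases inc_diag.1 h3 with rfl | rfl
      · exact Conn.refl _ _
      · exact Conn.ends hs
      · exact (Conn.ends hs).symm
      · exact Conn.refl _ _
    · exact (inducedBC_conn h3).mono hout
  have hwire : ∀ u v : vertexSet AdjL (hpDomain N), Conn (outer N) u.1 v.1 →
      Relation.EqvGen r u v := by
    intro u v h
    rcases eq_or_inc_of_conn h with he | ⟨⟨s, hs, hus⟩, t, ht, hvt⟩
    · rw [Subtype.ext he]
      exact Relation.EqvGen.refl _
    · exact Relation.EqvGen.rel _ _ (Or.inr ⟨mem_bdry (mem_vertexSet.1 u.2) hs.2 hus,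
        mem_bdry (mem_vertexSet.1 v.2) ht.2 hvt,
        Relation.EqvGen.rel _ _ (Or.inl (connectedIn_tau10.2 h))⟩)
  have hpath : ∀ (u : vertexSet AdjL (hpDomain N)) (v : V), Conn σ u.1 v →
      ∃ w : vertexSet AdjL (hpDomain N), Relation.EqvGen r u w ∧ Conn (outer N) w.1 v := by
    intro u v h
    induction h with
    | refl => exact ⟨u, Relation.EqvGen.refl _, Conn.refl _ _⟩
    | @tail a b _ hab ih =>
      obtain ⟨w, hw, hc⟩ := ih
      obtain ⟨s, hs, hj⟩ := hab
      rcases hs with hs | hs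
      · have hsB : diag s ∈ hpDomain (N : ℤ) := diag_mem_hpDomain.2 (toF_subset η hs)
        have ha := inc_diag.2 (hj.imp And.left And.left)
        have hb := inc_diag.2 (hj.symm.imp And.left And.left)
        have h1 := hwire w ⟨a, diag s, hsB, ha⟩ hc
        exact ⟨⟨b, diag s, hsB, hb⟩, (hw.trans _ _ _ h1).trans _ _ _
          (Relation.EqvGen.rel _ _ (Or.inl ⟨diag s, hsB, mem_toF.1 hs, ha, hb⟩)), Conn.refl _ _⟩
      · exact ⟨w, hw, hc.trans (Conn.of_joins (σ := outer N) hs hj)⟩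
  have hU : ∀ u : vertexSet AdjL (hpDomain N), u.1 ∈ U N := fun u => mem_vertexSet.1 u.2
  refine Nat.card_eq_of_bijective
    (Quot.lift (fun u => (⟨cluster σ u.1, u.1, hU u, rfl⟩ : cluster σ '' U N))
      fun u v h => Subtype.ext (cluster_eq_iff.2 (hconn u v h))) ⟨?_, ?_⟩
  · rintro ⟨u⟩ ⟨v⟩ h
    have hc : Conn σ u.1 v.1 := cluster_eq_iff.1 (congrArg Subtype.val h)
    obtain ⟨w, hw, hwv⟩ := hpath u v.1 hc
    exact Quot.eqvGen_sound (hw.trans _ _ _ (hwire w v hwv))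
  · rintro ⟨_, u, hu, rfl⟩
    exact ⟨Quot.mk _ ⟨u, mem_vertexSet.2 hu⟩, rfl⟩

lemma openCount_eq {N : ℕ} (η : {e // e ∈ hpDomain N} → Bool) :
    openCount AdjL (hpDomain N) η = (toF N η).card := by
  symm
  unfold openCount
  refine Finset.card_bij (fun s hs => ⟨diag s, diag_mem_hpDomain.2 (toF_subset η hs)⟩) ?_ ?_ ?_
  · intro s hs
    rw [Finset.mem_filter]
    refine ⟨Finset.mem_univ _, ?_⟩
    have := mem_toF.1 hs
    rwa [extendBy, dif_pos (diag_mem_hpDomain.2 (toF_subset η hs))] at this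
  · intro s _ t _ h
    exact diag_injective (congrArg Subtype.val h)
  · rintro ⟨e, he⟩ h
    obtain ⟨s, rfl⟩ := diag_surjective e
    refine ⟨s, ?_, rfl⟩
    rw [mem_toF, extendBy, dif_pos he]
    exact (Finset.mem_filter.1 h).2

lemma pc_div {q : ℝ} : pc q / (1 - pc q) = √q := by
  have : 0 ≤ √q := Real.sqrt_nonneg q
  unfold pc
  field_simp
  ring

lemma fkWeight_eq {q : ℝ} (hq : 1 ≤ q) {N : ℕ} (η : {e // e ∈ hpDomain N} → Bool) :
    fkWeight AdjL (pc q) q 4 (hpDomain N) (inducedBC AdjL 4 (hpDomain N) tau10) η =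
      wt (√q) N (toF N η) := by
  rw [fkWeight, wt, pc_div, openCount_eq, clusterCount_eq, Real.sq_sqrt (by linarith)]

end SquareModel

namespace SquareModel

open FK
open scoped Topology

/-! ### The box measures as FK measures -/

lemma toF_injective (N : ℕ) : Function.Injective (toF N) := by
  intro η η' h
  funext ⟨e, he⟩
  obtain ⟨s, rfl⟩ := diag_surjective e
  have h1 : s ∈ toF N η ↔ s ∈ toF N η' := by rw [h]
  rw [mem_toF, mem_toF, extendBy, extendBy, dif_pos he, dif_pos he] at h1
  exact Bool.eq_iff_iff.2 h1

open Classical in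
lemma sum_fkWeight {q : ℝ} (hq : 1 ≤ q) (N : ℕ) (A : Set (Set Sq)) :
    ∑ η with opens (extendBy AdjL (hpDomain N) η) ∈ A,
      fkWeight AdjL (pc q) q 4 (hpDomain N) (inducedBC AdjL 4 (hpDomain N) tau10) η =
    mass (√q) N A := by
  unfold mass
  refine Finset.sum_bij (fun η _ => toF N η) ?_ ?_ ?_ ?_
  · intro η hη
    rw [mem_ev, coe_toF]
    exact ⟨toF_subset η, (Finset.mem_filter.1 hη).2⟩
  · exact fun η _ η' _ h => toF_injective N h
  · intro ζ hζ
    obtain ⟨h1, h2⟩ := mem_ev.1 hζ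
    obtain ⟨η, hη⟩ : ∃ η : {e // e ∈ hpDomain (N : ℤ)} → Bool, toF N η = ζ := by
      refine ⟨fun e => decide (∃ s ∈ ζ, diag s = e.1), ?_⟩
      ext s
      rw [mem_toF, extendBy]
      constructor
      · intro h
        split_ifs at h
        obtain ⟨t, ht, hts⟩ := of_decide_eq_true h
        rwa [← diag_injective hts]
      · intro h
        rw [dif_pos (diag_mem_hpDomain.2 (h1 h))]
        exact decide_eq_true ⟨s, h, rfl⟩
    refine ⟨η, ?_, hη⟩
    rw [Finset.mem_filter, ← coe_toF, hη]
    exact ⟨Finset.mem_univ _, h2⟩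
  · exact fun η _ => fkWeight_eq hq η

/-- The event on configurations induced by an event on sets of squares. -/
def event (A : Set (Set Sq)) : Set (Config AdjL) := {ω | opens ω ∈ A}

lemma measurable_extendBy (D : Finset (Edge AdjL)) : Measurable (extendBy AdjL D) := by
  refine measurable_pi_iff.2 fun e => ?_
  unfold extendBy
  split_ifs with h
  · exact measurable_pi_apply _
  · exact measurable_const

lemma measurableSet_cylinder (D : Finset (Edge AdjL)) (η : {e // e ∈ D} → Bool) :
    MeasurableSet (cylinder AdjL D η) := by
  rw [FK.cylinder, Set.ofPred_forall]
  refine MeasurableSet.iInter fun e => ?_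
  exact measurableSet_eq_fun (measurable_pi_apply e.1) measurable_const

open Classical in
/-- Local events are finite unions of cylinders. -/
lemma event_eq_biUnion {A : Set (Set Sq)} {F : Finset Sq} (hA : Dep A F) :
    event A = ⋃ η ∈ Finset.univ.filter
        (fun η : {e // e ∈ F.image diag} → Bool => opens (extendBy AdjL (F.image diag) η) ∈ A),
      cylinder AdjL (F.image diag) η := by
  have key : ∀ ω η, ω ∈ cylinder AdjL (F.image diag) η →
      (opens ω ∈ A ↔ opens (extendBy AdjL (F.image diag) η) ∈ A) := by
    intro ω η hω
    refine hA _ _ fun s hs => ?_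
    have hs' : diag s ∈ F.image diag := Finset.mem_image_of_mem _ (Finset.mem_coe.1 hs)
    show ω (diag s) = true ↔ extendBy AdjL (F.image diag) η (diag s) = true
    rw [extendBy, dif_pos hs', hω ⟨diag s, hs'⟩]
  ext ω
  simp only [Set.mem_iUnion, Finset.mem_filter, Finset.mem_univ, true_and, exists_prop]
  constructor
  · intro h
    have hω : ω ∈ cylinder AdjL (F.image diag) (restrictD AdjL _ ω) := fun e => rfl
    exact ⟨_, (key _ _ hω).1 h, hω⟩
  · rintro ⟨η, h1, h2⟩
    exact (key _ _ h2).2 h1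

lemma measurableSet_event {A : Set (Set Sq)} {F : Finset Sq} (hA : Dep A F) :
    MeasurableSet (event A) := by
  classical
  rw [event_eq_biUnion hA]
  exact Finset.measurableSet_biUnion _ fun η _ => measurableSet_cylinder _ η

lemma tendsto_event {μ : ℕ → Measure (Config AdjL)} {φ : Measure (Config AdjL)}
    (h : WeakLim AdjL μ φ) {A : Set (Set Sq)} {F : Finset Sq} (hA : Dep A F) :
    Tendsto (fun N => μ N (event A)) atTop (𝓝 (φ (event A))) := by
  classical
  have key : ∀ ν : Measure (Config AdjL), ν (event A) = ∑ η ∈ Finset.univ.filter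
      (fun η : {e // e ∈ F.image diag} → Bool => opens (extendBy AdjL (F.image diag) η) ∈ A),
      ν (cylinder AdjL (F.image diag) η) := by
    intro ν
    rw [event_eq_biUnion hA]
    refine measure_biUnion_finset (fun η _ η' _ hne => ?_) fun η _ => measurableSet_cylinder _ η
    refine Set.disjoint_left.2 fun ω h1 h2 => hne ?_
    funext e
    exact (h1 e).symm.trans (h2 e)
  simp only [key]
  exact tendsto_finsetSum _ fun η _ => h _ η

lemma pr_eq {q : ℝ} (hq : 1 ≤ q) (N : ℕ) {A : Set (Set Sq)} {F : Finset Sq} (hA : Dep A F) :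
    (((fkFin AdjL (pc q) q 4 (hpDomain N) (inducedBC AdjL 4 (hpDomain N) tau10)).map
      (extendBy AdjL (hpDomain N))) (event A)).toReal = pr (√q) N A := by
  classical
  have hX : 1 ≤ √q := Real.one_le_sqrt.2 hq
  set D := hpDomain (N : ℤ)
  set w := fkWeight AdjL (pc q) q 4 D (inducedBC AdjL 4 D tau10) with hw
  have hw0 : ∀ η, 0 ≤ w η := fun η => by
    rw [hw, fkWeight_eq hq]
    exact (wt_pos hX _ _).le
  have hm := measurable_extendBy D (measurableSet_event hA)
  have hsum : ∑ η, ENNReal.ofReal (w η) = ENNReal.ofReal (mass (√q) N Set.univ) := by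
    rw [← sum_fkWeight hq N Set.univ, ENNReal.ofReal_sum_of_nonneg fun η _ => hw0 η]
    simp [hw, D]
  have hsumA : ∑ η, ENNReal.ofReal (w η) * Measure.dirac η (extendBy AdjL D ⁻¹' event A) =
      ENNReal.ofReal (mass (√q) N A) := by
    rw [← sum_fkWeight hq N A, ENNReal.ofReal_sum_of_nonneg fun η _ => hw0 η, Finset.sum_filter]
    refine Finset.sum_congr rfl fun η _ => ?_
    rw [Measure.dirac_apply' _ hm]
    by_cases h : opens (extendBy AdjL D η) ∈ A
    · rw [if_pos h, Set.indicator_of_mem (show η ∈ extendBy AdjL D ⁻¹' event A from h)]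
      simp
    · rw [if_neg h, Set.indicator_of_notMem (show η ∉ extendBy AdjL D ⁻¹' event A from h)]
      simp
  rw [Measure.map_apply (measurable_extendBy D) (measurableSet_event hA), fkFin,
    Measure.smul_apply, Measure.finsetSum_apply]
  simp only [Measure.smul_apply, smul_eq_mul]
  rw [← hw, hsum, hsumA, ENNReal.toReal_mul, ENNReal.toReal_inv,
    ENNReal.toReal_ofReal (mass_nonneg hX _ _), ENNReal.toReal_ofReal (mass_nonneg hX _ _), pr,
    div_eq_inv_mul]

lemma isLimit_of_isHPDobrushin {q : ℝ} (hq : 1 ≤ q) {φ : Measure (Config AdjL)}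
    (hφ : IsHPDobrushin (pc q) q φ) : IsLimit (√q) fun A => (φ (event A)).toReal where
  one_le := Real.one_le_sqrt.2 hq
  tendsto A F hA := by
    have := hφ.1
    refine ((ENNReal.tendsto_toReal (measure_ne_top φ _)).comp (tendsto_event hφ.2 hA)).congr
      fun N => ?_
    exact pr_eq hq N hA

lemma infCluster_subset_arm (n : ℕ) :
    {ω | InfCluster AdjL ω HPedges ((0, 0) : V)} ⊆ event (arm n 0) := by
  intro ω hω
  have hsub : {s | diag s ∈ HPedges ∧ ω (diag s) = true} ⊆ opens ω := fun s hs => hs.2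
  have hHs : {s | diag s ∈ HPedges ∧ ω (diag s) = true} ⊆ Hs := fun s hs =>
    diag_mem_HPedges.1 hs.1
  refine isUpperSet_reach _ _ _ hsub ?_
  obtain ⟨w, hw, hwn⟩ := Set.Infinite.exists_notMem_finset hω
    (Finset.Icc (-(n : ℤ)) n ×ˢ Finset.Icc (0 : ℤ) n)
  have hc := connectedIn_iff.1 hw
  refine arm_of_conn hHs ?_ hc
  have h0 : 0 ≤ w.2 := by
    rcases conn_end hc with rfl | ⟨s, hs, a, hj⟩
    · exact le_rfl
    · have h1 : 0 ≤ s.2 := hHs hs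
      have h2 := joins_iff.1 hj
      omega
  rw [Finset.mem_product, Finset.mem_Icc, Finset.mem_Icc] at hwn
  show (n : ℤ) ≤ |w.1 - 0| ∨ (n : ℤ) ≤ w.2
  rw [le_abs']
  omega

end SquareModel

open FK in
/-- **Theorem.** Under the infinite-volume FK measure on the upper half-plane with
Dobrushin boundary conditions at the self-dual point `p_c(q) = √q/(1+√q)`, the origin is
almost surely not in an infinite cluster of the upper half-plane. -/
theorem no_percolation_halfplane_dobrushin (q : ℝ) (hq : 1 ≤ q)
    (φ : Measure (Config AdjL)) (hφ : IsHPDobrushin (pc q) q φ) :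
    φ {ω | InfCluster AdjL ω HPedges ((0, 0) : V)} = 0 := by
  have := hφ.1
  by_contra h
  refine (SquareModel.isLimit_of_isHPDobrushin hq hφ).not_forall_le_arm
    (ENNReal.toReal_pos h (measure_ne_top φ _)) fun n => ?_
  exact ENNReal.toReal_mono (measure_ne_top φ _)
    (measure_mono (SquareModel.infCluster_subset_arm n))
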